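/- Let B ⊂ ℝ² be the open unit ball, and let b, C, A > 0, 1/2 < s ≤ 1 and ε > 0. There exists a constant c = c(b, C, A, s, ε) with the following property: for every pair (u, V) where u is C² on B and continuous on the closed ball, V is a function on the closed ball with 0 ≤ V ≤ b and |V(x) − V(y)| ≤ A|x − y|^s for all x, y, and −Δu = V e^{u} in B, u = 0 on ∂B, ∫_B e^{u} dy ≤ C, and ∫_B V e^{u} dy ≤ 40π − ε, one has sup_B u ≤ c. -/

import Mathlib

open MeasureTheory Metric Real

/-- The Laplacian on `ℝ²`: `Δu = ∂²u/∂x₁² + ∂²u/∂x₂²`. -/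
noncomputable def lap (u : EuclideanSpace ℝ (Fin 2) → ℝ) (x : EuclideanSpace ℝ (Fin 2)) : ℝ :=
  ∑ i : Fin 2,
    fderiv ℝ (fun y => fderiv ℝ u y (EuclideanSpace.single i 1)) x (EuclideanSpace.single i 1)

open scoped RealInnerProductSpace Topology

/-- The Euclidean plane. -/
abbrev Plane := EuclideanSpace ℝ (Fin 2)

/-! ### The Green function of the unit disc -/

/-- The squared distance from `‖y‖ • x` to the unit vector in the direction of `y`. -/
noncomputable def greenDisc (x y : Plane) : ℝ := ‖x - y‖ ^ 2 + (1 - ‖x‖ ^ 2) * (1 - ‖y‖ ^ 2)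

/-- `4π` times the Green function of the unit disc. -/
noncomputable def greenLog (x y : Plane) : ℝ := log (greenDisc x y) - log (‖x - y‖ ^ 2)

/-- The gradient of `greenLog` in the first variable. -/
noncomputable def greenGrad (x y : Plane) : Plane :=
  (2 / greenDisc x y) • ((x - y) - (1 - ‖y‖ ^ 2) • x) - (2 / ‖x - y‖ ^ 2) • (x - y)

lemma greenDisc_comm (x y : Plane) : greenDisc x y = greenDisc y x := by
  simp only [greenDisc, norm_sub_rev x y]; ring

lemma greenDisc_eq (x y : Plane) :
    greenDisc x y = 1 - 2 * ⟪x, y⟫ + ‖x‖ ^ 2 * ‖y‖ ^ 2 := by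
  rw [greenDisc, norm_sub_sq_real]; ring

section GreenBounds

variable {x y : Plane}

lemma one_sub_norm_sq_pos (hx : ‖x‖ < 1) : 0 < 1 - ‖x‖ ^ 2 := by
  nlinarith [norm_nonneg x]

lemma norm_sub_sq_le_greenDisc (hx : ‖x‖ < 1) (hy : ‖y‖ < 1) : ‖x - y‖ ^ 2 ≤ greenDisc x y := by
  have := mul_pos (one_sub_norm_sq_pos hx) (one_sub_norm_sq_pos hy)
  rw [greenDisc]; linarith

lemma greenDisc_pos (hx : ‖x‖ < 1) (hy : ‖y‖ < 1) : 0 < greenDisc x y := by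
  have := mul_pos (one_sub_norm_sq_pos hx) (one_sub_norm_sq_pos hy)
  rw [greenDisc]; positivity

lemma one_sub_norm_sq_le_greenDisc (hx : ‖x‖ ≤ 1) (hy : ‖y‖ ≤ 1) :
    (1 - ‖x‖) ^ 2 ≤ greenDisc x y := by
  have h := real_inner_le_norm x y
  have hx0 := norm_nonneg x
  have hy0 := norm_nonneg y
  have h2 : (1 - ‖x‖ * ‖y‖) ^ 2 ≤ greenDisc x y := by rw [greenDisc_eq]; nlinarith
  have h3 : 1 - ‖x‖ ≤ 1 - ‖x‖ * ‖y‖ := by nlinarith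
  have h4 : (1 - ‖x‖) ^ 2 ≤ (1 - ‖x‖ * ‖y‖) ^ 2 := by
    apply pow_le_pow_left₀ _ h3; linarith
  linarith

lemma one_sub_norm_sq_le_add (hx : ‖x‖ < 1) (hy : ‖y‖ < 1) :
    1 - ‖y‖ ^ 2 ≤ (1 - ‖x‖ ^ 2) + 2 * ‖x - y‖ := by
  have h := abs_le.1 (abs_norm_sub_norm_le x y)
  nlinarith [norm_nonneg x, norm_nonneg y, norm_nonneg (x - y)]

lemma greenLog_nonneg (hx : ‖x‖ < 1) (hy : ‖y‖ < 1) (hxy : x ≠ y) : 0 ≤ greenLog x y := by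
  have h0 : 0 < ‖x - y‖ := norm_sub_pos_iff.2 hxy
  have := log_le_log (by positivity) (norm_sub_sq_le_greenDisc hx hy)
  rw [greenLog]; linarith

lemma greenLog_le (hx : ‖x‖ < 1) (hy : ‖y‖ < 1) (hxy : x ≠ y) :
    greenLog x y ≤ 4 * (1 - ‖x‖) * ‖x - y‖⁻¹ := by
  have h0 : 0 < ‖x - y‖ := norm_sub_pos_iff.2 hxy
  set d := ‖x - y‖ with hd
  have hx0 := norm_nonneg x
  have h1 : greenDisc x y ≤ (d + 2 * (1 - ‖x‖)) ^ 2 := by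
    have h := one_sub_norm_sq_le_add hx hy
    have hx1 := one_sub_norm_sq_pos hx
    have h2 : 1 - ‖x‖ ^ 2 ≤ 2 * (1 - ‖x‖) := by nlinarith
    rw [greenDisc]
    rw [← hd] at h ⊢
    have : (1 - ‖x‖ ^ 2) * (1 - ‖y‖ ^ 2) ≤ (2 * (1 - ‖x‖)) * (2 * (1 - ‖x‖) + 2 * d) := by
      apply mul_le_mul h2 (by linarith) (one_sub_norm_sq_pos hy).le (by linarith)
    nlinarith
  have h3 : greenLog x y = log (greenDisc x y / d ^ 2) := by
    rw [greenLog, log_div (greenDisc_pos hx hy).ne' (by positivity)]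
  rw [h3]
  have h4 : greenDisc x y / d ^ 2 ≤ (1 + 2 * (1 - ‖x‖) * d⁻¹) ^ 2 := by
    rw [div_le_iff₀ (by positivity), ← mul_pow]
    rwa [add_mul, one_mul, mul_assoc, inv_mul_cancel₀ h0.ne', mul_one]
  have hp : 0 ≤ 2 * (1 - ‖x‖) * d⁻¹ := by
    have : 0 ≤ 1 - ‖x‖ := by linarith
    positivity
  calc log (greenDisc x y / d ^ 2) ≤ log ((1 + 2 * (1 - ‖x‖) * d⁻¹) ^ 2) :=
        log_le_log (div_pos (greenDisc_pos hx hy) (by positivity)) h4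
    _ = 2 * log (1 + 2 * (1 - ‖x‖) * d⁻¹) := by rw [log_pow]; norm_num
    _ ≤ 4 * (1 - ‖x‖) * d⁻¹ := by
        have := log_le_sub_one_of_pos (show 0 < 1 + 2 * (1 - ‖x‖) * d⁻¹ by linarith)
        linarith

lemma abs_greenLog_le (hx : ‖x‖ < 1) (hy : ‖y‖ < 1) (hxy : x ≠ y) :
    |greenLog x y| ≤ 4 * ‖x - y‖⁻¹ := by
  rw [abs_of_nonneg (greenLog_nonneg hx hy hxy)]
  refine (greenLog_le hx hy hxy).trans ?_
  have : 4 * (1 - ‖x‖) ≤ 4 := by linarith [norm_nonneg x]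
  gcongr

lemma norm_greenGrad_le (hx : ‖x‖ < 1) (hy : ‖y‖ < 1) (hxy : x ≠ y) :
    ‖greenGrad x y‖ ≤ 12 * ‖x - y‖⁻¹ := by
  have h0 : 0 < ‖x - y‖ := norm_sub_pos_iff.2 hxy
  have hD := greenDisc_pos hx hy
  have hx1 := one_sub_norm_sq_pos hx
  have hy1 := one_sub_norm_sq_pos hy
  set d := ‖x - y‖ with hd
  have hnum : ‖(x - y) - (1 - ‖y‖ ^ 2) • x‖ ≤ d + (1 - ‖y‖ ^ 2) := by
    refine (norm_sub_le _ _).trans ?_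
    rw [norm_smul, Real.norm_of_nonneg hy1.le]
    nlinarith
  have h1 := norm_sub_sq_le_greenDisc hx hy
  rw [← hd] at h1
  have h2 : (1 - ‖y‖ ^ 2) * d ≤ 4 * greenDisc x y := by
    have h := one_sub_norm_sq_le_add hx hy
    rw [← hd] at h
    by_cases hc : 1 - ‖y‖ ^ 2 ≤ 4 * d
    · nlinarith
    · push Not at hc
      have : greenDisc x y = d ^ 2 + (1 - ‖x‖ ^ 2) * (1 - ‖y‖ ^ 2) := rfl
      have hh : (1 - ‖y‖ ^ 2) / 2 ≤ 1 - ‖x‖ ^ 2 := by linarith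
      nlinarith
  have hA : ‖(2 / greenDisc x y) • ((x - y) - (1 - ‖y‖ ^ 2) • x)‖ ≤ 10 * d⁻¹ := by
    rw [norm_smul, Real.norm_of_nonneg (by positivity), div_mul_eq_mul_div,
      div_le_iff₀ hD, mul_comm (10 : ℝ), mul_assoc, ← div_eq_inv_mul, le_div_iff₀ h0]
    nlinarith
  have hB : ‖(2 / d ^ 2) • (x - y)‖ = 2 * d⁻¹ := by
    rw [norm_smul, Real.norm_of_nonneg (by positivity), ← hd]; field_simp
  calc ‖greenGrad x y‖ ≤ _ := norm_sub_le _ _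
    _ ≤ 10 * d⁻¹ + 2 * d⁻¹ := by rw [← hd, hB]; gcongr
    _ = 12 * d⁻¹ := by ring

lemma inner_greenGrad_add (hx : ‖x‖ < 1) (hy : ‖y‖ < 1) (hxy : x ≠ y) :
    ⟪x, greenGrad x y⟫ + ⟪y, greenGrad y x⟫ =
      -(2 * (1 - ‖x‖ ^ 2 * ‖y‖ ^ 2) / greenDisc x y) := by
  have h0 : 0 < ‖x - y‖ := norm_sub_pos_iff.2 hxy
  have hD := greenDisc_pos hx hy
  have hD' := greenDisc_eq x y
  have hd := norm_sub_sq_real x y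
  have hd0 : 0 < ‖x - y‖ ^ 2 := by positivity
  rw [greenGrad, greenGrad, greenDisc_comm y x, norm_sub_rev y x]
  simp only [inner_sub_right, inner_smul_right, real_inner_self_eq_norm_sq, real_inner_comm x y]
  set D := greenDisc x y
  set n := ‖x - y‖ ^ 2
  set t := ⟪x, y⟫
  field_simp
  rw [hD', hd]
  ring

lemma measurable_greenDisc : Measurable fun p : Plane × Plane => greenDisc p.1 p.2 := by
  unfold greenDisc; fun_prop

lemma measurable_greenLog : Measurable fun p : Plane × Plane => greenLog p.1 p.2 := by
  have := measurable_greenDisc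
  unfold greenLog; fun_prop

lemma measurable_greenGrad : Measurable fun p : Plane × Plane => greenGrad p.1 p.2 := by
  have := measurable_greenDisc
  unfold greenGrad; fun_prop

end GreenBounds

/-! ### The kernel `‖x - y‖⁻¹` -/

/-- The open unit disc. -/
abbrev unitDisc : Set Plane := ball 0 1

/-- Lebesgue measure on the unit disc. -/
noncomputable abbrev discMeasure : Measure Plane := volume.restrict unitDisc

lemma volume_real_ball_plane {r : ℝ} (hr : 0 ≤ r) (x : Plane) :
    volume.real (ball x r) = π * r ^ 2 := by
  rw [measureReal_def, EuclideanSpace.volume_ball]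
  simp only [Fintype.card_fin, Nat.cast_ofNat, ENNReal.toReal_mul, ENNReal.toReal_pow]
  rw [ENNReal.toReal_ofReal hr, ENNReal.toReal_ofReal (by positivity)]
  norm_num
  rw [Real.sq_sqrt pi_pos.le]
  ring

lemma volume_real_closedBall_plane {r : ℝ} (hr : 0 ≤ r) (x : Plane) :
    volume.real (closedBall x r) = π * r ^ 2 := by
  rw [measureReal_def, Measure.addHaar_closedBall_eq_addHaar_ball, ← measureReal_def,
    volume_real_ball_plane hr]

lemma indicator_inv_norm (r : ℝ) :
    (ball (0 : Plane) r).indicator (fun y => ‖y‖⁻¹) =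
      fun y => (Set.Iio r).indicator (fun t : ℝ => t⁻¹) ‖y‖ := by
  ext y
  simp [Set.indicator]

lemma radial_profile_inv (r : ℝ) :
    Set.EqOn (fun y : ℝ => y ^ (Module.finrank ℝ Plane - 1) • (Set.Iio r).indicator
      (fun t : ℝ => t⁻¹) y) ((Set.Iio r).indicator fun _ => (1 : ℝ)) (Set.Ioi 0) := by
  intro y (hy : 0 < y)
  by_cases h : y < r <;> simp [Set.indicator, h, hy.ne']

lemma integrableOn_inv_norm_ball_zero (r : ℝ) :
    IntegrableOn (fun y : Plane => ‖y‖⁻¹) (ball 0 r) := by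
  rw [← integrable_indicator_iff measurableSet_ball, indicator_inv_norm,
    integrable_fun_norm_addHaar volume, integrableOn_congr_fun (radial_profile_inv r)
    measurableSet_Ioi, integrableOn_indicator_iff measurableSet_Iio]
  refine integrableOn_const ?_
  rw [Set.inter_comm, Set.Ioi_inter_Iio]
  simp

lemma integral_inv_norm_ball_zero {r : ℝ} (hr : 0 ≤ r) :
    ∫ y in ball (0 : Plane) r, ‖y‖⁻¹ = 2 * π * r := by
  rw [← integral_indicator measurableSet_ball, indicator_inv_norm,
    integral_fun_norm_addHaar volume, setIntegral_congr_fun measurableSet_Ioi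
    (radial_profile_inv r), setIntegral_indicator measurableSet_Iio, Set.Ioi_inter_Iio,
    volume_real_ball_plane zero_le_one]
  simp [hr]
  ring

lemma integrableOn_inv_norm_sub_ball (x : Plane) (r : ℝ) :
    IntegrableOn (fun y : Plane => ‖x - y‖⁻¹) (ball x r) := by
  have h := (integrableOn_inv_norm_ball_zero r)
  rw [← integrable_indicator_iff measurableSet_ball] at h ⊢
  refine (h.comp_sub_left x).congr (ae_of_all _ fun y => ?_)
  simp [Set.indicator, dist_eq_norm, norm_sub_rev x y]

lemma setIntegral_inv_norm_sub_ball (x : Plane) {r : ℝ} (hr : 0 ≤ r) :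
    ∫ y in ball x r, ‖x - y‖⁻¹ = 2 * π * r := by
  rw [← integral_inv_norm_ball_zero hr, ← integral_indicator measurableSet_ball,
    ← integral_indicator measurableSet_ball, ← integral_sub_left_eq_self _ volume x]
  congr 1 with y
  simp [Set.indicator, dist_eq_norm]

lemma integrable_inv_norm_sub {x : Plane} (hx : ‖x‖ < 1) :
    Integrable (fun y : Plane => ‖x - y‖⁻¹) discMeasure := by
  refine (integrableOn_inv_norm_sub_ball x 2).mono_set fun y hy => ?_
  have : ‖y‖ < 1 := mem_ball_zero_iff.1 hy
  rw [mem_ball, dist_eq_norm]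
  linarith [norm_sub_le y x]

lemma integral_inv_norm_sub_le {x : Plane} (hx : ‖x‖ < 1) :
    ∫ y, ‖x - y‖⁻¹ ∂discMeasure ≤ 4 * π := by
  calc ∫ y, ‖x - y‖⁻¹ ∂discMeasure ≤ ∫ y in ball x 2, ‖x - y‖⁻¹ := by
        refine setIntegral_mono_set (integrableOn_inv_norm_sub_ball x 2)
          (ae_of_all _ fun y => by positivity) (Filter.Eventually.of_forall fun y hy => ?_)
        have : ‖y‖ < 1 := mem_ball_zero_iff.1 hy
        change y ∈ ball x 2
        rw [mem_ball, dist_eq_norm]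
        linarith [norm_sub_le y x]
    _ = 4 * π := by rw [setIntegral_inv_norm_sub_ball x zero_le_two]; ring

instance : IsFiniteMeasure discMeasure :=
  ⟨by simp⟩

lemma ae_norm_lt_one : ∀ᵐ x ∂discMeasure, ‖x‖ < 1 := by
  filter_upwards [ae_restrict_mem (measurableSet_ball (x := (0 : Plane)) (ε := 1))] with x hx
  simpa using hx

lemma ae_ne_discMeasure (x : Plane) : ∀ᵐ y ∂discMeasure, x ≠ y := by
  refine ae_restrict_of_ae ?_
  filter_upwards [compl_mem_ae_iff.2 (measure_singleton (μ := volume) x)] with y hy h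
  exact hy (by simp [h])

lemma integrable_inv_norm_sub_prod :
    Integrable (fun p : Plane × Plane => ‖p.1 - p.2‖⁻¹) (discMeasure.prod discMeasure) := by
  have hm : AEStronglyMeasurable (fun p : Plane × Plane => ‖p.1 - p.2‖⁻¹)
      (discMeasure.prod discMeasure) := by
    apply Measurable.aestronglyMeasurable; fun_prop
  rw [integrable_prod_iff hm]
  constructor
  · filter_upwards [ae_norm_lt_one] with x hx using integrable_inv_norm_sub hx
  · refine Integrable.mono' (integrable_const (4 * π)) hm.norm.integral_prod_right' ?_
    filter_upwards [ae_norm_lt_one] with x hx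
    rw [Real.norm_of_nonneg (by positivity)]
    simpa using integral_inv_norm_sub_le hx

lemma ae_prod_norm_lt_one : ∀ᵐ p ∂(discMeasure.prod discMeasure),
    ‖p.1‖ < 1 ∧ ‖p.2‖ < 1 ∧ p.1 ≠ p.2 := by
  have h : MeasurableSet {p : Plane × Plane | ‖p.1‖ < 1 ∧ ‖p.2‖ < 1 ∧ p.1 ≠ p.2} := by
    exact ((isOpen_lt continuous_fst.norm continuous_const).inter
      ((isOpen_lt continuous_snd.norm continuous_const).inter
      (isOpen_ne_fun continuous_fst continuous_snd))).measurableSet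
  rw [Measure.ae_prod_iff_ae_ae h]
  filter_upwards [ae_norm_lt_one] with x hx
  filter_upwards [ae_norm_lt_one, ae_ne_discMeasure x] with y hy hxy using ⟨hx, hy, hxy⟩

/-- A kernel dominated by `‖x - y‖⁻¹` is integrable on the product of the disc with itself. -/
lemma integrable_prod_of_le_inv {k : Plane × Plane → ℝ} {c : ℝ}
    (hk : AEStronglyMeasurable k (discMeasure.prod discMeasure))
    (hle : ∀ x y, ‖x‖ < 1 → ‖y‖ < 1 → x ≠ y → |k (x, y)| ≤ c * ‖x - y‖⁻¹) :
    Integrable k (discMeasure.prod discMeasure) := by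
  refine (integrable_inv_norm_sub_prod.const_mul c).mono' hk ?_
  filter_upwards [ae_prod_norm_lt_one] with p hp
  exact hle p.1 p.2 hp.1 hp.2.1 hp.2.2

lemma integrable_of_le_inv {k : Plane → ℝ} {c : ℝ} {x : Plane} (hx : ‖x‖ < 1)
    (hk : AEStronglyMeasurable k discMeasure)
    (hle : ∀ y, ‖y‖ < 1 → x ≠ y → |k y| ≤ c * ‖x - y‖⁻¹) :
    Integrable k discMeasure := by
  refine ((integrable_inv_norm_sub hx).const_mul c).mono' hk ?_
  filter_upwards [ae_norm_lt_one, ae_ne_discMeasure x] with y hy hxy using hle y hy hxy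

/-! ### Integration by parts and Laplacians of compositions with quadratic functions -/

section IntegrationByParts

variable {Ω : Set Plane} {ψ w : Plane → ℝ}

lemma integrable_mul_of_tsupport (hψ : ContinuousOn ψ Ω) (hw : ContinuousOn w Ω)
    (hc : HasCompactSupport ψ) (hs : tsupport ψ ⊆ Ω) : Integrable fun x => ψ x * w x := by
  have h : IntegrableOn (fun x => ψ x * w x) (tsupport ψ) :=
    ((hψ.mono hs).mul (hw.mono hs)).integrableOn_compact hc
  refine (integrableOn_iff_integrable_of_support_subset fun x hx => ?_).1 h
  exact subset_tsupport ψ (left_ne_zero_of_mul hx)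

lemma continuousOn_fderiv_apply (hΩ : IsOpen Ω) (hψ : ContDiffOn ℝ 1 ψ Ω) (v : Plane) :
    ContinuousOn (fun x => fderiv ℝ ψ x v) Ω :=
  (hψ.continuousOn_fderiv_of_isOpen hΩ le_rfl).clm_apply continuousOn_const

lemma integral_mul_fderiv_of_tsupport (hΩ : IsOpen Ω) (hψ : ContDiffOn ℝ 1 ψ Ω)
    (hw : ContDiffOn ℝ 1 w Ω) (hc : HasCompactSupport ψ) (hs : tsupport ψ ⊆ Ω) (v : Plane) :
    ∫ x, ψ x * fderiv ℝ w x v = -∫ x, fderiv ℝ ψ x v * w x := by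
  have hs' := (tsupport_fderiv_apply_subset ℝ (f := ψ) v).trans hs
  have hc' : HasCompactSupport fun x => fderiv ℝ ψ x v :=
    hc.of_isClosed_subset (isClosed_tsupport _) (tsupport_fderiv_apply_subset ℝ (f := ψ) v)
  refine integral_mul_fderiv_eq_neg_fderiv_mul_of_integrable
    (integrable_mul_of_tsupport (continuousOn_fderiv_apply hΩ hψ v) hw.continuousOn hc' hs')
    (integrable_mul_of_tsupport hψ.continuousOn (continuousOn_fderiv_apply hΩ hw v) hc hs)
    (integrable_mul_of_tsupport hψ.continuousOn hw.continuousOn hc hs) (fun x _ => ?_)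
    fun x hx => (hw.differentiableOn one_ne_zero).differentiableAt (hΩ.mem_nhds (hs hx))
  by_cases hx : x ∈ tsupport ψ
  · exact (hψ.differentiableOn one_ne_zero).differentiableAt (hΩ.mem_nhds (hs hx))
  · exact (differentiableAt_const (0 : ℝ)).congr_of_eventuallyEq
      (notMem_tsupport_iff_eventuallyEq.1 hx)

lemma contDiffOn_fderiv_apply (hΩ : IsOpen Ω) (hψ : ContDiffOn ℝ 2 ψ Ω) (v : Plane) :
    ContDiffOn ℝ 1 (fun x => fderiv ℝ ψ x v) Ω :=
  (hψ.fderiv_of_isOpen hΩ (by norm_num)).clm_apply contDiffOn_const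

lemma continuousOn_lap (hΩ : IsOpen Ω) (hψ : ContDiffOn ℝ 2 ψ Ω) : ContinuousOn (lap ψ) Ω :=
  continuousOn_finsetSum _ fun _ _ =>
    continuousOn_fderiv_apply hΩ (contDiffOn_fderiv_apply hΩ hψ _) _

lemma integral_mul_lap (hΩ : IsOpen Ω) (hψ : ContDiffOn ℝ 2 ψ Ω) (hw : ContDiffOn ℝ 2 w Ω)
    (hc : HasCompactSupport ψ) (hs : tsupport ψ ⊆ Ω) :
    ∫ x, ψ x * lap w x = ∫ x, lap ψ x * w x := by
  have h1 : (1 : WithTop ℕ∞) ≤ 2 := by norm_num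
  have hd (v : Plane) := contDiffOn_fderiv_apply hΩ hψ v
  have hdw (v : Plane) := contDiffOn_fderiv_apply hΩ hw v
  have hs' (v : Plane) := (tsupport_fderiv_apply_subset ℝ (f := ψ) v).trans hs
  have hc' (v : Plane) : HasCompactSupport fun x => fderiv ℝ ψ x v :=
    hc.of_isClosed_subset (isClosed_tsupport _) (tsupport_fderiv_apply_subset ℝ (f := ψ) v)
  have hs'' (v : Plane) := (tsupport_fderiv_apply_subset ℝ (f := fun x => fderiv ℝ ψ x v) v).trans (hs' v)
  have hc'' (v : Plane) : HasCompactSupport fun x => fderiv ℝ (fun x => fderiv ℝ ψ x v) x v :=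
    (hc' v).of_isClosed_subset (isClosed_tsupport _) (tsupport_fderiv_apply_subset ℝ v)
  simp only [lap, Finset.mul_sum, Finset.sum_mul]
  rw [integral_finsetSum, integral_finsetSum]
  · refine Finset.sum_congr rfl fun i _ => ?_
    rw [integral_mul_fderiv_of_tsupport hΩ (hψ.of_le h1) (hdw _) hc hs,
      integral_mul_fderiv_of_tsupport hΩ (hd _) (hw.of_le h1) (hc' _) (hs' _), neg_neg]
  · exact fun i _ => integrable_mul_of_tsupport (continuousOn_fderiv_apply hΩ (hd _) _)
      hw.continuousOn (hc'' _) (hs'' _)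
  · exact fun i _ => integrable_mul_of_tsupport hψ.continuousOn
      (continuousOn_fderiv_apply hΩ (hdw _) _) hc hs

end IntegrationByParts

section Calculus

variable {f g : Plane → ℝ} {x : Plane}

lemma lap_sub (hf : ContDiffAt ℝ 2 f x) (hg : ContDiffAt ℝ 2 g x) :
    lap (fun y => f y - g y) x = lap f x - lap g x := by
  have hd {h : Plane → ℝ} (hh : ContDiffAt ℝ 2 h x) (v : Plane) :
      DifferentiableAt ℝ (fun y => fderiv ℝ h y v) x :=
    ((hh.fderiv_right (m := 1) (by norm_num)).differentiableAt one_ne_zero).clm_apply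
      (differentiableAt_const _)
  have he {h : Plane → ℝ} (hh : ContDiffAt ℝ 2 h x) : ∀ᶠ y in 𝓝 x, DifferentiableAt ℝ h y :=
    (hh.eventually (by simp)).mono fun y hy => hy.differentiableAt two_ne_zero
  simp only [lap, ← Finset.sum_sub_distrib]
  refine Finset.sum_congr rfl fun i _ => ?_
  have : (fun y => fderiv ℝ (fun y => f y - g y) y (EuclideanSpace.single i 1)) =ᶠ[𝓝 x]
      fun y => fderiv ℝ f y (EuclideanSpace.single i 1) -
        fderiv ℝ g y (EuclideanSpace.single i 1) := by
    filter_upwards [he hf, he hg] with y hy hy'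
    rw [fderiv_fun_sub hy hy', sub_apply]
  rw [this.fderiv_eq, fderiv_fun_sub (hd hf _) (hd hg _), sub_apply]

lemma lap_mul (hf : ContDiffAt ℝ 2 f x) (hg : ContDiffAt ℝ 2 g x) :
    lap (fun y => f y * g y) x = f x * lap g x + g x * lap f x +
      2 * ∑ i : Fin 2, fderiv ℝ f x (EuclideanSpace.single i 1) *
        fderiv ℝ g x (EuclideanSpace.single i 1) := by
  have hd {h : Plane → ℝ} (hh : ContDiffAt ℝ 2 h x) (v : Plane) :
      DifferentiableAt ℝ (fun y => fderiv ℝ h y v) x :=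
    ((hh.fderiv_right (m := 1) (by norm_num)).differentiableAt one_ne_zero).clm_apply
      (differentiableAt_const _)
  have he {h : Plane → ℝ} (hh : ContDiffAt ℝ 2 h x) : ∀ᶠ y in 𝓝 x, DifferentiableAt ℝ h y :=
    (hh.eventually (by simp)).mono fun y hy => hy.differentiableAt two_ne_zero
  simp only [lap, Finset.mul_sum, ← Finset.sum_add_distrib]
  refine Finset.sum_congr rfl fun i _ => ?_
  have : (fun y => fderiv ℝ (fun y => f y * g y) y (EuclideanSpace.single i 1)) =ᶠ[𝓝 x]
      fun y => f y * fderiv ℝ g y (EuclideanSpace.single i 1) +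
        g y * fderiv ℝ f y (EuclideanSpace.single i 1) := by
    filter_upwards [he hf, he hg] with y hy hy'
    rw [fderiv_fun_mul hy hy']; simp
  rw [this.fderiv_eq, fderiv_fun_add ((he hf).self_of_nhds.fun_mul (hd hg _))
    ((he hg).self_of_nhds.fun_mul (hd hf _)), fderiv_fun_mul (he hf).self_of_nhds (hd hg _),
    fderiv_fun_mul (he hg).self_of_nhds (hd hf _)]
  simp only [add_apply, smul_apply, smul_eq_mul]
  ring

/-- The quadratic function `a ‖y‖² - 2 ⟪p, y⟫ + c`. -/
noncomputable def quad (a : ℝ) (p : Plane) (c : ℝ) (y : Plane) : ℝ :=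
  a * ‖y‖ ^ 2 - 2 * ⟪p, y⟫ + c

variable {a c : ℝ} {p : Plane} {φ : ℝ → ℝ}

lemma hasFDerivAt_quad (a : ℝ) (p : Plane) (c : ℝ) (y : Plane) :
    HasFDerivAt (quad a p c) (innerSL ℝ ((2 : ℝ) • (a • y - p))) y := by
  have h1 : HasFDerivAt (fun y : Plane => ‖y‖ ^ 2) _ y := (hasStrictFDerivAt_norm_sq y).hasFDerivAt
  have h2 : HasFDerivAt (fun y : Plane => ⟪p, y⟫) (innerSL ℝ p) y := (innerSL ℝ p).hasFDerivAt
  refine (((h1.const_mul a).sub (h2.const_mul 2)).add_const c).congr_fderiv ?_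
  ext v
  simp
  ring

lemma contDiff_quad {n : WithTop ℕ∞} (a : ℝ) (p : Plane) (c : ℝ) : ContDiff ℝ n (quad a p c) :=
  ((contDiff_const.mul (contDiff_norm_sq ℝ)).sub
    (contDiff_const.mul (contDiff_const.inner ℝ contDiff_id))).add contDiff_const

lemma fderiv_comp_quad (hφ : DifferentiableAt ℝ φ (quad a p c x)) (v : Plane) :
    fderiv ℝ (fun y => φ (quad a p c y)) x v =
      deriv φ (quad a p c x) * (2 * ⟪a • x - p, v⟫) := by
  have h := hφ.hasDerivAt.comp_hasFDerivAt x (hasFDerivAt_quad a p c x)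
  rw [show (fun y => φ (quad a p c y)) = φ ∘ quad a p c from rfl, h.fderiv]
  simp [inner_sub_left, inner_smul_left]

lemma sum_inner_single_mul (v w : Plane) :
    ∑ i : Fin 2, ⟪v, EuclideanSpace.single i 1⟫ * ⟪w, EuclideanSpace.single i 1⟫ = ⟪v, w⟫ := by
  simp [PiLp.inner_apply, mul_comm]

lemma lap_comp_quad (hφ : ContDiffAt ℝ 2 φ (quad a p c x)) :
    lap (fun y => φ (quad a p c y)) x =
      4 * deriv (deriv φ) (quad a p c x) * ‖a • x - p‖ ^ 2 +
        4 * a * deriv φ (quad a p c x) := by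
  have hq := (hasFDerivAt_quad a p c x).continuousAt
  have he : ∀ᶠ y in 𝓝 x, DifferentiableAt ℝ φ (quad a p c y) :=
    hq.eventually ((hφ.eventually (by simp)).mono fun y hy => hy.differentiableAt two_ne_zero)
  have hd : DifferentiableAt ℝ (deriv φ) (quad a p c x) :=
    ((hφ.fderiv_right (m := 1) (by norm_num)).differentiableAt one_ne_zero).clm_apply
      (differentiableAt_const 1)
  have h (i : Fin 2) : fderiv ℝ (fun y => fderiv ℝ (fun y => φ (quad a p c y)) y
      (EuclideanSpace.single i 1)) x (EuclideanSpace.single i 1) =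
      4 * deriv (deriv φ) (quad a p c x) * (⟪a • x - p, EuclideanSpace.single i 1⟫ *
        ⟪a • x - p, EuclideanSpace.single i 1⟫) + 2 * a * deriv φ (quad a p c x) := by
    have h1 : (fun y => fderiv ℝ (fun y => φ (quad a p c y)) y (EuclideanSpace.single i 1)) =ᶠ[𝓝 x]
        fun y => deriv φ (quad a p c y) * (2 * ⟪a • y - p, EuclideanSpace.single i 1⟫) := by
      filter_upwards [he] with y hy using fderiv_comp_quad hy _
    have h2 : HasFDerivAt (fun y : Plane => 2 * ⟪a • y - p, EuclideanSpace.single i (1 : ℝ)⟫)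
        ((2 * a) • innerSL ℝ (EuclideanSpace.single i (1 : ℝ))) x := by
      have : (fun y : Plane => 2 * ⟪a • y - p, EuclideanSpace.single i (1 : ℝ)⟫) =
          fun y => ((2 * a) • innerSL ℝ (EuclideanSpace.single i (1 : ℝ))) y -
            2 * ⟪p, EuclideanSpace.single i (1 : ℝ)⟫ := by
        ext y
        simp [inner_sub_left, inner_smul_left, real_inner_comm]
        ring
      rw [this]
      exact (ContinuousLinearMap.hasFDerivAt _).sub_const _
    have h3 := (hd.hasDerivAt.comp_hasFDerivAt x (hasFDerivAt_quad a p c x)).mul h2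
    rw [h1.fderiv_eq]
    rw [show (fun y => deriv φ (quad a p c y) * (2 * ⟪a • y - p, EuclideanSpace.single i (1 : ℝ)⟫))
      = (deriv φ ∘ quad a p c) * fun y => 2 * ⟪a • y - p, EuclideanSpace.single i (1 : ℝ)⟫ from rfl,
      h3.fderiv]
    simp [inner_sub_left, inner_smul_left]
    ring
  rw [lap]
  simp_rw [h]
  rw [Finset.sum_add_distrib, ← Finset.mul_sum, sum_inner_single_mul, real_inner_self_eq_norm_sq]
  simp
  ring

lemma norm_smul_sub_sq_quad : ‖a • x - p‖ ^ 2 = a * quad a p c x + (‖p‖ ^ 2 - a * c) := by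
  rw [norm_sub_sq_real, norm_smul, quad, real_inner_smul_left, real_inner_comm, mul_pow,
    Real.norm_eq_abs, sq_abs]
  ring

lemma lap_log_quad (h : quad a p c x ≠ 0) :
    lap (fun y => log (quad a p c y)) x = 4 * (a * c - ‖p‖ ^ 2) / quad a p c x ^ 2 := by
  have hd : deriv (deriv log) (quad a p c x) = -(quad a p c x ^ 2)⁻¹ := by
    rw [Real.deriv_log', deriv_inv]
  rw [lap_comp_quad (contDiffAt_log.2 h), hd, Real.deriv_log, norm_smul_sub_sq_quad (c := c)]
  field_simp
  ring

end Calculus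

/-! ### Cutoff functions and the regularised Green function -/

lemma lap_congr {f g : Plane → ℝ} {x : Plane} (h : f =ᶠ[𝓝 x] g) : lap f x = lap g x := by
  simp only [lap]
  refine Finset.sum_congr rfl fun i _ => ?_
  have : (fun y => fderiv ℝ f y (EuclideanSpace.single i 1)) =ᶠ[𝓝 x]
      fun y => fderiv ℝ g y (EuclideanSpace.single i 1) := by
    filter_upwards [h.fderiv (𝕜 := ℝ)] with y hy using by rw [hy]
  rw [this.fderiv_eq]

lemma setIntegral_mul_lap {Ω : Set Plane} {ψ w : Plane → ℝ} (hΩ : IsOpen Ω)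
    (hψ : ContDiffOn ℝ 2 ψ Ω) (hw : ContDiffOn ℝ 2 w Ω)
    (hc : HasCompactSupport ψ) (hs : tsupport ψ ⊆ Ω) :
    ∫ x in Ω, ψ x * lap w x = ∫ x in Ω, lap ψ x * w x := by
  rw [setIntegral_eq_integral_of_forall_compl_eq_zero,
    setIntegral_eq_integral_of_forall_compl_eq_zero, integral_mul_lap hΩ hψ hw hc hs]
  · intro x hx
    rw [lap_congr (notMem_tsupport_iff_eventuallyEq.1 fun h => hx (hs h))]
    simp [lap]
  · intro x hx
    rw [image_eq_zero_of_notMem_tsupport fun h => hx (hs h), zero_mul]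

lemma smoothTransition_contDiff_two : ContDiff ℝ 2 smoothTransition :=
  smoothTransition.contDiff (n := 2)

lemma smoothTransition_eventuallyEq {t : ℝ} (ht : t ∉ Set.Icc (0 : ℝ) 1) :
    ∃ c : ℝ, smoothTransition =ᶠ[𝓝 t] fun _ => c := by
  rw [Set.mem_Icc, not_and_or, not_le, not_le] at ht
  rcases ht with ht | ht
  · refine ⟨0, ?_⟩
    filter_upwards [eventually_lt_nhds ht] with y hy using smoothTransition.zero_of_nonpos hy.le
  · refine ⟨1, ?_⟩
    filter_upwards [eventually_gt_nhds ht] with y hy using smoothTransition.one_of_one_le hy.le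

lemma deriv_smoothTransition_eq_zero {t : ℝ} (ht : t ∉ Set.Icc (0 : ℝ) 1) :
    deriv smoothTransition t = 0 ∧ deriv (deriv smoothTransition) t = 0 := by
  obtain ⟨c, hc⟩ := smoothTransition_eventuallyEq ht
  have h := hc.deriv
  refine ⟨by simpa using h.self_of_nhds, ?_⟩
  rw [h.deriv_eq]; simp

lemma exists_deriv_smoothTransition_le :
    ∃ K : ℝ, 0 ≤ K ∧ ∀ t, |deriv smoothTransition t| ≤ K ∧
      |deriv (deriv smoothTransition) t| ≤ K := by
  have h2 : ContDiff ℝ 1 (deriv smoothTransition) :=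
    (contDiff_succ_iff_deriv (n := 1).1 (by
      rw [one_add_one_eq_two]; exact smoothTransition_contDiff_two)).2.2
  have h3 : Continuous (deriv (deriv smoothTransition)) := h2.continuous_deriv le_rfl
  obtain ⟨K1, h1⟩ := isCompact_Icc.exists_bound_of_continuousOn (s := Set.Icc (0 : ℝ) 1)
    h2.continuous.continuousOn
  obtain ⟨K2, h2⟩ := isCompact_Icc.exists_bound_of_continuousOn (s := Set.Icc (0 : ℝ) 1)
    h3.continuousOn
  refine ⟨max 0 (max K1 K2), le_max_left _ _, fun t => ?_⟩
  by_cases ht : t ∈ Set.Icc (0 : ℝ) 1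
  · exact ⟨(h1 t ht).trans ((le_max_left _ _).trans (le_max_right _ _)),
      (h2 t ht).trans ((le_max_right _ _).trans (le_max_right _ _))⟩
  · rw [(deriv_smoothTransition_eq_zero ht).1, (deriv_smoothTransition_eq_zero ht).2]
    simp

/-- A smooth cutoff equal to `1` for `‖y‖² ≤ 1 - 2κ` and to `0` for `‖y‖² ≥ 1 - κ`. -/
noncomputable def discCutoff (κ : ℝ) (y : Plane) : ℝ :=
  smoothTransition (quad (-κ⁻¹) 0 ((1 - κ) / κ) y)

section Cutoff

variable {κ : ℝ} {y : Plane}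

lemma quad_discCutoff (hκ : 0 < κ) :
    quad (-κ⁻¹) 0 ((1 - κ) / κ) y = (1 - κ - ‖y‖ ^ 2) / κ := by
  rw [quad, inner_zero_left]; field_simp; ring

lemma contDiff_discCutoff (κ : ℝ) : ContDiff ℝ 2 (discCutoff κ) :=
  smoothTransition_contDiff_two.comp (contDiff_quad _ _ _)

lemma discCutoff_nonneg : 0 ≤ discCutoff κ y := smoothTransition.nonneg _

lemma discCutoff_le_one : discCutoff κ y ≤ 1 := smoothTransition.le_one _

lemma discCutoff_eq_one (hκ : 0 < κ) (hy : ‖y‖ ^ 2 ≤ 1 - 2 * κ) : discCutoff κ y = 1 := by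
  refine smoothTransition.one_of_one_le ?_
  rw [quad_discCutoff hκ, le_div_iff₀ hκ]; linarith

lemma discCutoff_eq_zero (hκ : 0 < κ) (hy : 1 - κ ≤ ‖y‖ ^ 2) : discCutoff κ y = 0 := by
  refine smoothTransition.zero_of_nonpos ?_
  rw [quad_discCutoff hκ]
  exact div_nonpos_of_nonpos_of_nonneg (by linarith) hκ.le

lemma tsupport_discCutoff_subset (hκ : 0 < κ) :
    tsupport (discCutoff κ) ⊆ closedBall 0 (√(1 - κ)) := by
  refine closure_minimal (fun y hy => ?_) isClosed_closedBall
  rw [mem_closedBall_zero_iff]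
  by_contra! h
  refine hy (discCutoff_eq_zero hκ ?_)
  by_contra! h'
  exact h.not_ge (Real.le_sqrt_of_sq_le h'.le)

lemma closedBall_sqrt_subset (hκ : 0 < κ) : closedBall (0 : Plane) (√(1 - κ)) ⊆ unitDisc :=
  closedBall_subset_ball (by rw [Real.sqrt_lt' one_pos]; linarith)

lemma tsupport_mul_discCutoff_subset (hκ : 0 < κ) (g : Plane → ℝ) :
    tsupport (fun y => discCutoff κ y * g y) ⊆ closedBall 0 (√(1 - κ)) :=
  (tsupport_mul_subset_left (f := discCutoff κ) (g := g)).trans (tsupport_discCutoff_subset hκ)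

lemma hasCompactSupport_mul_discCutoff (hκ : 0 < κ) (g : Plane → ℝ) :
    HasCompactSupport fun y => discCutoff κ y * g y :=
  (isCompact_closedBall _ _).of_isClosed_subset (isClosed_tsupport _)
    (tsupport_mul_discCutoff_subset hκ g)

/-- The annulus on which `discCutoff κ` is not locally constant. -/
def cutoffLayer (κ : ℝ) : Set Plane := {y | 1 - 2 * κ ≤ ‖y‖ ^ 2 ∧ ‖y‖ ^ 2 ≤ 1 - κ}

lemma quad_notMem_Icc (hκ : 0 < κ) (hy : y ∉ cutoffLayer κ) :
    quad (-κ⁻¹) 0 ((1 - κ) / κ) y ∉ Set.Icc (0 : ℝ) 1 := by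
  rw [quad_discCutoff hκ, Set.mem_Icc, le_div_iff₀ hκ, div_le_iff₀ hκ]
  exact fun h => hy ⟨by linarith, by linarith⟩

lemma cutoffLayer_subset (hκ : 0 < κ) : cutoffLayer κ ⊆ unitDisc := fun _ hy =>
  closedBall_sqrt_subset hκ (mem_closedBall_zero_iff.2 (Real.le_sqrt_of_sq_le hy.2))

lemma volume_cutoffLayer_le (hκ : 0 < κ) (hκ' : κ ≤ 1 / 2) :
    volume.real (cutoffLayer κ) ≤ π * κ := by
  have h1 : cutoffLayer κ ⊆ closedBall 0 (√(1 - κ)) \ ball 0 (√(1 - 2 * κ)) := by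
    intro y hy
    refine ⟨mem_closedBall_zero_iff.2 (Real.le_sqrt_of_sq_le hy.2), fun h => ?_⟩
    rw [mem_ball_zero_iff, Real.lt_sqrt (norm_nonneg y)] at h
    linarith [hy.1]
  have h2 : ball (0 : Plane) (√(1 - 2 * κ)) ⊆ closedBall 0 (√(1 - κ)) :=
    ball_subset_closedBall.trans (closedBall_subset_closedBall (Real.sqrt_le_sqrt (by linarith)))
  have h3 := measureReal_mono (μ := volume) h1
    (((measure_mono Set.sdiff_subset).trans_lt measure_closedBall_lt_top).ne)
  rw [measureReal_sdiff h2 measurableSet_ball measure_closedBall_lt_top.ne,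
    volume_real_closedBall_plane (Real.sqrt_nonneg _), volume_real_ball_plane (Real.sqrt_nonneg _),
    Real.sq_sqrt (by linarith), Real.sq_sqrt (by linarith)] at h3
  linarith

lemma fderiv_discCutoff (hκ : 0 < κ) (v : Plane) :
    fderiv ℝ (discCutoff κ) y v =
      deriv smoothTransition ((1 - κ - ‖y‖ ^ 2) / κ) * (2 * ⟪-κ⁻¹ • y, v⟫) := by
  rw [← quad_discCutoff hκ]
  have := fderiv_comp_quad (φ := smoothTransition) (a := -κ⁻¹) (p := 0) (c := (1 - κ) / κ) (x := y)
    (smoothTransition_contDiff_two.differentiable two_ne_zero _) v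
  rw [sub_zero] at this
  exact this

lemma lap_discCutoff (hκ : 0 < κ) :
    lap (discCutoff κ) y =
      4 * deriv (deriv smoothTransition) ((1 - κ - ‖y‖ ^ 2) / κ) * (κ⁻¹ ^ 2 * ‖y‖ ^ 2) -
        4 * κ⁻¹ * deriv smoothTransition ((1 - κ - ‖y‖ ^ 2) / κ) := by
  rw [← quad_discCutoff hκ]
  have := lap_comp_quad (φ := smoothTransition) (a := -κ⁻¹) (p := 0) (c := (1 - κ) / κ) (x := y)
    smoothTransition_contDiff_two.contDiffAt
  rw [sub_zero, norm_smul, mul_pow, Real.norm_eq_abs, sq_abs] at this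
  refine Eq.trans this ?_
  ring

end Cutoff

/-- The Green function with its logarithmic singularity smoothed at scale `√κ`. -/
noncomputable def regLog (κ : ℝ) (x y : Plane) : ℝ :=
  log (quad (‖x‖ ^ 2) x 1 y) - log (quad 1 x (‖x‖ ^ 2 + κ) y)

section RegLog

variable {κ : ℝ} {x y : Plane}

lemma quad_greenDisc : quad (‖x‖ ^ 2) x 1 y = greenDisc x y := by
  rw [quad, greenDisc_eq]; ring

lemma quad_norm_sub : quad 1 x (‖x‖ ^ 2 + κ) y = ‖x - y‖ ^ 2 + κ := by
  rw [quad, norm_sub_sq_real]; ring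

lemma regLog_eq : regLog κ x y = log (greenDisc x y) - log (‖x - y‖ ^ 2 + κ) := by
  rw [regLog, quad_greenDisc, quad_norm_sub]

variable (hκ : 0 < κ) (hx : ‖x‖ < 1) (hy : ‖y‖ < 1)
include hκ hx hy

lemma contDiffAt_regLog : ContDiffAt ℝ 2 (fun y => log (quad (‖x‖ ^ 2) x 1 y)) y ∧
    ContDiffAt ℝ 2 (fun y => log (quad 1 x (‖x‖ ^ 2 + κ) y)) y := by
  constructor
  · refine (contDiff_quad _ _ _).contDiffAt.log ?_
    rw [quad_greenDisc]; exact (greenDisc_pos hx hy).ne'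
  · refine (contDiff_quad _ _ _).contDiffAt.log ?_
    rw [quad_norm_sub]; positivity

lemma lap_regLog : lap (regLog κ x) y = -(4 * κ / (‖x - y‖ ^ 2 + κ) ^ 2) := by
  obtain ⟨h1, h2⟩ := contDiffAt_regLog hκ hx hy
  rw [show regLog κ x = fun y => log (quad (‖x‖ ^ 2) x 1 y) - log (quad 1 x (‖x‖ ^ 2 + κ) y) from
    rfl, lap_sub h1 h2, lap_log_quad, lap_log_quad, quad_norm_sub]
  · ring
  · rw [quad_norm_sub]; positivity
  · rw [quad_greenDisc]; exact (greenDisc_pos hx hy).ne'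

lemma fderiv_regLog (v : Plane) : fderiv ℝ (regLog κ x) y v =
    ⟪(2 / greenDisc x y) • (‖x‖ ^ 2 • y - x) - (2 / (‖x - y‖ ^ 2 + κ)) • (y - x), v⟫ := by
  obtain ⟨h1, h2⟩ := contDiffAt_regLog hκ hx hy
  rw [show regLog κ x = fun y => log (quad (‖x‖ ^ 2) x 1 y) - log (quad 1 x (‖x‖ ^ 2 + κ) y) from
    rfl, fderiv_fun_sub (h1.differentiableAt two_ne_zero) (h2.differentiableAt two_ne_zero),
    sub_apply, fderiv_comp_quad, fderiv_comp_quad, Real.deriv_log, Real.deriv_log,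
    quad_greenDisc, quad_norm_sub]
  · simp only [inner_sub_left, real_inner_smul_left]
    ring
  · rw [quad_norm_sub]; exact Real.differentiableAt_log (by positivity)
  · rw [quad_greenDisc]; exact Real.differentiableAt_log (greenDisc_pos hx hy).ne'

end RegLog

/-! ### Green representation -/

/-- The commutator of the Laplacian with the cutoff, applied to the regularised Green function. -/
noncomputable def cutoffError (κ : ℝ) (x y : Plane) : ℝ :=
  regLog κ x y * lap (discCutoff κ) y +
    2 * ∑ i : Fin 2, fderiv ℝ (discCutoff κ) y (EuclideanSpace.single i 1) *
      fderiv ℝ (regLog κ x) y (EuclideanSpace.single i 1)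

section CutoffError

variable {κ : ℝ} {x y : Plane}

lemma contDiffAt_regLog' (hκ : 0 < κ) (hx : ‖x‖ < 1) (hy : ‖y‖ < 1) :
    ContDiffAt ℝ 2 (regLog κ x) y :=
  (contDiffAt_regLog hκ hx hy).1.sub (contDiffAt_regLog hκ hx hy).2

lemma lap_cutoff_mul_regLog (hκ : 0 < κ) (hx : ‖x‖ < 1) (hy : ‖y‖ < 1) :
    lap (fun y => discCutoff κ y * regLog κ x y) y =
      -(discCutoff κ y * (4 * κ / (‖x - y‖ ^ 2 + κ) ^ 2)) + cutoffError κ x y := by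
  rw [lap_mul (contDiff_discCutoff κ).contDiffAt (contDiffAt_regLog' hκ hx hy),
    lap_regLog hκ hx hy, cutoffError]
  ring

lemma cutoffError_eq_zero (hκ : 0 < κ) (hy : y ∉ cutoffLayer κ) : cutoffError κ x y = 0 := by
  have h := quad_notMem_Icc hκ hy
  rw [quad_discCutoff hκ] at h
  obtain ⟨h1, h2⟩ := deriv_smoothTransition_eq_zero h
  simp [cutoffError, lap_discCutoff hκ, fderiv_discCutoff hκ, h1, h2]

lemma half_le_norm_sub_of_layer (hx : ‖x‖ < 1) (hκ : κ ≤ (1 - ‖x‖) / 8)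
    (hy : 1 - 2 * κ ≤ ‖y‖ ^ 2) (hy1 : ‖y‖ < 1) : (1 - ‖x‖) / 2 ≤ ‖x - y‖ := by
  have h1 := norm_sub_norm_le y x
  rw [norm_sub_rev] at h1
  nlinarith [norm_nonneg y, norm_nonneg x]

lemma abs_log_sub_log_le {a b m : ℝ} (hm : 0 < m) (ha : m ≤ a) (hb : m ≤ b) :
    |log a - log b| ≤ |a - b| / m := by
  have key {a b : ℝ} (ha : m ≤ a) (hb : m ≤ b) : log a - log b ≤ |a - b| / m := by
    have ha0 := hm.trans_le ha
    have hb0 := hm.trans_le hb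
    rw [← Real.log_div ha0.ne' hb0.ne']
    calc log (a / b) ≤ a / b - 1 := Real.log_le_sub_one_of_pos (by positivity)
      _ = (a - b) / b := by field_simp
      _ ≤ |a - b| / b := by gcongr; exact le_abs_self _
      _ ≤ |a - b| / m := by gcongr
  rw [abs_le]
  have := key hb ha
  rw [abs_sub_comm] at this
  exact ⟨by linarith, key ha hb⟩

lemma abs_regLog_le_of_layer (hκ : 0 < κ) (hx : ‖x‖ < 1) (hκ' : κ ≤ (1 - ‖x‖) / 8)
    (hy : y ∈ cutoffLayer κ) : |regLog κ x y| ≤ 12 * κ / (1 - ‖x‖) ^ 2 := by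
  have hy1 : ‖y‖ < 1 := mem_ball_zero_iff.1 (cutoffLayer_subset hκ hy)
  have hd : 0 < 1 - ‖x‖ := sub_pos.2 hx
  have h1 := half_le_norm_sub_of_layer hx hκ' hy.1 hy1
  have h2 := one_sub_norm_sq_le_greenDisc hx.le hy1.le
  have hm : ((1 - ‖x‖) / 2) ^ 2 ≤ ‖x - y‖ ^ 2 := pow_le_pow_left₀ (by positivity) h1 2
  rw [regLog_eq]
  refine (abs_log_sub_log_le (m := ((1 - ‖x‖) / 2) ^ 2) (by positivity)
    (by nlinarith) (by linarith)).trans ?_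
  have h3 : |greenDisc x y - (‖x - y‖ ^ 2 + κ)| ≤ 3 * κ := by
    rw [greenDisc, abs_le]
    have hx2 := one_sub_norm_sq_pos hx
    have := hy.1
    have := hy.2
    constructor <;> nlinarith [sq_nonneg ‖x‖]
  calc _ ≤ 3 * κ / ((1 - ‖x‖) / 2) ^ 2 := by gcongr
    _ = _ := by field_simp; ring

lemma abs_cutoffError_le {K : ℝ} (hK : 0 ≤ K) (hκ : 0 < κ) (hx : ‖x‖ < 1)
    (h' : ∀ t, |deriv smoothTransition t| ≤ K ∧ |deriv (deriv smoothTransition) t| ≤ K)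
    (hκ' : κ ≤ (1 - ‖x‖) / 8) (hy : y ∈ cutoffLayer κ) :
    |cutoffError κ x y| ≤ 200 * K / (1 - ‖x‖) ^ 2 / κ := by
  have hy1 : ‖y‖ < 1 := mem_ball_zero_iff.1 (cutoffLayer_subset hκ hy)
  have hd : 0 < 1 - ‖x‖ := sub_pos.2 hx
  have hL := abs_regLog_le_of_layer hκ hx hκ' hy
  have h1 := half_le_norm_sub_of_layer hx hκ' hy.1 hy1
  have hD := one_sub_norm_sq_le_greenDisc hx.le hy1.le
  have hD0 := greenDisc_pos hx hy1
  have hm : ((1 - ‖x‖) / 2) ^ 2 ≤ ‖x - y‖ ^ 2 := pow_le_pow_left₀ (by positivity) h1 2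
  set d := 1 - ‖x‖ with hddef
  have hκ1 : κ ≤ 1 := by linarith [norm_nonneg x]
  obtain ⟨hη, hη'⟩ := h' ((1 - κ - ‖y‖ ^ 2) / κ)
  have hlap : |lap (discCutoff κ) y| ≤ 8 * K / κ ^ 2 := by
    rw [lap_discCutoff hκ]
    refine (abs_sub _ _).trans ?_
    have hyy : ‖y‖ ^ 2 ≤ 1 := by nlinarith [norm_nonneg y]
    calc _ ≤ 4 * K * (κ⁻¹ ^ 2 * 1) + 4 * κ⁻¹ * K := by
          rw [abs_mul, abs_mul, abs_mul (4 * κ⁻¹), abs_of_pos (four_pos (α := ℝ)),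
            abs_of_nonneg (a := κ⁻¹ ^ 2 * ‖y‖ ^ 2) (by positivity),
            abs_of_pos (a := 4 * κ⁻¹) (by positivity)]
          gcongr
      _ = (4 * K + 4 * K * κ) / κ ^ 2 := by field_simp
      _ ≤ 8 * K / κ ^ 2 := by gcongr; nlinarith
  have hsum : |∑ i : Fin 2, fderiv ℝ (discCutoff κ) y (EuclideanSpace.single i 1) *
      fderiv ℝ (regLog κ x) y (EuclideanSpace.single i 1)| ≤ 40 * K / d ^ 2 / κ := by
    simp_rw [fderiv_discCutoff hκ, fderiv_regLog hκ hx hy1]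
    set η := deriv smoothTransition ((1 - κ - ‖y‖ ^ 2) / κ)
    set w := (2 / greenDisc x y) • (‖x‖ ^ 2 • y - x) - (2 / (‖x - y‖ ^ 2 + κ)) • (y - x) with hw
    have hwn : ‖w‖ ≤ 20 / d ^ 2 := by
      have h3 : ‖‖x‖ ^ 2 • y - x‖ ≤ 2 := by
        refine (norm_sub_le _ _).trans ?_
        rw [norm_smul, norm_pow, norm_norm]
        nlinarith [norm_nonneg x, norm_nonneg y, mul_le_one₀ hx.le (norm_nonneg x) hx.le]
      have h4 : ‖y - x‖ ≤ 2 := (norm_sub_le _ _).trans (by linarith)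
      have h5 : 2 / greenDisc x y ≤ 2 / d ^ 2 := by gcongr
      have h6 : 2 / (‖x - y‖ ^ 2 + κ) ≤ 2 / (d / 2) ^ 2 := by
        gcongr; linarith
      refine (norm_sub_le _ _).trans ?_
      rw [norm_smul, norm_smul, Real.norm_of_nonneg (by positivity),
        Real.norm_of_nonneg (by positivity)]
      calc _ ≤ 2 / d ^ 2 * 2 + 2 / (d / 2) ^ 2 * 2 := by gcongr
        _ = 20 / d ^ 2 := by field_simp; norm_num
    have : ∑ i : Fin 2, η * (2 * ⟪-κ⁻¹ • y, EuclideanSpace.single i (1 : ℝ)⟫) *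
        ⟪w, EuclideanSpace.single i (1 : ℝ)⟫ = 2 * η * ⟪-κ⁻¹ • y, w⟫ := by
      rw [← sum_inner_single_mul, Finset.mul_sum]
      exact Finset.sum_congr rfl fun i _ => by ring
    rw [this, real_inner_smul_left, abs_mul, abs_mul, abs_mul, abs_neg, abs_of_pos (two_pos (α := ℝ)),
      abs_of_pos (inv_pos.2 hκ)]
    have h7 : |⟪y, w⟫| ≤ 1 * (20 / d ^ 2) :=
      (abs_real_inner_le_norm _ _).trans (mul_le_mul hy1.le hwn (norm_nonneg _) zero_le_one)
    calc _ ≤ 2 * K * (κ⁻¹ * (1 * (20 / d ^ 2))) := by gcongr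
      _ = _ := by field_simp; ring
  rw [cutoffError]
  refine (abs_add_le _ _).trans ?_
  rw [abs_mul, abs_mul 2, abs_of_pos (two_pos (α := ℝ))]
  calc _ ≤ 12 * κ / d ^ 2 * (8 * K / κ ^ 2) + 2 * (40 * K / d ^ 2 / κ) := by gcongr
    _ = 176 * K / d ^ 2 / κ := by field_simp; norm_num
    _ ≤ _ := by gcongr; norm_num

end CutoffError

section ApproximateIdentity

lemma integral_radial_bump : ∫ z : Plane, (1 + ‖z‖ ^ 2)⁻¹ ^ 2 = π := by
  have h := integral_fun_norm_addHaar (volume : Measure Plane) fun t : ℝ => (1 + t ^ 2)⁻¹ ^ 2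
  have hd (t : ℝ) : HasDerivAt (fun t : ℝ => -(1 / 2) * (1 + t ^ 2)⁻¹)
      (t * (1 + t ^ 2)⁻¹ ^ 2) t := by
    have h1 : HasDerivAt (fun t : ℝ => 1 + t ^ 2) (2 * t) t := by
      simpa using (hasDerivAt_pow 2 t).const_add 1
    refine ((h1.fun_inv (by positivity)).const_mul _).congr_deriv ?_
    field_simp
  have ht : Filter.Tendsto (fun t : ℝ => -(1 / 2) * (1 + t ^ 2)⁻¹) Filter.atTop (𝓝 0) := by
    have : Filter.Tendsto (fun t : ℝ => 1 + t ^ 2) Filter.atTop Filter.atTop :=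
      Filter.tendsto_atTop_add_const_left _ _ (Filter.tendsto_pow_atTop two_ne_zero)
    have h2 := this.inv_tendsto_atTop.const_mul (-(1 / 2))
    rw [mul_zero] at h2
    exact h2
  have hi := integral_Ioi_of_hasDerivAt_of_nonneg' (a := 0) (fun t _ => hd t)
    (fun t (ht : 0 < t) => by positivity) ht
  rw [h, volume_real_ball_plane zero_le_one]
  simp only [finrank_euclideanSpace, Fintype.card_fin, smul_eq_mul, nsmul_eq_mul]
  norm_num at hi ⊢
  rw [hi]
  ring

lemma tendsto_integral_poisson {g : Plane → ℝ} {x : Plane} (hg : Integrable g)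
    (hc : ContinuousAt g x) :
    Filter.Tendsto (fun κ : ℝ => ∫ y, 4 * κ / (‖x - y‖ ^ 2 + κ) ^ 2 * g y) (𝓝[>] 0)
      (𝓝 (4 * π * g x)) := by
  have h := tendsto_integral_comp_smul_smul_of_integrable' (μ := (volume : Measure Plane))
    (φ := fun z : Plane => π⁻¹ * (1 + ‖z‖ ^ 2)⁻¹ ^ 2) (fun z => by positivity) ?_ ?_ hg hc
  · have hs : Filter.Tendsto (fun κ : ℝ => (√κ)⁻¹) (𝓝[>] 0) Filter.atTop := by
      refine tendsto_inv_nhdsGT_zero.comp ?_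
      refine tendsto_nhdsWithin_iff.2 ⟨?_, ?_⟩
      · have := (Real.continuous_sqrt.tendsto 0).mono_left (nhdsWithin_le_nhds (s := Set.Ioi 0))
        simpa using this
      · filter_upwards [self_mem_nhdsWithin] with κ hκ using Real.sqrt_pos.2 hκ
    refine ((h.comp hs).const_mul (4 * π)).congr' ?_
    filter_upwards [self_mem_nhdsWithin] with κ (hκ : 0 < κ)
    simp only [Function.comp]
    rw [← integral_const_mul]
    refine integral_congr_ae (ae_of_all _ fun y => ?_)
    simp only [finrank_euclideanSpace, Fintype.card_fin, smul_eq_mul]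
    rw [norm_smul, mul_pow, norm_inv, Real.norm_of_nonneg (Real.sqrt_nonneg _), inv_pow,
      Real.sq_sqrt hκ.le]
    field_simp
    rw [add_comm]
    field_simp
  · rw [integral_const_mul, integral_radial_bump]; field_simp
  · have h2 : Filter.Tendsto (fun t : ℝ => π⁻¹ * t⁻¹ ^ 2) Filter.atTop (𝓝 0) := by
      simpa using (tendsto_inv_atTop_zero.pow 2).const_mul π⁻¹
    refine squeeze_zero' (g := fun z : Plane => π⁻¹ * ‖z‖⁻¹ ^ 2) (Filter.Eventually.of_forall
      fun z => by positivity) ?_ (h2.comp tendsto_norm_cobounded_atTop)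
    filter_upwards [(tendsto_norm_cobounded_atTop (E := Plane)).eventually_gt_atTop 0] with z hz
    rw [finrank_euclideanSpace, Fintype.card_fin]
    field_simp
    nlinarith [sq_nonneg ‖z‖]

end ApproximateIdentity

/-- `u` solves `-Δu = f` in the unit disc with zero boundary values and `|f| ≤ F`. -/
structure DirichletSolution (u f : Plane → ℝ) (F : ℝ) : Prop where
  contDiffOn : ContDiffOn ℝ 2 u unitDisc
  continuousOn : ContinuousOn u (closedBall 0 1)
  boundary : ∀ x ∈ sphere (0 : Plane) 1, u x = 0
  eq : ∀ x ∈ unitDisc, -lap u x = f x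
  bound : ∀ x ∈ unitDisc, |f x| ≤ F

/-- The approximate identity produced by `lap_regLog`. -/
noncomputable def bumpKernel (κ : ℝ) (x y : Plane) : ℝ := 4 * κ / (‖x - y‖ ^ 2 + κ) ^ 2

namespace DirichletSolution

variable {u f : Plane → ℝ} {F : ℝ} {x : Plane}

lemma bound_nonneg (h : DirichletSolution u f F) : 0 ≤ F :=
  (abs_nonneg _).trans (h.bound 0 (mem_ball_self one_pos))

lemma continuousOn_source (h : DirichletSolution u f F) : ContinuousOn f unitDisc :=
  (continuousOn_lap isOpen_ball h.contDiffOn).neg.congr fun x hx => (h.eq x hx).symm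

lemma aestronglyMeasurable_source (h : DirichletSolution u f F) :
    AEStronglyMeasurable f discMeasure :=
  h.continuousOn_source.aestronglyMeasurable measurableSet_ball

lemma ae_bound (h : DirichletSolution u f F) : ∀ᵐ y ∂discMeasure, |f y| ≤ F := by
  filter_upwards [ae_norm_lt_one] with y hy using h.bound y (mem_ball_zero_iff.2 hy)

lemma integrable_source (h : DirichletSolution u f F) : Integrable f discMeasure :=
  (integrable_const F).mono' h.aestronglyMeasurable_source h.ae_bound

lemma exists_abs_le (h : DirichletSolution u f F) :
    ∃ U, 0 ≤ U ∧ ∀ y ∈ closedBall (0 : Plane) 1, |u y| ≤ U := by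
  obtain ⟨U, hU⟩ := (isCompact_closedBall (0 : Plane) 1).exists_bound_of_continuousOn
    h.continuousOn
  exact ⟨U, (norm_nonneg _).trans (hU 0 (mem_closedBall_self zero_le_one)), hU⟩

lemma integrable (h : DirichletSolution u f F) : Integrable u discMeasure := by
  obtain ⟨U, hU0, hU⟩ := h.exists_abs_le
  refine (integrable_const U).mono'
    (h.contDiffOn.continuousOn.aestronglyMeasurable measurableSet_ball) ?_
  filter_upwards [ae_norm_lt_one] with y hy using hU y (mem_closedBall_zero_iff.2 hy.le)

lemma exists_abs_lt_near_boundary (h : DirichletSolution u f F) {ε : ℝ} (hε : 0 < ε) :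
    ∃ δ > 0, ∀ y : Plane, ‖y‖ ≤ 1 → 1 - δ < ‖y‖ → |u y| < ε := by
  obtain ⟨δ, hδ, H⟩ := Metric.uniformContinuousOn_iff.1
    ((isCompact_closedBall (0 : Plane) 1).uniformContinuousOn_of_continuous h.continuousOn) ε hε
  refine ⟨min δ 1, by positivity, fun y hy hyδ => ?_⟩
  have hy0 : 0 < ‖y‖ := by linarith [min_le_right δ 1]
  have hz : ‖‖y‖⁻¹ • y‖ = 1 := by rw [norm_smul, norm_inv, norm_norm, inv_mul_cancel₀ hy0.ne']
  have hd : dist y (‖y‖⁻¹ • y) < δ := by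
    have : y - ‖y‖⁻¹ • y = (1 - ‖y‖⁻¹) • y := by rw [sub_smul, one_smul]
    rw [dist_eq_norm, this, norm_smul, Real.norm_eq_abs, abs_of_nonpos, neg_sub, sub_mul,
      inv_mul_cancel₀ hy0.ne', one_mul]
    · linarith [min_le_left δ 1]
    · rw [sub_nonpos]; exact (one_le_inv₀ hy0).2 hy
  have := H y (mem_closedBall_zero_iff.2 hy) _ (mem_closedBall_zero_iff.2 hz.le) hd
  rwa [h.boundary _ (mem_sphere_zero_iff_norm.2 hz), dist_zero_right] at this

lemma bumpKernel_nonneg {κ : ℝ} {y : Plane} (hκ : 0 ≤ κ) : 0 ≤ bumpKernel κ x y := by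
  unfold bumpKernel; positivity

lemma continuous_bump {κ : ℝ} (hκ : 0 < κ) : Continuous (bumpKernel κ x) :=
  continuous_const.div (by fun_prop : Continuous fun y => (‖x - y‖ ^ 2 + κ) ^ 2)
    fun y => by positivity

lemma bump_le {κ m : ℝ} {y : Plane} (hκ : 0 < κ) (hm : 0 < m) (h : m ≤ ‖x - y‖ ^ 2 + κ) :
    bumpKernel κ x y ≤ 4 * κ / m ^ 2 := by
  unfold bumpKernel
  gcongr

lemma integrable_bump_mul (h : DirichletSolution u f F) {κ : ℝ} (hκ : 0 < κ) :
    Integrable (fun y => bumpKernel κ x y * u y) discMeasure := by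
  refine h.integrable.bdd_mul (c := 4 * κ / κ ^ 2)
    (continuous_bump hκ).aestronglyMeasurable (ae_of_all _ fun y => ?_)
  rw [Real.norm_of_nonneg (bumpKernel_nonneg hκ.le)]
  exact bump_le hκ hκ (by nlinarith [sq_nonneg ‖x - y‖])

lemma integrable_cutoff_bump_mul (h : DirichletSolution u f F) {κ : ℝ} (hκ : 0 < κ) :
    Integrable (fun y => discCutoff κ y * (bumpKernel κ x y * u y)) discMeasure := by
  refine (h.integrable_bump_mul hκ).bdd_mul (c := 1)
    (contDiff_discCutoff κ).continuous.aestronglyMeasurable (ae_of_all _ fun y => ?_)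
  rw [Real.norm_of_nonneg discCutoff_nonneg]
  exact discCutoff_le_one

lemma tendsto_bump (h : DirichletSolution u f F) (hx : ‖x‖ < 1) :
    Filter.Tendsto (fun κ : ℝ => ∫ y, bumpKernel κ x y * u y ∂discMeasure) (𝓝[>] 0)
      (𝓝 (4 * π * u x)) := by
  have hx' : x ∈ unitDisc := mem_ball_zero_iff.2 hx
  have hc : ContinuousAt (unitDisc.indicator u) x := by
    refine (h.contDiffOn.continuousOn.continuousAt (isOpen_ball.mem_nhds hx')).congr ?_
    filter_upwards [isOpen_ball.mem_nhds hx'] with y hy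
    rw [Set.indicator_of_mem hy]
  have ht := tendsto_integral_poisson ((integrable_indicator_iff measurableSet_ball).2
    h.integrable) hc
  rw [Set.indicator_of_mem hx'] at ht
  refine ht.congr fun κ => ?_
  rw [← integral_indicator measurableSet_ball]
  congr 1 with y
  rw [Set.indicator_mul_right, bumpKernel]

lemma tendsto_bump_boundary (h : DirichletSolution u f F) (hx : ‖x‖ < 1) :
    Filter.Tendsto (fun κ : ℝ => ∫ y, (1 - discCutoff κ y) * (bumpKernel κ x y * u y) ∂discMeasure)
      (𝓝[>] 0) (𝓝 0) := by
  obtain ⟨U, hU0, hU⟩ := h.exists_abs_le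
  have hd : 0 < 1 - ‖x‖ := sub_pos.2 hx
  have ht : Filter.Tendsto (fun κ : ℝ => 4 * κ / (((1 - ‖x‖) / 2) ^ 2) ^ 2 * U * π) (𝓝[>] 0)
      (𝓝 0) := by
    have : Continuous fun κ : ℝ => 4 * κ / (((1 - ‖x‖) / 2) ^ 2) ^ 2 * U * π := by fun_prop
    simpa using (this.tendsto 0).mono_left nhdsWithin_le_nhds
  refine squeeze_zero_norm' ?_ ht
  filter_upwards [Ioc_mem_nhdsGT (show (0 : ℝ) < (1 - ‖x‖) / 8 by positivity)] with κ ⟨hκ, hκ'⟩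
  have hv : volume.real unitDisc = π := by
    rw [volume_real_ball_plane zero_le_one]; ring
  rw [← hv]
  refine norm_setIntegral_le_of_norm_le_const measure_ball_lt_top fun y hy => ?_
  have hy1 : ‖y‖ < 1 := mem_ball_zero_iff.1 hy
  have hb : 0 ≤ bumpKernel κ x y := bumpKernel_nonneg hκ.le
  rw [Real.norm_eq_abs]
  by_cases hl : ‖y‖ ^ 2 ≤ 1 - 2 * κ
  · rw [discCutoff_eq_one hκ hl]
    simp only [sub_self, zero_mul, abs_zero]
    positivity
  · have h1 := half_le_norm_sub_of_layer hx hκ' (not_le.1 hl).le hy1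
    have h2 : bumpKernel κ x y ≤ 4 * κ / (((1 - ‖x‖) / 2) ^ 2) ^ 2 :=
      bump_le hκ (by positivity) (by nlinarith)
    rw [abs_mul, abs_mul, abs_of_nonneg (sub_nonneg.2 discCutoff_le_one), abs_of_nonneg hb]
    calc _ ≤ 1 * (4 * κ / (((1 - ‖x‖) / 2) ^ 2) ^ 2 * U) := by
          gcongr
          · linarith [discCutoff_nonneg (κ := κ) (y := y)]
          · exact hU y (mem_closedBall_zero_iff.2 hy1.le)
      _ = _ := one_mul _

lemma abs_regLog_le {κ : ℝ} {y : Plane} (hκ : 0 < κ) (hκ1 : κ ≤ 1) (hx : ‖x‖ < 1) (hy : ‖y‖ < 1)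
    (hxy : x ≠ y) : |regLog κ x y| ≤ ((1 - ‖x‖) ^ 2)⁻¹ + 4 * ‖x - y‖⁻¹ := by
  have hd : 0 < 1 - ‖x‖ := sub_pos.2 hx
  have hD := one_sub_norm_sq_le_greenDisc hx.le hy.le
  have hD0 := greenDisc_pos hx hy
  have hr : 0 < ‖x - y‖ := norm_pos_iff.2 (sub_ne_zero.2 hxy)
  have h1 := le_of_abs_le (abs_greenLog_le hx hy hxy)
  rw [greenLog] at h1
  have h2 : log (‖x - y‖ ^ 2) ≤ log (‖x - y‖ ^ 2 + κ) :=
    Real.log_le_log (by positivity) (by linarith)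
  have h3 : log (‖x - y‖ ^ 2 + κ) - log (greenDisc x y) ≤ ((1 - ‖x‖) ^ 2)⁻¹ := by
    rw [← Real.log_div (by positivity) hD0.ne']
    refine (Real.log_le_sub_one_of_pos (by positivity)).trans ?_
    calc (‖x - y‖ ^ 2 + κ) / greenDisc x y - 1 = (‖x - y‖ ^ 2 + κ - greenDisc x y) / greenDisc x y
        := by field_simp
      _ ≤ 1 / greenDisc x y := by
        gcongr; linarith [norm_sub_sq_le_greenDisc hx hy]
      _ ≤ 1 / (1 - ‖x‖) ^ 2 := by gcongr
      _ = _ := one_div _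
  have h4 : 0 < ‖x - y‖⁻¹ := by positivity
  have h5 : 0 < ((1 - ‖x‖) ^ 2)⁻¹ := by positivity
  rw [regLog_eq, abs_le]
  constructor <;> linarith

lemma measurable_regLog (κ : ℝ) (x : Plane) : Measurable (regLog κ x) := by
  unfold regLog quad
  fun_prop

lemma integrable_const_add_inv (hx : ‖x‖ < 1) (a c : ℝ) :
    Integrable (fun y => a + c * ‖x - y‖⁻¹) discMeasure :=
  (integrable_const a).add ((integrable_inv_norm_sub hx).const_mul c)

lemma tendsto_regLog (h : DirichletSolution u f F) (hx : ‖x‖ < 1) :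
    Filter.Tendsto (fun κ : ℝ => ∫ y, discCutoff κ y * regLog κ x y * f y ∂discMeasure)
      (𝓝[>] 0) (𝓝 (∫ y, greenLog x y * f y ∂discMeasure)) := by
  refine tendsto_integral_filter_of_dominated_convergence
    (fun y => (((1 - ‖x‖) ^ 2)⁻¹ + 4 * ‖x - y‖⁻¹) * F) ?_ ?_
    ((integrable_const_add_inv hx _ _).mul_const F) ?_
  · exact Filter.Eventually.of_forall fun κ =>
      (((contDiff_discCutoff κ).continuous.measurable.mul
        (measurable_regLog κ x)).aestronglyMeasurable).mul h.aestronglyMeasurable_source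
  · filter_upwards [Ioc_mem_nhdsGT one_pos] with κ ⟨hκ, hκ1⟩
    filter_upwards [ae_norm_lt_one, ae_ne_discMeasure x, h.ae_bound] with y hy hxy hf
    rw [Real.norm_eq_abs, abs_mul, abs_mul, abs_of_nonneg discCutoff_nonneg]
    refine mul_le_mul ?_ hf (abs_nonneg _) (by positivity)
    calc _ ≤ 1 * |regLog κ x y| := by gcongr; exact discCutoff_le_one
      _ ≤ _ := by rw [one_mul]; exact abs_regLog_le hκ hκ1 hx hy hxy
  · filter_upwards [ae_norm_lt_one, ae_ne_discMeasure x] with y hy hxy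
    have hr : 0 < ‖x - y‖ := norm_pos_iff.2 (sub_ne_zero.2 hxy)
    refine Filter.Tendsto.mul_const _ ?_
    have h1 : Filter.Tendsto (fun κ : ℝ => log (greenDisc x y) - log (‖x - y‖ ^ 2 + κ)) (𝓝[>] 0)
        (𝓝 (greenLog x y)) := by
      have : ContinuousAt (fun κ : ℝ => log (greenDisc x y) - log (‖x - y‖ ^ 2 + κ)) 0 := by
        refine continuousAt_const.sub (ContinuousAt.log (by fun_prop) ?_)
        positivity
      have h2 := this.tendsto.mono_left (nhdsWithin_le_nhds (s := Set.Ioi 0))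
      rwa [add_zero] at h2
    refine h1.congr' ?_
    have hy2 : 0 < (1 - ‖y‖ ^ 2) / 2 := half_pos (one_sub_norm_sq_pos hy)
    filter_upwards [Ioc_mem_nhdsGT hy2] with κ ⟨hκ, hκ'⟩
    rw [discCutoff_eq_one hκ (by linarith), one_mul, regLog_eq]

lemma tendsto_cutoffError (h : DirichletSolution u f F) (hx : ‖x‖ < 1) :
    Filter.Tendsto (fun κ : ℝ => ∫ y, cutoffError κ x y * u y ∂discMeasure) (𝓝[>] 0) (𝓝 0) := by
  obtain ⟨K, hK, hK'⟩ := exists_deriv_smoothTransition_le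
  have hd : 0 < 1 - ‖x‖ := sub_pos.2 hx
  set A := 200 * K / (1 - ‖x‖) ^ 2 with hA
  have hA0 : 0 ≤ A := by positivity
  rw [Metric.tendsto_nhds]
  intro ε hε
  obtain ⟨δ, hδ, H⟩ := h.exists_abs_lt_near_boundary (ε := ε / (A * π + 1)) (by positivity)
  have hmin : 0 < min (min ((1 - ‖x‖) / 8) (1 / 2)) (δ / 4) := by positivity
  filter_upwards [Ioc_mem_nhdsGT hmin] with κ ⟨hκ, hκ'⟩
  have hκ1 := hκ'.trans ((min_le_left _ _).trans (min_le_left _ _))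
  have hκ2 := hκ'.trans ((min_le_left _ _).trans (min_le_right _ _))
  have hκ3 := hκ'.trans (min_le_right _ _)
  have hlayer : ∫ y, cutoffError κ x y * u y ∂discMeasure =
      ∫ y in cutoffLayer κ, cutoffError κ x y * u y :=
    setIntegral_eq_of_subset_of_forall_sdiff_eq_zero measurableSet_ball (cutoffLayer_subset hκ)
      fun y hy => by rw [cutoffError_eq_zero hκ hy.2, zero_mul]
  rw [dist_zero_right, hlayer]
  have hfin : volume (cutoffLayer κ) < ⊤ :=
    (measure_mono (cutoffLayer_subset hκ)).trans_lt measure_ball_lt_top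
  calc _ ≤ A / κ * (ε / (A * π + 1)) * volume.real (cutoffLayer κ) := by
        refine norm_setIntegral_le_of_norm_le_const hfin fun y hy => ?_
        have hy1 : ‖y‖ < 1 := mem_ball_zero_iff.1 (cutoffLayer_subset hκ hy)
        rw [Real.norm_eq_abs, abs_mul]
        refine mul_le_mul (abs_cutoffError_le hK hκ hx hK' hκ1 hy) (H y hy1.le ?_).le
          (abs_nonneg _) (by positivity)
        nlinarith [hy.1, norm_nonneg y]
    _ ≤ A / κ * (ε / (A * π + 1)) * (π * κ) := by
        gcongr; exact volume_cutoffLayer_le hκ hκ2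
    _ = ε * ((A * π) / (A * π + 1)) := by field_simp
    _ < ε := by
        refine mul_lt_of_lt_one_right hε ?_
        rw [div_lt_one (by positivity)]
        linarith

lemma integral_bump_eq (h : DirichletSolution u f F) (hx : ‖x‖ < 1) {κ : ℝ} (hκ : 0 < κ) :
    ∫ y, bumpKernel κ x y * u y ∂discMeasure =
      (∫ y, (1 - discCutoff κ y) * (bumpKernel κ x y * u y) ∂discMeasure) +
      (∫ y, discCutoff κ y * regLog κ x y * f y ∂discMeasure) +
      ∫ y, cutoffError κ x y * u y ∂discMeasure := by
  have hψ : ContDiffOn ℝ 2 (fun y => discCutoff κ y * regLog κ x y) unitDisc := fun y hy =>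
    ((contDiff_discCutoff κ).contDiffAt.mul
      (contDiffAt_regLog' hκ hx (mem_ball_zero_iff.1 hy))).contDiffWithinAt
  have hsupp := (tsupport_mul_discCutoff_subset hκ (regLog κ x)).trans (closedBall_sqrt_subset hκ)
  have hcpt := hasCompactSupport_mul_discCutoff hκ (regLog κ x)
  have hI := setIntegral_mul_lap isOpen_ball hψ h.contDiffOn hcpt hsupp
  have hl : ∫ y, discCutoff κ y * regLog κ x y * lap u y ∂discMeasure =
      -∫ y, discCutoff κ y * regLog κ x y * f y ∂discMeasure := by
    rw [← integral_neg]
    refine setIntegral_congr_fun measurableSet_ball fun y hy => ?_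
    rw [← h.eq y hy]; ring
  have hb := h.integrable_bump_mul (x := x) hκ
  have hcb := h.integrable_cutoff_bump_mul (x := x) hκ
  have hlapE : Set.EqOn (fun y => lap (fun y => discCutoff κ y * regLog κ x y) y * u y)
      (fun y => -(discCutoff κ y * (bumpKernel κ x y * u y)) + cutoffError κ x y * u y) unitDisc := by
    intro y hy
    simp only
    rw [lap_cutoff_mul_regLog hκ hx (mem_ball_zero_iff.1 hy), bumpKernel]
    ring
  have hlapI : Integrable (fun y => lap (fun y => discCutoff κ y * regLog κ x y) y * u y)
      discMeasure := by
    have h0 : ContinuousOn (fun y => lap (fun y => discCutoff κ y * regLog κ x y) y) unitDisc :=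
      continuousOn_lap isOpen_ball hψ
    have hts : tsupport (lap fun y => discCutoff κ y * regLog κ x y) ⊆
        tsupport fun y => discCutoff κ y * regLog κ x y := by
      refine closure_minimal (fun y hy => ?_) (isClosed_tsupport _)
      by_contra hy'
      refine hy ?_
      rw [lap_congr (notMem_tsupport_iff_eventuallyEq.1 hy')]
      simp [lap]
    exact (integrable_mul_of_tsupport h0 h.contDiffOn.continuousOn
      (hcpt.of_isClosed_subset (isClosed_tsupport _) hts) (hts.trans hsupp)).restrict
  have hEI : Integrable (fun y => cutoffError κ x y * u y) discMeasure := by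
    refine (hlapI.add hcb).congr ?_
    filter_upwards [ae_restrict_mem measurableSet_ball] with y hy
    have := hlapE hy
    simp only at this
    simp only [Pi.add_apply, this]
    ring
  have h1 : ∫ y, (1 - discCutoff κ y) * (bumpKernel κ x y * u y) ∂discMeasure =
      (∫ y, bumpKernel κ x y * u y ∂discMeasure) -
        ∫ y, discCutoff κ y * (bumpKernel κ x y * u y) ∂discMeasure := by
    rw [← integral_sub hb hcb]
    congr 1 with y
    ring
  have h2 := integral_add hcb.fun_neg hEI
  rw [integral_neg] at h2
  rw [hl, setIntegral_congr_fun measurableSet_ball hlapE, h2] at hI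
  linarith

/-- Green representation formula. -/
theorem four_pi_mul_eq (h : DirichletSolution u f F) (hx : ‖x‖ < 1) :
    4 * π * u x = ∫ y, greenLog x y * f y ∂discMeasure := by
  have h1 := ((h.tendsto_bump_boundary hx).add (h.tendsto_regLog hx)).add
    (h.tendsto_cutoffError hx)
  rw [zero_add, add_zero] at h1
  refine tendsto_nhds_unique ((h.tendsto_bump hx).congr' ?_) h1
  filter_upwards [self_mem_nhdsWithin] with κ hκ using h.integral_bump_eq hx hκ

end DirichletSolution

/-! ### The gradient of a solution -/

section GreenDifference

variable {x x' y : Plane}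

lemma abs_greenDisc_sub_le (hx : ‖x‖ < 1) (hx' : ‖x'‖ < 1) (hy : ‖y‖ < 1) :
    |greenDisc x' y - greenDisc x y| ≤ 4 * ‖x' - x‖ := by
  have h1 : greenDisc x' y - greenDisc x y =
      -2 * ⟪x' - x, y⟫ + (‖x'‖ - ‖x‖) * (‖x'‖ + ‖x‖) * ‖y‖ ^ 2 := by
    rw [greenDisc_eq, greenDisc_eq, inner_sub_left]; ring
  have h2 : |⟪x' - x, y⟫| ≤ ‖x' - x‖ * 1 :=
    (abs_real_inner_le_norm _ _).trans (by gcongr)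
  have h3 := abs_norm_sub_norm_le x' x
  have hy2 : ‖y‖ ^ 2 ≤ 1 := by nlinarith [norm_nonneg y]
  rw [h1]
  refine (abs_add_le _ _).trans ?_
  rw [abs_mul, abs_mul, abs_mul, abs_neg, abs_of_pos (two_pos (α := ℝ)),
    abs_of_nonneg (a := ‖x'‖ + ‖x‖) (by positivity), abs_of_nonneg (a := ‖y‖ ^ 2) (by positivity)]
  calc _ ≤ 2 * (‖x' - x‖ * 1) + ‖x' - x‖ * (1 + 1) * 1 := by gcongr
    _ = _ := by ring

lemma abs_log_sub_log_le_inv_add {a b : ℝ} (ha : 0 < a) (hb : 0 < b) :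
    |log a - log b| ≤ |a - b| * (a⁻¹ + b⁻¹) := by
  refine (abs_log_sub_log_le (m := min a b) (lt_min ha hb) (min_le_left _ _)
    (min_le_right _ _)).trans ?_
  rw [div_eq_mul_inv]
  gcongr
  rcases min_choice a b with h | h <;> rw [h]
  · linarith [inv_pos.2 hb]
  · linarith [inv_pos.2 ha]

lemma abs_greenLog_sub_le (hx : ‖x‖ < 1) (hy : ‖y‖ < 1)
    (hxx' : ‖x' - x‖ ≤ (1 - ‖x‖) / 2) (hxy : x ≠ y) (hxy' : x' ≠ y) :
    |greenLog x' y - greenLog x y| ≤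
      ‖x' - x‖ * (16 / (1 - ‖x‖) ^ 2 + 2 * ‖x' - y‖⁻¹ + 2 * ‖x - y‖⁻¹) := by
  have hd : 0 < 1 - ‖x‖ := sub_pos.2 hx
  have hx'n : ‖x'‖ ≤ ‖x‖ + ‖x' - x‖ := by
    have := norm_add_le x (x' - x); rwa [add_sub_cancel] at this
  have hx' : ‖x'‖ < 1 := by linarith
  have hD : ((1 - ‖x‖) / 2) ^ 2 ≤ greenDisc x y :=
    le_trans (by gcongr; linarith) (one_sub_norm_sq_le_greenDisc hx.le hy.le)
  have hD' : ((1 - ‖x‖) / 2) ^ 2 ≤ greenDisc x' y :=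
    le_trans (by gcongr; linarith) (one_sub_norm_sq_le_greenDisc hx'.le hy.le)
  have h1 : |log (greenDisc x' y) - log (greenDisc x y)| ≤ 16 / (1 - ‖x‖) ^ 2 * ‖x' - x‖ := by
    refine (abs_log_sub_log_le (by positivity) hD' hD).trans ?_
    calc _ ≤ 4 * ‖x' - x‖ / ((1 - ‖x‖) / 2) ^ 2 := by
          gcongr; exact abs_greenDisc_sub_le hx hx' hy
      _ = _ := by field_simp; ring
  have h2 : |log (‖x' - y‖ ^ 2) - log (‖x - y‖ ^ 2)| ≤
      2 * (‖x' - x‖ * (‖x' - y‖⁻¹ + ‖x - y‖⁻¹)) := by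
    rw [Real.log_pow, Real.log_pow, Nat.cast_ofNat, ← mul_sub, abs_mul,
      abs_of_pos (two_pos (α := ℝ))]
    have h3 := abs_log_sub_log_le_inv_add (norm_pos_iff.2 (sub_ne_zero.2 hxy'))
      (norm_pos_iff.2 (sub_ne_zero.2 hxy))
    have h4 : |‖x' - y‖ - ‖x - y‖| ≤ ‖x' - x‖ := by
      refine (abs_norm_sub_norm_le _ _).trans_eq ?_
      rw [sub_sub_sub_cancel_right]
    gcongr
    exact h3.trans (by gcongr)
  calc |greenLog x' y - greenLog x y| = |(log (greenDisc x' y) - log (greenDisc x y)) -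
        (log (‖x' - y‖ ^ 2) - log (‖x - y‖ ^ 2))| := by rw [greenLog, greenLog]; congr 1; ring
    _ ≤ _ := abs_sub _ _
    _ ≤ _ := add_le_add h1 h2
    _ = _ := by ring

lemma hasDerivAt_greenLog (hx : ‖x‖ < 1) (hy : ‖y‖ < 1) (hxy : x ≠ y) (v : Plane) :
    HasDerivAt (fun t : ℝ => greenLog (x + t • v) y) ⟪v, greenGrad x y⟫ 0 := by
  have hr : 0 < ‖x - y‖ := norm_pos_iff.2 (sub_ne_zero.2 hxy)
  have e1 (z : Plane) : quad (‖y‖ ^ 2) y 1 z = greenDisc z y := by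
    rw [quad_greenDisc, greenDisc_comm]
  have e2 (z : Plane) : quad 1 y (‖y‖ ^ 2) z = ‖z - y‖ ^ 2 := by
    have := quad_norm_sub (κ := 0) (x := y) (y := z)
    rwa [add_zero, add_zero, norm_sub_rev] at this
  have h1 : greenDisc x y ≠ 0 := (greenDisc_pos hx hy).ne'
  have h2 : ‖x - y‖ ^ 2 ≠ 0 := by positivity
  have hf : (fun z => greenLog z y) =
      fun z => log (quad (‖y‖ ^ 2) y 1 z) - log (quad 1 y (‖y‖ ^ 2) z) := by
    ext z; rw [e1, e2, greenLog]
  have d1 : DifferentiableAt ℝ (fun z => log (quad (‖y‖ ^ 2) y 1 z)) x :=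
    (hasFDerivAt_quad _ _ _ x).differentiableAt.log (by rwa [e1])
  have d2 : DifferentiableAt ℝ (fun z => log (quad 1 y (‖y‖ ^ 2) z)) x :=
    (hasFDerivAt_quad _ _ _ x).differentiableAt.log (by rwa [e2])
  have hd : DifferentiableAt ℝ (fun z => greenLog z y) x := by
    rw [hf]; exact d1.sub d2
  have hv : fderiv ℝ (fun z => greenLog z y) x v = ⟪v, greenGrad x y⟫ := by
    rw [hf, fderiv_fun_sub d1 d2, sub_apply, fderiv_comp_quad, fderiv_comp_quad, Real.deriv_log,
      Real.deriv_log, e1, e2, greenGrad]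
    · simp only [inner_sub_left, real_inner_smul_left, inner_sub_right, real_inner_smul_right,
        real_inner_comm x v, real_inner_comm y v]
      ring
    · rw [e2]; exact Real.differentiableAt_log h2
    · rw [e1]; exact Real.differentiableAt_log h1
  rw [← hv]
  exact hd.hasFDerivAt.hasLineDerivAt v

end GreenDifference

namespace DirichletSolution

variable {u f : Plane → ℝ} {F : ℝ} {x : Plane}

lemma integrable_greenLog_mul (h : DirichletSolution u f F) (hx : ‖x‖ < 1) :
    Integrable (fun y => greenLog x y * f y) discMeasure := by
  refine integrable_of_le_inv (c := 4 * F) hx ((measurable_greenLog.comp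
    measurable_prodMk_left).aestronglyMeasurable.mul h.aestronglyMeasurable_source) ?_
  intro y hy hxy
  rw [abs_mul, mul_right_comm]
  exact mul_le_mul (abs_greenLog_le hx hy hxy) (h.bound y (mem_ball_zero_iff.2 hy)) (abs_nonneg _)
    (by positivity)

lemma abs_inner_greenGrad_le {y : Plane} (hx : ‖x‖ < 1) (hy : ‖y‖ < 1) (hxy : x ≠ y) (v : Plane) :
    |⟪v, greenGrad x y⟫| ≤ ‖v‖ * (12 * ‖x - y‖⁻¹) :=
  (abs_real_inner_le_norm _ _).trans (by gcongr; exact norm_greenGrad_le hx hy hxy)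

lemma aestronglyMeasurable_inner_greenGrad (v : Plane) :
    AEStronglyMeasurable (fun y => ⟪v, greenGrad x y⟫) discMeasure :=
  ((measurable_greenGrad.comp measurable_prodMk_left).const_inner).aestronglyMeasurable

lemma integrable_inner_greenGrad_mul (h : DirichletSolution u f F) (hx : ‖x‖ < 1) (v : Plane) :
    Integrable (fun y => ⟪v, greenGrad x y⟫ * f y) discMeasure := by
  refine integrable_of_le_inv (c := ‖v‖ * 12 * F) hx
    ((aestronglyMeasurable_inner_greenGrad v).mul h.aestronglyMeasurable_source) ?_
  intro y hy hxy
  rw [abs_mul, mul_right_comm, mul_assoc ‖v‖]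
  exact mul_le_mul (abs_inner_greenGrad_le hx hy hxy v) (h.bound y (mem_ball_zero_iff.2 hy))
    (abs_nonneg _) (by positivity)

/-- The difference quotient of the Green function in the direction `v`, minus its limit. -/
noncomputable def greenQuotientError (x v : Plane) (t : ℝ) (y : Plane) : ℝ :=
  t⁻¹ * (greenLog (x + t • v) y - greenLog x y) - ⟪v, greenGrad x y⟫

lemma abs_greenQuotientError_le {v y : Plane} {t : ℝ} (hx : ‖x‖ < 1) (hy : ‖y‖ < 1) (ht : 0 < t)
    (htv : t * ‖v‖ ≤ (1 - ‖x‖) / 2) (hxy : x ≠ y) (hxy' : x + t • v ≠ y) :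
    |greenQuotientError x v t y| ≤
      ‖v‖ * (16 / (1 - ‖x‖) ^ 2 + 2 * ‖x + t • v - y‖⁻¹ + 14 * ‖x - y‖⁻¹) := by
  have e : ‖x + t • v - x‖ = t * ‖v‖ := by
    rw [add_sub_cancel_left, norm_smul, Real.norm_of_nonneg ht.le]
  have h1 := abs_greenLog_sub_le hx hy (by rwa [e]) hxy hxy'
  rw [e] at h1
  refine (abs_sub _ _).trans ?_
  rw [abs_mul, abs_of_pos (inv_pos.2 ht)]
  calc _ ≤ t⁻¹ * (t * ‖v‖ * (16 / (1 - ‖x‖) ^ 2 + 2 * ‖x + t • v - y‖⁻¹ + 2 * ‖x - y‖⁻¹)) +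
        ‖v‖ * (12 * ‖x - y‖⁻¹) := by
        gcongr; exact abs_inner_greenGrad_le hx hy hxy v
    _ = _ := by field_simp; ring

lemma aestronglyMeasurable_greenQuotientError (v : Plane) (t : ℝ) :
    Measurable (greenQuotientError x v t) :=
  (((measurable_greenLog.comp measurable_prodMk_left).sub
    (measurable_greenLog.comp measurable_prodMk_left)).const_mul _).sub
    (measurable_greenGrad.comp measurable_prodMk_left).const_inner

lemma near_bound (h : DirichletSolution u f F) (hx : ‖x‖ < 1) (v : Plane) {ρ t : ℝ} (hρ : 0 < ρ)
    (hρx : ρ ≤ (1 - ‖x‖) / 2) (ht : 0 < t) (htv : t * ‖v‖ ≤ ρ) :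
    ‖∫ y in ball x ρ, greenQuotientError x v t y * f y ∂discMeasure‖ ≤
      F * ‖v‖ * (16 / (1 - ‖x‖) ^ 2 * (π * ρ ^ 2) + 36 * π * ρ) := by
  have hd : 0 < 1 - ‖x‖ := sub_pos.2 hx
  have hsub : ball x ρ ⊆ unitDisc := fun y hy => by
    rw [mem_ball_iff_norm] at hy
    rw [mem_ball_zero_iff]
    have := norm_add_le x (y - x)
    rw [add_sub_cancel] at this
    linarith
  have hsub2 : ball x ρ ⊆ ball (x + t • v) (2 * ρ) := by
    refine ball_subset_ball' ?_
    rw [dist_eq_norm, sub_add_cancel_left, norm_neg, norm_smul, Real.norm_of_nonneg ht.le]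
    linarith
  have i1 : IntegrableOn (fun y => ‖x + t • v - y‖⁻¹) (ball x ρ) :=
    (integrableOn_inv_norm_sub_ball _ (2 * ρ)).mono_set hsub2
  have i2 := integrableOn_inv_norm_sub_ball x ρ
  have i0 : IntegrableOn (fun _ : Plane => 16 / (1 - ‖x‖) ^ 2) (ball x ρ) :=
    integrableOn_const measure_ball_lt_top.ne
  have i1' := i1.const_mul 2
  have i2' := i2.const_mul 14
  have hle : ∫ y in ball x ρ, ‖x + t • v - y‖⁻¹ ≤ 4 * π * ρ := by
    calc _ ≤ ∫ y in ball (x + t • v) (2 * ρ), ‖x + t • v - y‖⁻¹ :=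
          setIntegral_mono_set (integrableOn_inv_norm_sub_ball _ _)
            (ae_of_all _ fun y => by positivity) hsub2.eventuallyLE
      _ = _ := by rw [setIntegral_inv_norm_sub_ball _ (by positivity)]; ring
  rw [Measure.restrict_restrict_of_subset hsub]
  have hae (z : Plane) : ∀ᵐ y ∂(volume.restrict (ball x ρ)), z ≠ y :=
    ae_restrict_of_ae (by
      filter_upwards [compl_mem_ae_iff.2 (measure_singleton (μ := volume) z)] with y hy hzy
      exact hy (by simp [hzy]))
  calc _ ≤ ∫ y in ball x ρ, F * ‖v‖ *
        (16 / (1 - ‖x‖) ^ 2 + 2 * ‖x + t • v - y‖⁻¹ + 14 * ‖x - y‖⁻¹) := by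
        refine norm_integral_le_of_norm_le (((i0.add i1').add i2').const_mul _) ?_
        filter_upwards [ae_restrict_mem measurableSet_ball, hae x, hae (x + t • v)]
          with y hy hxy hxy'
        have hy1 : ‖y‖ < 1 := mem_ball_zero_iff.1 (hsub hy)
        rw [Real.norm_eq_abs, abs_mul, mul_comm, mul_assoc F]
        exact mul_le_mul (h.bound y (hsub hy))
          (abs_greenQuotientError_le hx hy1 ht (htv.trans hρx) hxy hxy') (abs_nonneg _)
          h.bound_nonneg
    _ = F * ‖v‖ * (16 / (1 - ‖x‖) ^ 2 * (π * ρ ^ 2) +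
        2 * (∫ y in ball x ρ, ‖x + t • v - y‖⁻¹) + 28 * π * ρ) := by
        have e1 := integral_add (i0.add i1') i2'
        have e2 := integral_add i0 i1'
        simp only [Pi.add_apply] at e1 e2
        rw [integral_const_mul, e1, e2, integral_const_mul, integral_const_mul,
          setIntegral_inv_norm_sub_ball x hρ.le, setIntegral_const,
          volume_real_ball_plane hρ.le, smul_eq_mul]
        ring
    _ ≤ F * ‖v‖ * (16 / (1 - ‖x‖) ^ 2 * (π * ρ ^ 2) + 2 * (4 * π * ρ) + 28 * π * ρ) := by
        have := h.bound_nonneg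
        gcongr
    _ = _ := by ring

lemma tendsto_far (h : DirichletSolution u f F) (hx : ‖x‖ < 1) (v : Plane) {ρ : ℝ} (hρ : 0 < ρ) :
    Filter.Tendsto (fun t : ℝ => ∫ y in (ball x ρ)ᶜ, greenQuotientError x v t y * f y ∂discMeasure)
      (𝓝[>] 0) (𝓝 0) := by
  have hd : 0 < 1 - ‖x‖ := sub_pos.2 hx
  suffices Filter.Tendsto (fun t : ℝ => ∫ y in (ball x ρ)ᶜ, greenQuotientError x v t y * f y
      ∂discMeasure) (𝓝[>] 0) (𝓝 (∫ _ in (ball x ρ)ᶜ, (0 : ℝ) ∂discMeasure)) by simpa using this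
  refine tendsto_integral_filter_of_dominated_convergence
    (fun _ => ‖v‖ * (16 / (1 - ‖x‖) ^ 2 + 2 * (ρ / 2)⁻¹ + 14 * ρ⁻¹) * F) ?_ ?_
    (integrable_const _) ?_
  · exact Filter.Eventually.of_forall fun t =>
      ((aestronglyMeasurable_greenQuotientError v t).aestronglyMeasurable).mul
        h.aestronglyMeasurable_source.restrict
  · have hmin : 0 < min (ρ / 2) ((1 - ‖x‖) / 2) / (‖v‖ + 1) := by positivity
    filter_upwards [Ioc_mem_nhdsGT hmin] with t ⟨ht, ht'⟩
    rw [le_div_iff₀ (by positivity)] at ht'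
    have htv : t * ‖v‖ ≤ min (ρ / 2) ((1 - ‖x‖) / 2) := by nlinarith
    filter_upwards [ae_restrict_mem measurableSet_ball.compl, ae_restrict_of_ae ae_norm_lt_one,
      ae_restrict_of_ae h.ae_bound] with y hy hy1 hf
    have hxy : ρ ≤ ‖x - y‖ := by
      rwa [Set.mem_compl_iff, mem_ball, not_lt, dist_comm, dist_eq_norm] at hy
    have hxy' : ρ / 2 ≤ ‖x + t • v - y‖ := by
      have h1 := norm_sub_norm_le (x - y) (-(t • v))
      rw [sub_neg_eq_add, norm_neg, norm_smul, Real.norm_of_nonneg ht.le,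
        sub_add_eq_add_sub] at h1
      linarith [htv.trans (min_le_left _ _)]
    rw [Real.norm_eq_abs, abs_mul]
    refine mul_le_mul ((abs_greenQuotientError_le hx hy1 ht (htv.trans (min_le_right _ _)) ?_
      ?_).trans ?_) hf (abs_nonneg _) (by positivity)
    · intro e; rw [e, sub_self, norm_zero] at hxy; linarith
    · intro e; rw [e, sub_self, norm_zero] at hxy'; linarith
    · gcongr
  · filter_upwards [ae_restrict_of_ae ae_norm_lt_one, ae_restrict_of_ae (ae_ne_discMeasure x)]
      with y hy hxy
    have h1 := (hasDerivAt_greenLog hx hy hxy v).tendsto_slope_zero_right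
    simp only [zero_add, zero_smul, add_zero, smul_eq_mul] at h1
    have h2 := (h1.sub_const ⟪v, greenGrad x y⟫).mul_const (f y)
    rw [sub_self, zero_mul] at h2
    exact h2

/-- The gradient of a solution in terms of the gradient of the Green function. -/
theorem four_pi_mul_fderiv_eq (h : DirichletSolution u f F) (hx : ‖x‖ < 1) (v : Plane) :
    4 * π * fderiv ℝ u x v = ∫ y, ⟪v, greenGrad x y⟫ * f y ∂discMeasure := by
  have hd : 0 < 1 - ‖x‖ := sub_pos.2 hx
  have hlin : HasDerivAt (fun t : ℝ => u (x + t • v)) (fderiv ℝ u x v) 0 :=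
    ((h.contDiffOn.contDiffAt (isOpen_ball.mem_nhds (mem_ball_zero_iff.2 hx))).differentiableAt
      two_ne_zero).hasFDerivAt.hasLineDerivAt v
  have h1 := (hlin.tendsto_slope_zero_right).const_mul (4 * π)
  simp only [zero_add, zero_smul, add_zero, smul_eq_mul] at h1
  have hI : ∀ᶠ t in 𝓝[>] (0 : ℝ), 4 * π * (t⁻¹ * (u (x + t • v) - u x)) -
      ∫ y, ⟪v, greenGrad x y⟫ * f y ∂discMeasure =
      ∫ y, greenQuotientError x v t y * f y ∂discMeasure ∧
      Integrable (fun y => greenQuotientError x v t y * f y) discMeasure := by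
    have hmin : 0 < ((1 - ‖x‖) / 2) / (‖v‖ + 1) := by positivity
    filter_upwards [Ioc_mem_nhdsGT hmin] with t ⟨ht, ht'⟩
    rw [le_div_iff₀ (by positivity)] at ht'
    have hxt : ‖x + t • v‖ < 1 := by
      have := norm_add_le x (t • v)
      rw [norm_smul, Real.norm_of_nonneg ht.le] at this
      nlinarith
    have j1 := h.integrable_greenLog_mul hxt
    have j2 := h.integrable_greenLog_mul hx
    have j3 := h.integrable_inner_greenGrad_mul hx v
    have e : (fun y => greenQuotientError x v t y * f y) = fun y =>
        t⁻¹ * (greenLog (x + t • v) y * f y - greenLog x y * f y) - ⟪v, greenGrad x y⟫ * f y := by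
      ext y; rw [greenQuotientError]; ring
    rw [e]
    refine ⟨?_, ((j1.sub j2).const_mul _).sub j3⟩
    have e2 := integral_sub ((j1.sub j2).const_mul t⁻¹) j3
    simp only [Pi.sub_apply] at e2
    rw [e2, integral_const_mul, integral_sub j1 j2,
      ← h.four_pi_mul_eq hxt, ← h.four_pi_mul_eq hx]
    ring
  have h2 : Filter.Tendsto (fun t : ℝ => 4 * π * (t⁻¹ * (u (x + t • v) - u x)) -
      ∫ y, ⟪v, greenGrad x y⟫ * f y ∂discMeasure) (𝓝[>] 0) (𝓝 0) := by
    rw [Metric.tendsto_nhds]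
    intro ε hε
    have hlim : Filter.Tendsto (fun ρ : ℝ => F * ‖v‖ *
        (16 / (1 - ‖x‖) ^ 2 * (π * ρ ^ 2) + 36 * π * ρ)) (𝓝[>] 0) (𝓝 0) := by
      have : Continuous fun ρ : ℝ => F * ‖v‖ *
        (16 / (1 - ‖x‖) ^ 2 * (π * ρ ^ 2) + 36 * π * ρ) := by fun_prop
      simpa using (this.tendsto 0).mono_left nhdsWithin_le_nhds
    obtain ⟨ρ, hρ1, hρ2, hρ3⟩ := ((hlim.eventually_lt_const (half_pos hε)).and
      (Ioc_mem_nhdsGT (show (0 : ℝ) < (1 - ‖x‖) / 2 by positivity))).exists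
    have hfar := (Metric.tendsto_nhds.1 (h.tendsto_far hx v hρ2)) (ε / 2) (half_pos hε)
    filter_upwards [hI, hfar, Ioc_mem_nhdsGT (show 0 < ρ / (‖v‖ + 1) by positivity)]
      with t ⟨ht1, ht2⟩ ht3 ⟨ht4, ht5⟩
    rw [le_div_iff₀ (by positivity)] at ht5
    have hn := h.near_bound hx v hρ2 hρ3 ht4 (by nlinarith)
    rw [dist_zero_right] at ht3 ⊢
    rw [ht1, ← integral_add_compl measurableSet_ball ht2]
    refine (norm_add_le _ _).trans_lt ?_
    linarith
  have h3 := tendsto_nhds_unique (h1.sub_const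
    (∫ y, ⟪v, greenGrad x y⟫ * f y ∂discMeasure)) h2
  linarith

end DirichletSolution

/-! ### The Pohozaev pairing -/

/-- The interaction kernel obtained by symmetrising `⟪X x, greenGrad x y⟫`. -/
noncomputable def pairKernel (X : Plane → Plane) (x y : Plane) : ℝ :=
  ⟪X x, greenGrad x y⟫ + ⟪X y, greenGrad y x⟫

namespace DirichletSolution

variable {u f : Plane → ℝ} {F N : ℝ} {X : Plane → Plane}

lemma integrable_inner_greenGrad_prod (h : DirichletSolution u f F) (hX : Measurable X)
    (hN : ∀ x ∈ unitDisc, ‖X x‖ ≤ N) :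
    Integrable (fun p : Plane × Plane => f p.1 * (⟪X p.1, greenGrad p.1 p.2⟫ * f p.2))
      (discMeasure.prod discMeasure) := by
  have hN0 : 0 ≤ N := (norm_nonneg _).trans (hN 0 (mem_ball_self one_pos))
  refine integrable_prod_of_le_inv (c := F * (N * 12 * F)) ?_ ?_
  · exact (h.aestronglyMeasurable_source.comp_fst).mul
      (((hX.comp measurable_fst).inner measurable_greenGrad).aestronglyMeasurable.mul
      h.aestronglyMeasurable_source.comp_snd)
  · intro x y hx hy hxy
    have hF := h.bound_nonneg
    have h1 : |⟪X x, greenGrad x y⟫| ≤ N * (12 * ‖x - y‖⁻¹) :=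
      (abs_inner_greenGrad_le hx hy hxy _).trans (by
        gcongr; exact hN x (mem_ball_zero_iff.2 hx))
    calc |f x * (⟪X x, greenGrad x y⟫ * f y)| = |f x| * (|⟪X x, greenGrad x y⟫| * |f y|) := by
          rw [abs_mul, abs_mul]
      _ ≤ F * (N * (12 * ‖x - y‖⁻¹) * F) := by
          gcongr
          · exact h.bound x (mem_ball_zero_iff.2 hx)
          · exact h.bound y (mem_ball_zero_iff.2 hy)
      _ = _ := by ring

lemma integrable_pairKernel (h : DirichletSolution u f F) (hX : Measurable X)
    (hN : ∀ x ∈ unitDisc, ‖X x‖ ≤ N) :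
    Integrable (fun p : Plane × Plane => f p.1 * f p.2 * pairKernel X p.1 p.2)
      (discMeasure.prod discMeasure) := by
  have h1 := h.integrable_inner_greenGrad_prod hX hN
  refine (h1.add h1.swap).congr (ae_of_all _ fun p => ?_)
  simp only [Pi.add_apply, Function.comp_apply, Prod.fst_swap, Prod.snd_swap, pairKernel]
  ring

/-- The virial identity: pairing the equation with a vector field. -/
theorem eight_pi_mul_integral_eq (h : DirichletSolution u f F) (hX : Measurable X)
    (hN : ∀ x ∈ unitDisc, ‖X x‖ ≤ N) :
    8 * π * ∫ x, f x * fderiv ℝ u x (X x) ∂discMeasure =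
      ∫ p, f p.1 * f p.2 * pairKernel X p.1 p.2 ∂(discMeasure.prod discMeasure) := by
  have h1 := h.integrable_inner_greenGrad_prod hX hN
  have e1 : 4 * π * ∫ x, f x * fderiv ℝ u x (X x) ∂discMeasure =
      ∫ p, f p.1 * (⟪X p.1, greenGrad p.1 p.2⟫ * f p.2) ∂(discMeasure.prod discMeasure) := by
    rw [integral_prod _ h1, ← integral_const_mul]
    refine integral_congr_ae ?_
    filter_upwards [ae_norm_lt_one] with x hx
    rw [integral_const_mul, ← h.four_pi_mul_fderiv_eq hx]
    ring
  have e2 := integral_prod_swap (μ := discMeasure) (ν := discMeasure)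
    (fun p : Plane × Plane => f p.1 * (⟪X p.1, greenGrad p.1 p.2⟫ * f p.2))
  calc _ = 4 * π * (∫ x, f x * fderiv ℝ u x (X x) ∂discMeasure) +
        4 * π * ∫ x, f x * fderiv ℝ u x (X x) ∂discMeasure := by ring
    _ = _ := by
      have e3 := integral_add h1.swap h1
      simp only [Function.comp_apply] at e3
      rw [e2] at e3
      rw [e1, ← e3]
      refine integral_congr_ae (ae_of_all _ fun p => ?_)
      simp only [Prod.fst_swap, Prod.snd_swap, pairKernel]
      ring

end DirichletSolution

/-! ### Solutions of the Liouville equation with a normalised maximum -/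

/-- The density `V e^u`. -/
noncomputable abbrev curv (u V : Plane → ℝ) (y : Plane) : ℝ := V y * exp (u y)

/-- A solution of `-Δu = V e^u` in the unit disc with zero boundary data, whose maximum is attained
at the interior point `x₀` and equals `-2 log r` with `r ≤ 1`. -/
structure LiouvillePeak (b C A s : ℝ) (u V : Plane → ℝ) (x₀ : Plane) (r : ℝ) : Prop where
  b_pos : 0 < b
  C_pos : 0 < C
  A_pos : 0 < A
  s_pos : 0 < s
  s_le_one : s ≤ 1
  r_pos : 0 < r
  r_le_one : r ≤ 1
  norm_lt : ‖x₀‖ < 1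
  contDiffOn : ContDiffOn ℝ 2 u unitDisc
  continuousOn : ContinuousOn u (closedBall 0 1)
  boundary : ∀ x ∈ sphere (0 : Plane) 1, u x = 0
  eq : ∀ x ∈ unitDisc, -lap u x = curv u V x
  nonneg : ∀ x ∈ closedBall (0 : Plane) 1, 0 ≤ V x
  le : ∀ x ∈ closedBall (0 : Plane) 1, V x ≤ b
  holder : ∀ x ∈ closedBall (0 : Plane) 1, ∀ y ∈ closedBall (0 : Plane) 1,
    |V x - V y| ≤ A * ‖x - y‖ ^ s
  mass : ∫ y, exp (u y) ∂discMeasure ≤ C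
  exp_le : ∀ x ∈ unitDisc, exp (u x) ≤ (r ^ 2)⁻¹
  exp_eq : exp (u x₀) = (r ^ 2)⁻¹

/-- The constant in the bound for the singular potential of the density. -/
noncomputable def potentialConst (b C : ℝ) : ℝ := 2 * π * b + b * C

/-- The constant in the gradient bound. -/
noncomputable def gradConst (b C : ℝ) : ℝ := 3 * potentialConst b C / π

namespace LiouvillePeak

variable {b C A s r : ℝ} {u V : Plane → ℝ} {x x₀ y : Plane}

lemma potentialConst_pos (h : LiouvillePeak b C A s u V x₀ r) : 0 < potentialConst b C := by
  have := h.b_pos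
  have := h.C_pos
  rw [potentialConst]; positivity

lemma gradConst_pos (h : LiouvillePeak b C A s u V x₀ r) : 0 < gradConst b C := by
  have := h.potentialConst_pos
  rw [gradConst]; positivity

lemma dist_pos (h : LiouvillePeak b C A s u V x₀ r) : 0 < 1 - ‖x₀‖ := sub_pos.2 h.norm_lt

lemma apply_peak (h : LiouvillePeak b C A s u V x₀ r) : u x₀ = 2 * log r⁻¹ := by
  rw [← Real.log_exp (u x₀), h.exp_eq, Real.log_inv, Real.log_inv, Real.log_pow]; push_cast; ring

lemma curv_nonneg (h : LiouvillePeak b C A s u V x₀ r) (hx : x ∈ unitDisc) : 0 ≤ curv u V x :=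
  mul_nonneg (h.nonneg x (ball_subset_closedBall hx)) (exp_pos _).le

lemma curv_le_mul_exp (h : LiouvillePeak b C A s u V x₀ r) (hx : x ∈ unitDisc) :
    curv u V x ≤ b * exp (u x) :=
  mul_le_mul_of_nonneg_right (h.le x (ball_subset_closedBall hx)) (exp_pos _).le

lemma curv_le (h : LiouvillePeak b C A s u V x₀ r) (hx : x ∈ unitDisc) :
    curv u V x ≤ b * (r ^ 2)⁻¹ :=
  (h.curv_le_mul_exp hx).trans (mul_le_mul_of_nonneg_left (h.exp_le x hx) h.b_pos.le)

lemma dirichlet (h : LiouvillePeak b C A s u V x₀ r) :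
    DirichletSolution u (curv u V) (b * (r ^ 2)⁻¹) where
  contDiffOn := h.contDiffOn
  continuousOn := h.continuousOn
  boundary := h.boundary
  eq := h.eq
  bound x hx := by rw [abs_of_nonneg (h.curv_nonneg hx)]; exact h.curv_le hx

lemma integrable_curv (h : LiouvillePeak b C A s u V x₀ r) :
    Integrable (curv u V) discMeasure := h.dirichlet.integrable_source

lemma integrable_exp (h : LiouvillePeak b C A s u V x₀ r) :
    Integrable (fun y => exp (u y)) discMeasure := by
  refine (integrable_const (r ^ 2)⁻¹).mono'
    (h.contDiffOn.continuousOn.rexp.aestronglyMeasurable measurableSet_ball) ?_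
  filter_upwards [ae_norm_lt_one] with y hy
  rw [Real.norm_of_nonneg (exp_pos _).le]
  exact h.exp_le y (mem_ball_zero_iff.2 hy)

lemma ae_curv_nonneg (h : LiouvillePeak b C A s u V x₀ r) :
    ∀ᵐ y ∂discMeasure, 0 ≤ curv u V y := by
  filter_upwards [ae_norm_lt_one] with y hy using h.curv_nonneg (mem_ball_zero_iff.2 hy)

lemma ae_curv_le_mul_exp (h : LiouvillePeak b C A s u V x₀ r) :
    ∀ᵐ y ∂discMeasure, curv u V y ≤ b * exp (u y) := by
  filter_upwards [ae_norm_lt_one] with y hy using h.curv_le_mul_exp (mem_ball_zero_iff.2 hy)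

lemma integral_curv_le (h : LiouvillePeak b C A s u V x₀ r) :
    ∫ y, curv u V y ∂discMeasure ≤ b * C := by
  refine (integral_mono_ae h.integrable_curv (h.integrable_exp.const_mul b)
    h.ae_curv_le_mul_exp).trans ?_
  rw [integral_const_mul]
  exact mul_le_mul_of_nonneg_left h.mass h.b_pos.le

lemma apply_nonneg (h : LiouvillePeak b C A s u V x₀ r) (hx : ‖x‖ < 1) : 0 ≤ u x := by
  have h1 := h.dirichlet.four_pi_mul_eq hx
  have h2 : 0 ≤ ∫ y, greenLog x y * curv u V y ∂discMeasure := by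
    refine integral_nonneg_of_ae ?_
    filter_upwards [ae_norm_lt_one, ae_ne_discMeasure x] with y hy hxy
    exact mul_nonneg (greenLog_nonneg hx hy hxy) (h.curv_nonneg (mem_ball_zero_iff.2 hy))
  rw [← h1] at h2
  exact nonneg_of_mul_nonneg_right h2 (by positivity)

lemma integrable_curv_mul_inv (h : LiouvillePeak b C A s u V x₀ r) (hx : ‖x‖ < 1) :
    Integrable (fun y => curv u V y * ‖x - y‖⁻¹) discMeasure := by
  refine integrable_of_le_inv (c := b * (r ^ 2)⁻¹) hx (h.integrable_curv.1.mul
    (Measurable.aestronglyMeasurable (by fun_prop))) fun y hy _ => ?_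
  rw [abs_mul, abs_of_nonneg (a := ‖x - y‖⁻¹) (by positivity)]
  gcongr
  exact h.dirichlet.bound y (mem_ball_zero_iff.2 hy)

lemma integral_curv_mul_inv_le (h : LiouvillePeak b C A s u V x₀ r) (hx : ‖x‖ < 1) :
    ∫ y, curv u V y * ‖x - y‖⁻¹ ∂discMeasure ≤ potentialConst b C / r := by
  have hr := h.r_pos
  have hb := h.b_pos
  have i0 : IntegrableOn (fun y => ‖x - y‖⁻¹) (ball x r) := integrableOn_inv_norm_sub_ball x r
  have i1 : Integrable ((ball x r).indicator fun y => ‖x - y‖⁻¹) :=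
    i0.integrable_indicator measurableSet_ball
  have i2 := (i1.integrableOn (s := unitDisc)).const_mul (b * (r ^ 2)⁻¹)
  have i3 := h.integrable_curv.mul_const r⁻¹
  have hle : ∫ y, (ball x r).indicator (fun y => ‖x - y‖⁻¹) y ∂discMeasure ≤ 2 * π * r := by
    rw [← setIntegral_inv_norm_sub_ball x hr.le]
    refine (setIntegral_le_integral i1 (ae_of_all _ fun y => Set.indicator_nonneg
      (fun _ _ => by positivity) _)).trans_eq (integral_indicator measurableSet_ball)
  calc ∫ y, curv u V y * ‖x - y‖⁻¹ ∂discMeasure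
      ≤ ∫ y, b * (r ^ 2)⁻¹ * (ball x r).indicator (fun y => ‖x - y‖⁻¹) y +
        curv u V y * r⁻¹ ∂discMeasure := by
        refine integral_mono_ae (h.integrable_curv_mul_inv hx) (i2.add i3) ?_
        filter_upwards [ae_norm_lt_one] with y hy
        have hc := h.curv_nonneg (mem_ball_zero_iff.2 hy)
        by_cases hyr : y ∈ ball x r
        · rw [Set.indicator_of_mem hyr]
          have := h.curv_le (mem_ball_zero_iff.2 hy)
          have h2 : 0 ≤ curv u V y * r⁻¹ := by positivity
          have h3 : curv u V y * ‖x - y‖⁻¹ ≤ b * (r ^ 2)⁻¹ * ‖x - y‖⁻¹ := by gcongr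
          linarith
        · rw [Set.indicator_of_notMem hyr, mul_zero, zero_add]
          rw [mem_ball', not_lt, dist_eq_norm] at hyr
          gcongr
    _ ≤ b * (r ^ 2)⁻¹ * (2 * π * r) + b * C * r⁻¹ := by
        rw [integral_add i2 i3, integral_const_mul, integral_mul_const]
        gcongr
        exact h.integral_curv_le
    _ = _ := by rw [potentialConst]; field_simp

lemma abs_fderiv_le (h : LiouvillePeak b C A s u V x₀ r) (hx : ‖x‖ < 1) (v : Plane) :
    |fderiv ℝ u x v| ≤ ‖v‖ * (gradConst b C / r) := by
  have h1 := h.dirichlet.four_pi_mul_fderiv_eq hx v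
  have h2 : |∫ y, ⟪v, greenGrad x y⟫ * curv u V y ∂discMeasure| ≤
      ‖v‖ * 12 * (potentialConst b C / r) := by
    rw [← Real.norm_eq_abs]
    calc _ ≤ ∫ y, ‖v‖ * 12 * (curv u V y * ‖x - y‖⁻¹) ∂discMeasure := by
          refine norm_integral_le_of_norm_le ((h.integrable_curv_mul_inv hx).const_mul _) ?_
          filter_upwards [ae_norm_lt_one, ae_ne_discMeasure x] with y hy hxy
          have hc := h.curv_nonneg (mem_ball_zero_iff.2 hy)
          rw [norm_mul, Real.norm_eq_abs, Real.norm_of_nonneg hc]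
          calc _ ≤ ‖v‖ * (12 * ‖x - y‖⁻¹) * curv u V y := by
                gcongr; exact DirichletSolution.abs_inner_greenGrad_le hx hy hxy v
            _ = _ := by ring
      _ ≤ _ := by
        rw [integral_const_mul]
        gcongr
        exact h.integral_curv_mul_inv_le hx
  rw [← h1, abs_mul, abs_of_pos (by positivity)] at h2
  have hr := h.r_pos
  calc |fderiv ℝ u x v| = (4 * π * |fderiv ℝ u x v|) / (4 * π) := by field_simp
    _ ≤ (‖v‖ * 12 * (potentialConst b C / r)) / (4 * π) := by gcongr
    _ = _ := by rw [gradConst]; field_simp; ring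

/-- The height of the maximum is controlled by its distance to the boundary. -/
lemma log_inv_le (h : LiouvillePeak b C A s u V x₀ r) :
    2 * π * log r⁻¹ ≤ (1 - ‖x₀‖) * (potentialConst b C / r) := by
  have hx := h.norm_lt
  have h1 := h.dirichlet.four_pi_mul_eq hx
  have h2 : ∫ y, greenLog x₀ y * curv u V y ∂discMeasure ≤
      4 * (1 - ‖x₀‖) * (potentialConst b C / r) := by
    calc _ ≤ ∫ y, 4 * (1 - ‖x₀‖) * (curv u V y * ‖x₀ - y‖⁻¹) ∂discMeasure := by
          refine integral_mono_ae (h.dirichlet.integrable_greenLog_mul hx)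
            ((h.integrable_curv_mul_inv hx).const_mul _) ?_
          filter_upwards [ae_norm_lt_one, ae_ne_discMeasure x₀] with y hy hxy
          have hc := h.curv_nonneg (mem_ball_zero_iff.2 hy)
          calc _ ≤ 4 * (1 - ‖x₀‖) * ‖x₀ - y‖⁻¹ * curv u V y := by
                gcongr; exact greenLog_le hx hy hxy
            _ = _ := by ring
      _ ≤ _ := by
        rw [integral_const_mul]
        have := h.dist_pos
        gcongr
        exact h.integral_curv_mul_inv_le hx
  rw [← h1, h.apply_peak] at h2
  linarith

end LiouvillePeak

/-! ### The global Pohozaev identity -/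

section Lipschitz

/-- A Hölder function is approximated from below by a Lipschitz function on the scale `r`. -/
lemma exists_lipschitz_minorant {E : Type*} [PseudoMetricSpace E] {S : Set E} {V : E → ℝ}
    {A s r : ℝ} (hS : S.Nonempty) (hA : 0 ≤ A) (hs : 0 < s) (hs1 : s ≤ 1) (hr : 0 < r)
    (hV : ∀ x ∈ S, 0 ≤ V x) (hVs : ∀ x ∈ S, ∀ y ∈ S, |V x - V y| ≤ A * dist x y ^ s) :
    ∃ W : E → ℝ, LipschitzWith (A * r ^ (s - 1)).toNNReal W ∧
      ∀ x ∈ S, W x ≤ V x ∧ V x - A * r ^ s ≤ W x := by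
  have : Nonempty S := hS.to_subtype
  set K := A * r ^ (s - 1)
  have hK : 0 ≤ K := by positivity
  have hbdd (x : E) : BddBelow (Set.range fun y : S => V y + K * dist x y) := by
    refine ⟨0, ?_⟩
    rintro _ ⟨y, rfl⟩
    have := hV y y.2
    positivity
  refine ⟨fun x => ⨅ y : S, (V y + K * dist x y), ?_, fun x hx => ⟨?_, ?_⟩⟩
  · refine LipschitzWith.of_le_add_mul _ fun x y => ?_
    rw [Real.coe_toNNReal _ hK, ← sub_le_iff_le_add]
    refine le_ciInf fun z => ?_
    have h1 := ciInf_le (hbdd x) z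
    have h2 : K * dist x z ≤ K * (dist x y + dist y z) := by gcongr; exact dist_triangle _ _ _
    linarith
  · refine (ciInf_le (hbdd x) ⟨x, hx⟩).trans ?_
    simp
  · refine le_ciInf fun y => ?_
    have h1 := (abs_le.1 (hVs x hx y y.2)).2
    rcases le_total (dist x (y : E)) r with h | h
    · have h2 : A * dist x (y : E) ^ s ≤ A * r ^ s := by gcongr
      have h3 : 0 ≤ K * dist x (y : E) := by positivity
      linarith
    · have h0 : 0 < dist x (y : E) := hr.trans_le h
      have h2 : dist x (y : E) ^ s ≤ r ^ (s - 1) * dist x (y : E) := by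
        calc dist x (y : E) ^ s = dist x (y : E) ^ (s - 1) * dist x (y : E) := by
              rw [← Real.rpow_add_one h0.ne', sub_add_cancel]
          _ ≤ _ := by
              gcongr ?_ * _
              exact Real.rpow_le_rpow_of_nonpos hr h (by linarith)
      have h3 : A * dist x (y : E) ^ s ≤ K * dist x (y : E) := by
        calc _ ≤ A * (r ^ (s - 1) * dist x (y : E)) := by gcongr
          _ = _ := by ring
      have h4 : 0 ≤ A * r ^ s := by positivity
      linarith

lemma abs_integral_mul_fderiv_le {E : Type*} [NormedAddCommGroup E] [InnerProductSpace ℝ E]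
    [FiniteDimensional ℝ E] [MeasurableSpace E] [BorelSpace E] {W H : E → ℝ} {K : NNReal}
    (hW : LipschitzWith K W) (hH : ContDiff ℝ 1 H) (hc : HasCompactSupport H) (v : E) :
    |∫ x, W x * fderiv ℝ H x v| ≤ K * ‖v‖ * ∫ x, |H x| := by
  obtain ⟨D, hD⟩ := hH.lipschitzWith_of_hasCompactSupport hc one_ne_zero
  have h1 := LipschitzWith.integral_lineDeriv_mul_eq (μ := volume) hW hD hc (-v)
  rw [neg_neg] at h1
  have h2 : ∫ x, W x * fderiv ℝ H x v = ∫ x, lineDeriv ℝ W x (-v) * H x := by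
    rw [h1]
    refine integral_congr_ae (ae_of_all _ fun x => ?_)
    beta_reduce
    rw [((hH.differentiable one_ne_zero) x).lineDeriv_eq_fderiv, mul_comm]
  rw [h2, ← Real.norm_eq_abs, ← integral_const_mul]
  refine norm_integral_le_of_norm_le
    ((hH.continuous.integrable_of_hasCompactSupport hc).abs.const_mul _) (ae_of_all _ fun x => ?_)
  rw [norm_mul, Real.norm_eq_abs (H x)]
  gcongr
  simpa using norm_lineDeriv_le_of_lipschitz ℝ hW (x₀ := x) (v := -v)

lemma contDiff_of_tsupport_subset {E : Type*} [NormedAddCommGroup E] [NormedSpace ℝ E]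
    {Ω : Set E} {H : E → ℝ} {n : WithTop ℕ∞} (hΩ : IsOpen Ω) (hH : ContDiffOn ℝ n H Ω)
    (hs : tsupport H ⊆ Ω) : ContDiff ℝ n H :=
  contDiff_iff_contDiffAt.2 fun x => by
    by_cases hx : x ∈ tsupport H
    · exact hH.contDiffAt (hΩ.mem_nhds (hs hx))
    · exact contDiffAt_const.congr_of_eventuallyEq (notMem_tsupport_iff_eventuallyEq.1 hx)

lemma sum_coord_mul_apply (L : Plane →L[ℝ] ℝ) (x : Plane) :
    ∑ i : Fin 2, x i * L (EuclideanSpace.single i 1) = L x := by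
  have h := (EuclideanSpace.basisFun (Fin 2) ℝ).sum_repr x
  conv_rhs => rw [← h]
  simp

lemma abs_coord_le (x : Plane) (i : Fin 2) : |x i| ≤ ‖x‖ := by
  simpa using EuclideanSpace.norm_eq x ▸ PiLp.norm_apply_le x i

end Lipschitz

section Radial

variable {g W : Plane → ℝ} {G B N κ : ℝ} {K : NNReal}

lemma sum_fderiv_cutoff_mul_coord {χ : Plane → ℝ} {y : Plane} (p : Plane)
    (hχ : DifferentiableAt ℝ χ y) (hg : DifferentiableAt ℝ g y) :
    ∑ i : Fin 2, fderiv ℝ (fun z => χ z * ((z - p) i * g z)) y (EuclideanSpace.single i 1) =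
      χ y * (fderiv ℝ g y (y - p) + 2 * g y) + fderiv ℝ χ y (y - p) * g y := by
  have hi (i : Fin 2) : HasFDerivAt (fun z : Plane => (z - p) i)
      (EuclideanSpace.proj i : Plane →L[ℝ] ℝ) y :=
    ((EuclideanSpace.proj i : Plane →L[ℝ] ℝ).hasFDerivAt (x := y)).sub_const (p i)
  have h (i : Fin 2) : fderiv ℝ (fun z => χ z * ((z - p) i * g z)) y
      (EuclideanSpace.single i 1) =
      χ y * ((y - p) i * fderiv ℝ g y (EuclideanSpace.single i 1)) + χ y * g y +
        ((y - p) i * fderiv ℝ χ y (EuclideanSpace.single i 1)) * g y := by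
    rw [(hχ.hasFDerivAt.fun_mul ((hi i).fun_mul hg.hasFDerivAt)).fderiv]
    simp
    ring
  rw [Fin.sum_univ_two, h 0, h 1, ← sum_coord_mul_apply (fderiv ℝ g y) (y - p),
    ← sum_coord_mul_apply (fderiv ℝ χ y) (y - p), Fin.sum_univ_two, Fin.sum_univ_two]
  ring

lemma abs_integral_cutoff_le {χ : Plane → ℝ} {p : Plane} {M : ℝ} (hg : ContDiffOn ℝ 1 g unitDisc)
    (hi : Integrable g discMeasure) (hW : LipschitzWith K W) (hχ : ContDiff ℝ 1 χ)
    (hχ0 : ∀ y, 0 ≤ χ y) (hχ1 : ∀ y, χ y ≤ 1) (hχs : tsupport χ ⊆ unitDisc)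
    (hM : ∀ y ∈ unitDisc, ‖y - p‖ ≤ M) :
    |∫ y, W y * (χ y * (fderiv ℝ g y (y - p) + 2 * g y) + fderiv ℝ χ y (y - p) * g y)
      ∂discMeasure| ≤ 2 * K * (M * ∫ y, |g y| ∂discMeasure) := by
  have hM0 : 0 ≤ M := (norm_nonneg _).trans (hM 0 (mem_ball_self one_pos))
  set H : Fin 2 → Plane → ℝ := fun i z => χ z * ((z - p) i * g z)
  have hχc : HasCompactSupport χ :=
    isCompact_of_isClosed_isBounded (isClosed_tsupport _) (isBounded_ball.subset hχs)
  have hsupp (i : Fin 2) : tsupport (H i) ⊆ unitDisc := (tsupport_mul_subset_left).trans hχs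
  have hc (i : Fin 2) : HasCompactSupport (H i) := hχc.mul_right
  have hH (i : Fin 2) : ContDiff ℝ 1 (H i) := by
    refine contDiff_of_tsupport_subset isOpen_ball ?_ (hsupp i)
    have hp : ContDiff ℝ 1 fun z : Plane => (z - p) i :=
      (EuclideanSpace.proj i : Plane →L[ℝ] ℝ).contDiff.sub contDiff_const
    exact hχ.contDiffOn.mul (hp.contDiffOn.mul hg)
  have hInt (i : Fin 2) : Integrable
      (fun y => W y * fderiv ℝ (H i) y (EuclideanSpace.single i 1)) := by
    refine Continuous.integrable_of_hasCompactSupport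
      (hW.continuous.mul (((hH i).continuous_fderiv one_ne_zero).clm_apply continuous_const)) ?_
    have hc' : HasCompactSupport fun y => fderiv ℝ (H i) y (EuclideanSpace.single i 1) :=
      (hc i).of_isClosed_subset (isClosed_tsupport _) (tsupport_fderiv_apply_subset ℝ _)
    exact hc'.mul_left
  have h0 (i : Fin 2) (y : Plane) (hy : y ∉ unitDisc) :
      W y * fderiv ℝ (H i) y (EuclideanSpace.single i 1) = 0 := by
    rw [image_eq_zero_of_notMem_tsupport (f := fun y => fderiv ℝ (H i) y
      (EuclideanSpace.single i 1)) fun h => hy (hsupp i (tsupport_fderiv_apply_subset ℝ _ h)),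
      mul_zero]
  have e : ∫ y, W y * (χ y * (fderiv ℝ g y (y - p) + 2 * g y) +
      fderiv ℝ χ y (y - p) * g y) ∂discMeasure =
      ∑ i : Fin 2, ∫ y, W y * fderiv ℝ (H i) y (EuclideanSpace.single i 1) := by
    rw [← integral_finsetSum _ fun i _ => hInt i,
      ← setIntegral_eq_integral_of_forall_compl_eq_zero (s := unitDisc) fun y hy =>
        Finset.sum_eq_zero fun i _ => h0 i y hy]
    refine setIntegral_congr_fun measurableSet_ball fun y hy => ?_
    beta_reduce
    rw [← sum_fderiv_cutoff_mul_coord p (hχ.differentiable one_ne_zero y) ((hg.differentiableOn one_ne_zero).differentiableAt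
      (isOpen_ball.mem_nhds hy)), Finset.mul_sum]
  have hb (i : Fin 2) : |∫ y, W y * fderiv ℝ (H i) y (EuclideanSpace.single i 1)| ≤
      K * (M * ∫ y, |g y| ∂discMeasure) := by
    refine (abs_integral_mul_fderiv_le hW (hH i) (hc i) _).trans ?_
    rw [PiLp.norm_single, norm_one, mul_one]
    gcongr
    rw [← setIntegral_eq_integral_of_forall_compl_eq_zero (s := unitDisc) fun y hy => by
      rw [image_eq_zero_of_notMem_tsupport fun h => hy (hsupp i h), abs_zero]]
    rw [← integral_const_mul]
    refine integral_mono_ae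
      ((hH i).continuous.integrable_of_hasCompactSupport (hc i)).abs.integrableOn
      (hi.abs.const_mul M) ?_
    filter_upwards [ae_norm_lt_one] with y hy
    rw [abs_mul, abs_mul, abs_of_nonneg (hχ0 y)]
    calc _ ≤ 1 * (M * |g y|) := by
          gcongr
          · exact hχ1 y
          · exact (abs_coord_le _ i).trans (hM y (mem_ball_zero_iff.2 hy))
      _ = _ := by ring
  rw [e]
  refine (Finset.abs_sum_le_sum_abs _ _).trans ((Finset.sum_le_sum fun i _ => hb i).trans_eq ?_)
  simp
  ring

lemma tendsto_integral_fderiv_cutoff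
    (hzero : ∀ ε > 0, ∃ δ > 0, ∀ y : Plane, ‖y‖ < 1 → 1 - δ < ‖y‖ → |g y| < ε)
    (hN : ∀ y ∈ unitDisc, |W y| ≤ N) :
    Filter.Tendsto (fun κ : ℝ => ∫ y, W y * (fderiv ℝ (discCutoff κ) y y * g y) ∂discMeasure)
      (𝓝[>] 0) (𝓝 0) := by
  obtain ⟨K, hK, hK'⟩ := exists_deriv_smoothTransition_le
  have hN0 : 0 ≤ N := (abs_nonneg _).trans (hN 0 (mem_ball_self one_pos))
  set A := N * (2 * K) with hA
  have hA0 : 0 ≤ A := by positivity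
  rw [Metric.tendsto_nhds]
  intro ε hε
  obtain ⟨δ, hδ, H⟩ := hzero (ε / (A * π + 1)) (by positivity)
  have hmin : 0 < min (1 / 2) (δ / 4) := by positivity
  filter_upwards [Ioc_mem_nhdsGT hmin] with κ ⟨hκ, hκ'⟩
  have hκ2 := hκ'.trans (min_le_left _ _)
  have hκ3 := hκ'.trans (min_le_right _ _)
  have hlayer : ∫ y, W y * (fderiv ℝ (discCutoff κ) y y * g y) ∂discMeasure =
      ∫ y in cutoffLayer κ, W y * (fderiv ℝ (discCutoff κ) y y * g y) :=
    setIntegral_eq_of_subset_of_forall_sdiff_eq_zero measurableSet_ball (cutoffLayer_subset hκ)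
      fun y hy => by
        have h := quad_notMem_Icc hκ hy.2
        rw [quad_discCutoff hκ] at h
        rw [fderiv_discCutoff hκ, (deriv_smoothTransition_eq_zero h).1]
        ring
  rw [dist_zero_right, hlayer]
  have hfin : volume (cutoffLayer κ) < ⊤ :=
    (measure_mono (cutoffLayer_subset hκ)).trans_lt measure_ball_lt_top
  calc _ ≤ A / κ * (ε / (A * π + 1)) * volume.real (cutoffLayer κ) := by
        refine norm_setIntegral_le_of_norm_le_const hfin fun y hy => ?_
        have hyd := cutoffLayer_subset hκ hy
        have hy1 : ‖y‖ < 1 := mem_ball_zero_iff.1 hyd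
        have hg1 : |g y| ≤ ε / (A * π + 1) := (H y hy1 (by nlinarith [hy.1, norm_nonneg y])).le
        have hd : |fderiv ℝ (discCutoff κ) y y| ≤ 2 * K / κ := by
          rw [fderiv_discCutoff hκ, real_inner_smul_left, real_inner_self_eq_norm_sq, abs_mul,
            abs_mul, abs_mul, abs_neg, abs_of_pos (two_pos (α := ℝ)), abs_of_pos (inv_pos.2 hκ),
            abs_of_nonneg (sq_nonneg ‖y‖)]
          calc _ ≤ K * (2 * (κ⁻¹ * 1)) := by
                gcongr
                · exact (hK' _).1
                · nlinarith [norm_nonneg y]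
            _ = _ := by ring
        rw [Real.norm_eq_abs, abs_mul, abs_mul]
        calc _ ≤ N * (2 * K / κ * (ε / (A * π + 1))) := by gcongr; exact hN y hyd
          _ = _ := by rw [hA]; ring
    _ ≤ A / κ * (ε / (A * π + 1)) * (π * κ) := by
        gcongr; exact volume_cutoffLayer_le hκ hκ2
    _ = ε * ((A * π) / (A * π + 1)) := by field_simp
    _ < ε := by
        refine mul_lt_of_lt_one_right hε ?_
        rw [div_lt_one (by positivity)]
        linarith

/-- Radial integration by parts against a Lipschitz weight, for functions vanishing on the
boundary. -/
lemma abs_integral_radial_le (hg : ContDiffOn ℝ 1 g unitDisc)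
    (hG : ∀ y ∈ unitDisc, |fderiv ℝ g y y| ≤ G) (hB : ∀ y ∈ unitDisc, |g y| ≤ B)
    (hzero : ∀ ε > 0, ∃ δ > 0, ∀ y : Plane, ‖y‖ < 1 → 1 - δ < ‖y‖ → |g y| < ε)
    (hW : LipschitzWith K W) (hN : ∀ y ∈ unitDisc, |W y| ≤ N) :
    |∫ y, W y * (fderiv ℝ g y y + 2 * g y) ∂discMeasure| ≤
      2 * K * ∫ y, |g y| ∂discMeasure := by
  have hN0 : 0 ≤ N := (abs_nonneg _).trans (hN 0 (mem_ball_self one_pos))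
  have hG0 : 0 ≤ G := (abs_nonneg _).trans (hG 0 (mem_ball_self one_pos))
  have hB0 : 0 ≤ B := (abs_nonneg _).trans (hB 0 (mem_ball_self one_pos))
  have hgm : AEStronglyMeasurable g discMeasure :=
    hg.continuousOn.aestronglyMeasurable measurableSet_ball
  have hi : Integrable g discMeasure := by
    refine (integrable_const B).mono' hgm ?_
    filter_upwards [ae_norm_lt_one] with y hy using hB y (mem_ball_zero_iff.2 hy)
  have hdm : AEStronglyMeasurable (fun y => fderiv ℝ g y y) discMeasure :=
    ((hg.continuousOn_fderiv_of_isOpen isOpen_ball le_rfl).clm_apply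
      continuousOn_id).aestronglyMeasurable measurableSet_ball
  have hm : AEStronglyMeasurable (fun y => fderiv ℝ g y y + 2 * g y) discMeasure :=
    hdm.add (hgm.const_mul 2)
  have hWm : AEStronglyMeasurable W discMeasure := hW.continuous.aestronglyMeasurable
  have hζm (κ : ℝ) : AEStronglyMeasurable (discCutoff κ) discMeasure :=
    (contDiff_discCutoff κ).continuous.aestronglyMeasurable
  have hle (κ : ℝ) : ∀ᵐ y ∂discMeasure,
      ‖W y * (discCutoff κ y * (fderiv ℝ g y y + 2 * g y))‖ ≤ N * (G + 2 * B) := by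
    filter_upwards [ae_norm_lt_one] with y hy
    have hy' := mem_ball_zero_iff.2 hy
    rw [Real.norm_eq_abs, abs_mul, abs_mul, abs_of_nonneg discCutoff_nonneg]
    have h1 : |fderiv ℝ g y y + 2 * g y| ≤ G + 2 * B := by
      refine (abs_add_le _ _).trans ?_
      rw [abs_mul, abs_of_pos (two_pos (α := ℝ))]
      linarith [hG y hy', hB y hy']
    have h2 := mul_le_mul (discCutoff_le_one (κ := κ) (y := y)) h1 (abs_nonneg _) zero_le_one
    rw [one_mul] at h2
    exact mul_le_mul (hN y hy') h2 (mul_nonneg discCutoff_nonneg (abs_nonneg _)) hN0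
  have h1 : Filter.Tendsto (fun κ : ℝ => ∫ y, W y * (discCutoff κ y *
      (fderiv ℝ g y y + 2 * g y)) ∂discMeasure) (𝓝[>] 0)
      (𝓝 (∫ y, W y * (fderiv ℝ g y y + 2 * g y) ∂discMeasure)) := by
    refine tendsto_integral_filter_of_dominated_convergence (fun _ => N * (G + 2 * B))
      (Filter.Eventually.of_forall fun κ => hWm.mul ((hζm κ).mul hm))
      (Filter.Eventually.of_forall hle) (integrable_const _) ?_
    filter_upwards [ae_norm_lt_one] with y hy
    refine tendsto_const_nhds.congr' ?_
    have hy2 : 0 < (1 - ‖y‖ ^ 2) / 2 := half_pos (one_sub_norm_sq_pos hy)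
    filter_upwards [Ioc_mem_nhdsGT hy2] with κ ⟨hκ, hκ'⟩
    rw [discCutoff_eq_one hκ (by linarith), one_mul]
  have h2 := tendsto_integral_fderiv_cutoff hzero hN
  have h3 := (h1.add h2).abs
  rw [add_zero] at h3
  refine le_of_tendsto h3 ?_
  filter_upwards [self_mem_nhdsWithin] with κ (hκ : 0 < κ)
  have h4 := abs_integral_cutoff_le (p := 0) (M := 1) hg hi hW
    ((contDiff_discCutoff κ).of_le one_le_two) (fun _ => discCutoff_nonneg)
    (fun _ => discCutoff_le_one)
    ((tsupport_discCutoff_subset hκ).trans (closedBall_sqrt_subset hκ))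
    (fun y hy => by rw [sub_zero]; exact (mem_ball_zero_iff.1 hy).le)
  simp only [sub_zero, one_mul] at h4
  refine le_of_eq_of_le ?_ h4
  have hInt : Integrable (fun y => W y * (fderiv ℝ (discCutoff κ) y y * g y)) discMeasure := by
    have hc : Continuous fun y => fderiv ℝ (discCutoff κ) y y :=
      ((contDiff_discCutoff κ).continuous_fderiv two_ne_zero).clm_apply continuous_id
    obtain ⟨D, hD⟩ := (isCompact_closedBall (0 : Plane) 1).exists_bound_of_continuousOn
      hc.continuousOn
    refine (integrable_const (N * (D * B))).mono'
      (hWm.mul (hc.aestronglyMeasurable.mul hgm)) ?_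
    filter_upwards [ae_norm_lt_one] with y hy
    have hy' := mem_ball_zero_iff.2 hy
    have hD' := hD y (mem_closedBall_zero_iff.2 hy.le)
    rw [norm_mul, norm_mul]
    have : 0 ≤ D := (norm_nonneg _).trans hD'
    gcongr
    · exact hN y hy'
    · exact hB y hy'
  have hInt' : Integrable (fun y => W y * (discCutoff κ y * (fderiv ℝ g y y + 2 * g y)))
      discMeasure := (integrable_const (N * (G + 2 * B))).mono' (hWm.mul ((hζm κ).mul hm)) (hle κ)
  rw [← integral_add hInt' hInt]
  congr 1
  refine integral_congr_ae (ae_of_all _ fun y => ?_)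
  ring

end Radial

/-- The constant in the global Pohozaev estimate. -/
noncomputable def globalConst (b C A : ℝ) : ℝ := A * gradConst b C * C + 2 * A * C + 2 * (b + A) * C

/-- The mass of the density on a disc. -/
noncomputable def discMass (u V : Plane → ℝ) (x₀ : Plane) (ρ : ℝ) : ℝ :=
  ∫ y in ball x₀ ρ, curv u V y

lemma restrict_discMeasure {S : Set Plane} (hS : MeasurableSet S) (h : S ⊆ unitDisc) :
    discMeasure.restrict S = volume.restrict S := by
  rw [discMeasure, Measure.restrict_restrict hS, Set.inter_eq_left.2 h]

namespace LiouvillePeak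

variable {b C A s r ρ : ℝ} {u V : Plane → ℝ} {x x₀ y : Plane}

lemma globalConst_pos (h : LiouvillePeak b C A s u V x₀ r) : 0 < globalConst b C A := by
  have := h.b_pos
  have := h.C_pos
  have := h.A_pos
  have := h.gradConst_pos
  rw [globalConst]; positivity

lemma differentiableAt (h : LiouvillePeak b C A s u V x₀ r) (hx : x ∈ unitDisc) :
    DifferentiableAt ℝ u x :=
  (h.contDiffOn.differentiableOn two_ne_zero).differentiableAt (isOpen_ball.mem_nhds hx)

lemma ball_subset (hρ : ρ ≤ 1 - ‖x₀‖) : ball x₀ ρ ⊆ unitDisc :=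
  ball_subset_ball' (by rw [dist_zero_right]; linarith)

lemma setIntegral_curv_eq (hρ : ρ ≤ 1 - ‖x₀‖) :
    ∫ y in ball x₀ ρ, curv u V y ∂discMeasure = discMass u V x₀ ρ := by
  rw [restrict_discMeasure measurableSet_ball (ball_subset hρ), discMass]

lemma fderiv_exp_sub_one (h : LiouvillePeak b C A s u V x₀ r) (hx : x ∈ unitDisc) (v : Plane) :
    fderiv ℝ (fun y => exp (u y) - 1) x v = exp (u x) * fderiv ℝ u x v := by
  rw [((h.differentiableAt hx).hasFDerivAt.exp.sub_const 1).fderiv]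
  rfl

lemma abs_fderiv_le_of_norm_le (h : LiouvillePeak b C A s u V x₀ r) (hx : ‖x‖ < 1) {v : Plane} {N : ℝ}
    (hv : ‖v‖ ≤ N) : |fderiv ℝ u x v| ≤ N * (gradConst b C / r) := by
  refine (h.abs_fderiv_le hx v).trans ?_
  have := h.gradConst_pos
  have := h.r_pos
  gcongr

lemma abs_integral_curv_mul_radial_le (h : LiouvillePeak b C A s u V x₀ r) :
    |∫ x, curv u V x * fderiv ℝ u x x ∂discMeasure| ≤ globalConst b C A * r ^ (s - 1) := by
  have hr := h.r_pos
  have hb := h.b_pos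
  have hA := h.A_pos
  have hC := h.C_pos
  have hK := h.gradConst_pos
  obtain ⟨W, hW, hWV⟩ := exists_lipschitz_minorant (S := closedBall (0 : Plane) 1) (V := V)
    ⟨0, mem_closedBall_self zero_le_one⟩ hA.le h.s_pos h.s_le_one hr h.nonneg
    (fun x hx y hy => by rw [dist_eq_norm]; exact h.holder x hx y hy)
  have hrs : r ^ s ≤ 1 := Real.rpow_le_one hr.le h.r_le_one h.s_pos.le
  have hrs1 : 1 ≤ r ^ (s - 1) :=
    Real.one_le_rpow_of_pos_of_le_one_of_nonpos hr h.r_le_one (by linarith [h.s_le_one])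
  have hWN (y) (hy : y ∈ unitDisc) : |W y| ≤ b + A := by
    obtain ⟨h1, h2⟩ := hWV y (ball_subset_closedBall hy)
    have h3 := h.nonneg y (ball_subset_closedBall hy)
    have h4 := h.le y (ball_subset_closedBall hy)
    have h5 : A * r ^ s ≤ A * 1 := by gcongr
    rw [abs_le]
    constructor <;> linarith
  set g : Plane → ℝ := fun y => exp (u y) - 1
  have hgC : ContDiffOn ℝ 1 g unitDisc :=
    ((h.contDiffOn.of_le one_le_two).exp).sub contDiffOn_const
  have hg0 (y) (hy : y ∈ unitDisc) : 0 ≤ g y :=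
    sub_nonneg.2 (Real.one_le_exp (h.apply_nonneg (mem_ball_zero_iff.1 hy)))
  have hg1 (y) (hy : y ∈ unitDisc) : |g y| ≤ exp (u y) := by
    rw [abs_of_nonneg (hg0 y hy)]
    exact sub_le_self _ zero_le_one
  have hdu (y) (hy : y ∈ unitDisc) : |fderiv ℝ u y y| ≤ gradConst b C / r := by
    simpa using h.abs_fderiv_le_of_norm_le (mem_ball_zero_iff.1 hy) (mem_ball_zero_iff.1 hy).le
  have hdg (y) (hy : y ∈ unitDisc) : |fderiv ℝ g y y| ≤ exp (u y) * (gradConst b C / r) := by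
    rw [h.fderiv_exp_sub_one hy, abs_mul, abs_of_pos (exp_pos _)]
    gcongr
    exact hdu y hy
  have hzero : ∀ ε > 0, ∃ δ > 0, ∀ y : Plane, ‖y‖ < 1 → 1 - δ < ‖y‖ → |g y| < ε := by
    intro ε hε
    obtain ⟨δ, hδ, H⟩ := h.dirichlet.exists_abs_lt_near_boundary
      (ε := min 1 (ε / 2)) (by positivity)
    refine ⟨δ, hδ, fun y hy hy' => ?_⟩
    have h1 := H y hy.le hy'
    have h2 := Real.abs_exp_sub_one_le (h1.le.trans (min_le_left _ _))
    have h3 := h1.trans_le (min_le_right _ _)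
    linarith
  have hrad := abs_integral_radial_le hgC (G := (r ^ 2)⁻¹ * (gradConst b C / r))
    (fun y hy => (hdg y hy).trans (by gcongr; exact h.exp_le y hy))
    (fun y hy => (hg1 y hy).trans (h.exp_le y hy)) hzero hW hWN
  have hgm : AEStronglyMeasurable g discMeasure :=
    hgC.continuousOn.aestronglyMeasurable measurableSet_ball
  have hdm : AEStronglyMeasurable (fun y => fderiv ℝ g y y) discMeasure :=
    ((hgC.continuousOn_fderiv_of_isOpen isOpen_ball le_rfl).clm_apply
      continuousOn_id).aestronglyMeasurable measurableSet_ball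
  have hWm : AEStronglyMeasurable W discMeasure := hW.continuous.aestronglyMeasurable
  have hgi : Integrable g discMeasure := h.integrable_exp.sub (integrable_const 1)
  have hdi : Integrable (fun y => fderiv ℝ g y y) discMeasure := by
    refine (h.integrable_exp.mul_const (gradConst b C / r)).mono' hdm ?_
    filter_upwards [ae_norm_lt_one] with y hy using hdg y (mem_ball_zero_iff.2 hy)
  have i2 : Integrable (fun y => W y * (fderiv ℝ g y y + 2 * g y)) discMeasure := by
    refine (hdi.add (hgi.const_mul 2)).bdd_mul (c := b + A) hWm ?_
    filter_upwards [ae_norm_lt_one] with y hy using hWN y (mem_ball_zero_iff.2 hy)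
  have i3 : Integrable (fun y => W y * g y) discMeasure := by
    refine hgi.bdd_mul (c := b + A) hWm ?_
    filter_upwards [ae_norm_lt_one] with y hy using hWN y (mem_ball_zero_iff.2 hy)
  have i4 : Integrable (fun y => W y * fderiv ℝ g y y) discMeasure := by
    refine hdi.bdd_mul (c := b + A) hWm ?_
    filter_upwards [ae_norm_lt_one] with y hy using hWN y (mem_ball_zero_iff.2 hy)
  have hdum : AEStronglyMeasurable (fun y => fderiv ℝ u y y) discMeasure :=
    ((h.contDiffOn.continuousOn_fderiv_of_isOpen isOpen_ball one_le_two).clm_apply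
      continuousOn_id).aestronglyMeasurable measurableSet_ball
  have i0 : Integrable (fun x => curv u V x * fderiv ℝ u x x) discMeasure := by
    refine h.integrable_curv.mul_bdd (c := gradConst b C / r) hdum ?_
    filter_upwards [ae_norm_lt_one] with y hy using hdu y (mem_ball_zero_iff.2 hy)
  have i1 : Integrable (fun x => curv u V x * fderiv ℝ u x x - W x * fderiv ℝ g x x)
    discMeasure := i0.sub i4
  have hInt : ∫ y, |g y| ∂discMeasure ≤ C := by
    refine (integral_mono_ae hgi.abs h.integrable_exp ?_).trans h.mass
    filter_upwards [ae_norm_lt_one] with y hy using hg1 y (mem_ball_zero_iff.2 hy)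
  have e : ∫ x, curv u V x * fderiv ℝ u x x ∂discMeasure =
      (∫ x, curv u V x * fderiv ℝ u x x - W x * fderiv ℝ g x x ∂discMeasure) +
      (∫ y, W y * (fderiv ℝ g y y + 2 * g y) ∂discMeasure) -
      2 * ∫ y, W y * g y ∂discMeasure := by
    have i12 : Integrable (fun x => curv u V x * fderiv ℝ u x x - W x * fderiv ℝ g x x +
      W x * (fderiv ℝ g x x + 2 * g x)) discMeasure := i1.add i2
    rw [← integral_const_mul, ← integral_add i1 i2, ← integral_sub i12 (i3.const_mul 2)]
    refine integral_congr_ae (ae_of_all _ fun y => ?_)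
    ring
  have b1 : |∫ x, curv u V x * fderiv ℝ u x x - W x * fderiv ℝ g x x ∂discMeasure| ≤
      A * r ^ s * (gradConst b C / r) * C := by
    rw [← Real.norm_eq_abs]
    refine (norm_integral_le_of_norm_le (h.integrable_exp.const_mul
      (A * r ^ s * (gradConst b C / r))) ?_).trans ?_
    · filter_upwards [ae_norm_lt_one] with y hy
      have hy' := mem_ball_zero_iff.2 hy
      have hV := hWV y (ball_subset_closedBall hy')
      rw [h.fderiv_exp_sub_one hy', curv]
      calc ‖V y * exp (u y) * fderiv ℝ u y y - W y * (exp (u y) * fderiv ℝ u y y)‖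
          = |V y - W y| * |fderiv ℝ u y y| * exp (u y) := by
            rw [← abs_of_pos (exp_pos (u y)), ← abs_mul, ← abs_mul, Real.norm_eq_abs,
              abs_of_pos (exp_pos (u y))]
            ring_nf
        _ ≤ _ := by
            gcongr
            · rw [abs_of_nonneg (by linarith)]; linarith
            · exact hdu y hy'
    · rw [integral_const_mul]
      gcongr
      exact h.mass
  have b2 : |∫ y, W y * (fderiv ℝ g y y + 2 * g y) ∂discMeasure| ≤ 2 * (A * r ^ (s - 1)) * C := by
    refine hrad.trans ?_
    rw [Real.coe_toNNReal _ (by positivity)]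
    gcongr
  have b3 : |∫ y, W y * g y ∂discMeasure| ≤ (b + A) * C := by
    rw [← Real.norm_eq_abs]
    refine (norm_integral_le_of_norm_le (h.integrable_exp.const_mul (b + A)) ?_).trans ?_
    · filter_upwards [ae_norm_lt_one] with y hy
      have hy' := mem_ball_zero_iff.2 hy
      rw [norm_mul]
      gcongr
      · exact hWN y hy'
      · exact hg1 y hy'
    · rw [integral_const_mul]
      gcongr
      exact h.mass
  have hrr : r ^ s / r = r ^ (s - 1) := by rw [Real.rpow_sub_one hr.ne']
  calc _ ≤ A * r ^ s * (gradConst b C / r) * C + 2 * (A * r ^ (s - 1)) * C +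
        2 * ((b + A) * C * 1) := by
        rw [e]
        refine (abs_sub _ _).trans (add_le_add ((abs_add_le _ _).trans (add_le_add b1 b2)) ?_)
        rw [abs_mul, abs_of_pos (two_pos (α := ℝ)), mul_one]
        gcongr
    _ ≤ A * r ^ s * (gradConst b C / r) * C + 2 * (A * r ^ (s - 1)) * C +
        2 * ((b + A) * C * r ^ (s - 1)) := by gcongr
    _ = A * gradConst b C * C * (r ^ s / r) + 2 * (A * r ^ (s - 1)) * C +
        2 * ((b + A) * C * r ^ (s - 1)) := by ring
    _ = _ := by rw [hrr, globalConst]; ring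

lemma pairKernel_id_le (hx : ‖x‖ < 1) (hy : ‖y‖ < 1) (hxy : x ≠ y) :
    pairKernel id x y ≤ 0 := by
  have h1 := inner_greenGrad_add hx hy hxy
  have hD := greenDisc_pos hx hy
  have h2 := one_sub_norm_sq_pos hx
  have h3 := one_sub_norm_sq_pos hy
  rw [pairKernel, id, id, h1, neg_nonpos]
  have : 0 ≤ 1 - ‖x‖ ^ 2 * ‖y‖ ^ 2 := by nlinarith [sq_nonneg ‖x‖, sq_nonneg ‖y‖]
  positivity

lemma pairKernel_id_le_of_mem {δ : ℝ} (hδ : δ = 1 - ‖x₀‖) (hδ0 : 0 < δ) (hx : x ∈ ball x₀ (δ / 2))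
    (hy : y ∈ ball x₀ (δ / 2)) (hxy : x ≠ y) : pairKernel id x y ≤ -(1 / (10 * δ)) := by
  have hle : δ / 2 ≤ 1 - ‖x₀‖ := by linarith
  have hx1 := mem_ball_zero_iff.1 (ball_subset hle hx)
  have hy1 := mem_ball_zero_iff.1 (ball_subset hle hy)
  have hD := greenDisc_pos hx1 hy1
  rw [mem_ball, dist_eq_norm] at hx hy
  have hxn := abs_le.1 (abs_norm_sub_norm_le x x₀)
  have hyn := abs_le.1 (abs_norm_sub_norm_le y x₀)
  have hxy' : ‖x - y‖ ≤ δ := by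
    rw [← dist_eq_norm] at hx hy ⊢
    linarith [dist_triangle_right x y x₀]
  have h0 := norm_nonneg x
  have h0' := norm_nonneg y
  have h1 : δ / 2 ≤ 1 - ‖x‖ ^ 2 * ‖y‖ ^ 2 := by
    have : ‖x‖ ^ 2 * ‖y‖ ^ 2 ≤ ‖x‖ ^ 2 * 1 := by gcongr; nlinarith
    nlinarith
  have h2 : greenDisc x y ≤ 10 * δ ^ 2 := by
    rw [greenDisc]
    have h3 : 1 - ‖x‖ ^ 2 ≤ 3 * δ := by nlinarith
    have h4 : 1 - ‖y‖ ^ 2 ≤ 3 * δ := by nlinarith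
    have h5 := (one_sub_norm_sq_pos hx1).le
    have h6 := (one_sub_norm_sq_pos hy1).le
    have h7 : (1 - ‖x‖ ^ 2) * (1 - ‖y‖ ^ 2) ≤ 3 * δ * (3 * δ) := by gcongr
    have h8 : ‖x - y‖ ^ 2 ≤ δ ^ 2 := by gcongr
    linarith
  rw [pairKernel, id, id, inner_greenGrad_add hx1 hy1 hxy, neg_le_neg_iff]
  calc 1 / (10 * δ) = 2 * (δ / 2) / (10 * δ ^ 2) := by field_simp
    _ ≤ _ := by
      gcongr
      linarith

/-- The global Pohozaev estimate: a peak carrying mass stays away from the boundary. -/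
lemma sq_discMass_le (h : LiouvillePeak b C A s u V x₀ r) :
    discMass u V x₀ ((1 - ‖x₀‖) / 2) ^ 2 ≤
      80 * π * (1 - ‖x₀‖) * (globalConst b C A * r ^ (s - 1)) := by
  set δ := 1 - ‖x₀‖ with hδ
  have hδ0 : 0 < δ := h.dist_pos
  have hle : δ / 2 ≤ 1 - ‖x₀‖ := by linarith
  have h1 := h.dirichlet.eight_pi_mul_integral_eq (X := id) (N := 1) measurable_id
    fun x hx => (mem_ball_zero_iff.1 hx).le
  have hi := h.dirichlet.integrable_pairKernel (X := id) (N := 1) measurable_id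
    fun x hx => (mem_ball_zero_iff.1 hx).le
  set F : Plane → ℝ := (ball x₀ (δ / 2)).indicator (curv u V) with hF
  have hFi : Integrable F discMeasure := h.integrable_curv.indicator measurableSet_ball
  have hFint : ∫ y, F y ∂discMeasure = discMass u V x₀ (δ / 2) := by
    rw [hF, integral_indicator measurableSet_ball, setIntegral_curv_eq hle]
  have h2 : ∫ p, curv u V p.1 * curv u V p.2 * pairKernel id p.1 p.2 ∂(discMeasure.prod discMeasure)
      ≤ ∫ p : Plane × Plane, F p.1 * F p.2 * (-(1 / (10 * δ))) ∂(discMeasure.prod discMeasure) := by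
    refine integral_mono_ae hi ((hFi.mul_prod hFi).mul_const _) ?_
    filter_upwards [ae_prod_norm_lt_one] with p ⟨hp1, hp2, hp⟩
    have hc1 := h.curv_nonneg (mem_ball_zero_iff.2 hp1)
    have hc2 := h.curv_nonneg (mem_ball_zero_iff.2 hp2)
    by_cases hm : p.1 ∈ ball x₀ (δ / 2) ∧ p.2 ∈ ball x₀ (δ / 2)
    · rw [hF, Set.indicator_of_mem hm.1, Set.indicator_of_mem hm.2]
      exact mul_le_mul_of_nonneg_left (pairKernel_id_le_of_mem hδ hδ0 hm.1 hm.2 hp)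
        (mul_nonneg hc1 hc2)
    · have h0 : F p.1 * F p.2 = 0 := by
        rw [not_and_or] at hm
        rcases hm with hm | hm
        · rw [hF, Set.indicator_of_notMem hm, zero_mul]
        · rw [hF, Set.indicator_of_notMem hm, mul_zero]
      rw [h0, zero_mul]
      exact mul_nonpos_of_nonneg_of_nonpos (mul_nonneg hc1 hc2) (pairKernel_id_le hp1 hp2 hp)
  rw [integral_mul_const, integral_prod_mul F F, hFint, ← h1] at h2
  have h3 := (abs_le.1 h.abs_integral_curv_mul_radial_le).1
  simp only [id] at h2
  have h4 : 8 * π * -(globalConst b C A * r ^ (s - 1)) ≤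
      discMass u V x₀ (δ / 2) * discMass u V x₀ (δ / 2) * -(1 / (10 * δ)) :=
    le_trans (by gcongr) h2
  rw [sq]
  calc _ = 10 * δ * (discMass u V x₀ (δ / 2) * discMass u V x₀ (δ / 2) * (1 / (10 * δ))) := by
        field_simp
    _ ≤ 10 * δ * (8 * π * (globalConst b C A * r ^ (s - 1))) :=
        mul_le_mul_of_nonneg_left (by linarith) (by positivity)
    _ = _ := by ring

end LiouvillePeak

/-! ### Lower bounds for the mass near the peak -/

/-- The oscillation of the solution near the peak that does not come from the mass near the peak. -/
noncomputable def oscConst (b C : ℝ) : ℝ := (log 12 * (b * C) + 2 * potentialConst b C) / (4 * π)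

/-- The number of peak scales needed to capture mass `2π`. -/
noncomputable def massConst (b C : ℝ) : ℝ := 1 + 8 * C * exp (oscConst b C) / π

lemma greenDisc_le_three_mul {x₀ y z : Plane} {ρ : ℝ} (hx : ‖x₀‖ < 1) (hz : ‖z‖ < 1)
    (hρ : ρ ≤ (1 - ‖x₀‖) / 2) (hy : y ∈ ball x₀ (ρ / 2)) :
    greenDisc x₀ z ≤ 3 * greenDisc y z := by
  rw [mem_ball, dist_eq_norm] at hy
  have hyn := abs_le.1 (abs_norm_sub_norm_le y x₀)
  have h0 := norm_nonneg y
  have h0' := norm_nonneg x₀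
  have hy1 : ‖y‖ < 1 := by linarith
  have h1 := one_sub_norm_sq_le_greenDisc hy1.le hz.le
  have h2 : (3 / 4 * (1 - ‖x₀‖)) ^ 2 ≤ (1 - ‖y‖) ^ 2 := by
    gcongr
    · linarith
  have h3 : ‖x₀ - z‖ ^ 2 ≤ 2 * ‖y - z‖ ^ 2 + 2 * ‖y - x₀‖ ^ 2 := by
    have h4 : ‖x₀ - z‖ ≤ ‖y - z‖ + ‖y - x₀‖ := by
      rw [← dist_eq_norm, ← dist_eq_norm, ← dist_eq_norm, add_comm]
      exact dist_triangle_left _ _ _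
    nlinarith [sq_nonneg (‖y - z‖ - ‖y - x₀‖), norm_nonneg (x₀ - z)]
  have h5 : ‖y - x₀‖ ^ 2 ≤ ((1 - ‖x₀‖) / 4) ^ 2 := by
    gcongr
    linarith
  have h6 : 1 - ‖x₀‖ ^ 2 ≤ 8 / 3 * (1 - ‖y‖ ^ 2) := by
    have : 3 / 4 * (1 - ‖x₀‖) * 1 ≤ (1 - ‖y‖) * (1 + ‖y‖) := by
      gcongr <;> linarith
    nlinarith
  have h7 := (one_sub_norm_sq_pos hz).le
  have h8 : (1 - ‖x₀‖ ^ 2) * (1 - ‖z‖ ^ 2) ≤ 8 / 3 * (1 - ‖y‖ ^ 2) * (1 - ‖z‖ ^ 2) := by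
    gcongr
  have h9 : greenDisc y z = ‖y - z‖ ^ 2 + (1 - ‖y‖ ^ 2) * (1 - ‖z‖ ^ 2) := rfl
  have h10 : greenDisc x₀ z = ‖x₀ - z‖ ^ 2 + (1 - ‖x₀‖ ^ 2) * (1 - ‖z‖ ^ 2) := rfl
  nlinarith [sq_nonneg ‖y - z‖]

lemma greenLog_sub_le {x₀ y z : Plane} {ρ : ℝ} (hx : ‖x₀‖ < 1) (hz : ‖z‖ < 1)
    (hρ : ρ ≤ (1 - ‖x₀‖) / 2) (hy : y ∈ ball x₀ (ρ / 2)) (hxz : x₀ ≠ z) (hyz : y ≠ z) :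
    greenLog x₀ z - greenLog y z ≤ log 3 + 2 * log (1 + ρ / ‖x₀ - z‖) := by
  have hρ0 : 0 < ρ := by linarith [dist_nonneg.trans_lt (mem_ball.1 hy)]
  have hy' := LiouvillePeak.ball_subset (x₀ := x₀) (by linarith : ρ / 2 ≤ 1 - ‖x₀‖) hy
  have hD := greenDisc_pos (mem_ball_zero_iff.1 hy') hz
  have hD0 := greenDisc_pos hx hz
  have hp : 0 < ‖x₀ - z‖ := norm_pos_iff.2 (sub_ne_zero.2 hxz)
  have hp' : 0 < ‖y - z‖ := norm_pos_iff.2 (sub_ne_zero.2 hyz)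
  have h1 : log (greenDisc x₀ z) ≤ log 3 + log (greenDisc y z) := by
    rw [← Real.log_mul (by norm_num) hD.ne']
    exact Real.log_le_log hD0 (greenDisc_le_three_mul hx hz hρ hy)
  have h2 : log ‖y - z‖ ≤ log ‖x₀ - z‖ + log (1 + ρ / ‖x₀ - z‖) := by
    have h3 : 0 < 1 + ρ / ‖x₀ - z‖ := by positivity
    rw [← Real.log_mul hp.ne' h3.ne']
    refine Real.log_le_log hp' ?_
    rw [mul_add, mul_div_cancel₀ _ hp.ne', mul_one]
    rw [mem_ball] at hy
    have := dist_triangle y x₀ z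
    rw [dist_eq_norm y z, dist_eq_norm x₀ z] at this
    linarith
  rw [greenLog, greenLog, Real.log_pow, Real.log_pow]
  push_cast
  linarith

lemma log_one_add_div_le {r ρ t : ℝ} (hr : 0 < r) (hρ : 0 < ρ) (ht : 0 < t) :
    log (1 + ρ / t) ≤ log 2 + (if t < ρ then log (1 + ρ / r) else 0) + r / t := by
  have h2 : 0 ≤ log 2 := Real.log_nonneg (by norm_num)
  split_ifs with h
  · have h1 : 1 + ρ / t ≤ (1 + ρ / r) * (1 + r / t) := by
      have h3 : (1 + ρ / r) * (1 + r / t) = 1 + ρ / t + ρ / r + r / t := by field_simp; ring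
      have : 0 ≤ ρ / r := by positivity
      have : 0 ≤ r / t := by positivity
      linarith
    have h4 := Real.log_le_log (by positivity) h1
    rw [Real.log_mul (by positivity) (by positivity)] at h4
    have h5 := Real.log_le_sub_one_of_pos (by positivity : 0 < 1 + r / t)
    linarith
  · have h1 : 1 + ρ / t ≤ 2 := by
      have : ρ / t ≤ 1 := (div_le_one ht).2 (not_lt.1 h)
      linarith
    have h3 := Real.log_le_log (by positivity) h1
    have : 0 ≤ r / t := by positivity
    linarith

namespace LiouvillePeak

variable {b C A s r ρ : ℝ} {u V : Plane → ℝ} {x x₀ y : Plane}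

lemma integral_indicator_curv (h : LiouvillePeak b C A s u V x₀ r) (hρ : ρ ≤ 1 - ‖x₀‖) :
    Integrable ((ball x₀ ρ).indicator (curv u V)) discMeasure ∧
      ∫ y, (ball x₀ ρ).indicator (curv u V) y ∂discMeasure = discMass u V x₀ ρ :=
  ⟨h.integrable_curv.indicator measurableSet_ball, by
    rw [integral_indicator measurableSet_ball, setIntegral_curv_eq hρ]⟩

lemma apply_sub_le (h : LiouvillePeak b C A s u V x₀ r) (hρ : ρ ≤ (1 - ‖x₀‖) / 2)
    (hy : y ∈ ball x₀ (ρ / 2)) :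
    4 * π * (u x₀ - u y) ≤
      4 * π * oscConst b C + 2 * log (1 + ρ / r) * discMass u V x₀ ρ := by
  have hρ0 : 0 < ρ := by linarith [dist_nonneg.trans_lt (mem_ball.1 hy)]
  have hr := h.r_pos
  have hδ := h.dist_pos
  have hy' := mem_ball_zero_iff.1
    (LiouvillePeak.ball_subset (x₀ := x₀) (by linarith : ρ / 2 ≤ 1 - ‖x₀‖) hy)
  obtain ⟨hFi, hF⟩ := h.integral_indicator_curv (by linarith : ρ ≤ 1 - ‖x₀‖)
  have i1 := h.integrable_curv.const_mul (log 12)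
  have i2 := hFi.const_mul (2 * log (1 + ρ / r))
  have i3 := (h.integrable_curv_mul_inv h.norm_lt).const_mul (2 * r)
  have i12 : Integrable (fun z => log 12 * curv u V z + 2 * log (1 + ρ / r) *
    (ball x₀ ρ).indicator (curv u V) z) discMeasure := i1.add i2
  rw [mul_sub, h.dirichlet.four_pi_mul_eq h.norm_lt, h.dirichlet.four_pi_mul_eq hy',
    ← integral_sub (h.dirichlet.integrable_greenLog_mul h.norm_lt)
      (h.dirichlet.integrable_greenLog_mul hy')]
  calc _ ≤ ∫ z, log 12 * curv u V z + 2 * log (1 + ρ / r) *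
        (ball x₀ ρ).indicator (curv u V) z + 2 * r * (curv u V z * ‖x₀ - z‖⁻¹) ∂discMeasure := by
        refine integral_mono_ae ((h.dirichlet.integrable_greenLog_mul h.norm_lt).sub
          (h.dirichlet.integrable_greenLog_mul hy')) (i12.add i3) ?_
        filter_upwards [ae_norm_lt_one, ae_ne_discMeasure x₀, ae_ne_discMeasure y] with z hz hxz hyz
        have hc := h.curv_nonneg (mem_ball_zero_iff.2 hz)
        have hp : 0 < ‖x₀ - z‖ := norm_pos_iff.2 (sub_ne_zero.2 hxz)
        have h1 := greenLog_sub_le h.norm_lt hz hρ hy hxz hyz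
        have h2 := log_one_add_div_le hr hρ0 hp
        have h3 : log 12 = log 3 + 2 * log 2 := by
          rw [show (12 : ℝ) = 3 * 2 ^ 2 by norm_num, Real.log_mul (by norm_num) (by norm_num),
            Real.log_pow]
          norm_num
        have h4 : greenLog x₀ z - greenLog y z ≤
            log 12 + 2 * (if ‖x₀ - z‖ < ρ then log (1 + ρ / r) else 0) + 2 * (r / ‖x₀ - z‖) := by
          linarith
        have h5 := mul_le_mul_of_nonneg_right h4 hc
        have h6 : (ball x₀ ρ).indicator (curv u V) z =
            (if ‖x₀ - z‖ < ρ then 1 else 0) * curv u V z := by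
          by_cases hm : ‖x₀ - z‖ < ρ
          · rw [Set.indicator_of_mem (by rwa [mem_ball', dist_eq_norm]), if_pos hm, one_mul]
          · rw [Set.indicator_of_notMem (by rwa [mem_ball', dist_eq_norm]), if_neg hm, zero_mul]
        refine le_trans (le_of_eq ?_) (h5.trans_eq ?_)
        · ring
        · rw [h6]
          split_ifs <;> ring
    _ ≤ log 12 * (b * C) + 2 * log (1 + ρ / r) * discMass u V x₀ ρ +
        2 * r * (potentialConst b C / r) := by
        rw [integral_add i12 i3, integral_add i1 i2, integral_const_mul, integral_const_mul,
          integral_const_mul, hF]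
        have : 0 ≤ log 12 := Real.log_nonneg (by norm_num)
        gcongr
        · exact h.integral_curv_le
        · exact h.integral_curv_mul_inv_le h.norm_lt
    _ = _ := by rw [oscConst]; field_simp; ring

lemma one_le_massConst (h : LiouvillePeak b C A s u V x₀ r) : 1 ≤ massConst b C := by
  have := h.C_pos
  rw [massConst, le_add_iff_nonneg_right]; positivity

lemma two_pi_le_discMass (h : LiouvillePeak b C A s u V x₀ r) (hρ : ρ ≤ (1 - ‖x₀‖) / 2)
    (hρr : massConst b C * r ≤ ρ) : 2 * π ≤ discMass u V x₀ ρ := by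
  by_contra! hm
  have hr := h.r_pos
  have hC := h.C_pos
  have hδ := h.dist_pos
  have hrρ : r ≤ ρ := (le_mul_of_one_le_left hr.le h.one_le_massConst).trans hρr
  have hρ0 : 0 < ρ := hr.trans_le hrρ
  have hsub : ball x₀ (ρ / 2) ⊆ unitDisc := ball_subset (by linarith)
  have hlog : 0 ≤ log (1 + ρ / r) := Real.log_nonneg (by
    have : 0 ≤ ρ / r := by positivity
    linarith)
  set q := exp (-oscConst b C) * ((r * (r + ρ))⁻¹) with hq
  have hlow (y) (hy : y ∈ ball x₀ (ρ / 2)) : q ≤ exp (u y) := by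
    have h1 := h.apply_sub_le hρ hy
    have h2 : 2 * log (1 + ρ / r) * discMass u V x₀ ρ ≤ 2 * log (1 + ρ / r) * (2 * π) := by
      gcongr
    have h3 : u x₀ - oscConst b C - log (1 + ρ / r) ≤ u y := by
      have h4 : 4 * π * (u x₀ - u y) ≤ 4 * π * (oscConst b C + log (1 + ρ / r)) := by linarith
      have := le_of_mul_le_mul_left h4 (by positivity)
      linarith
    refine le_trans (le_of_eq ?_) (Real.exp_le_exp.2 h3)
    rw [Real.exp_sub, Real.exp_sub, h.exp_eq, Real.exp_log (by positivity), hq, Real.exp_neg]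
    field_simp
  have h5 : q * (π * (ρ / 2) ^ 2) ≤ C := by
    calc _ = ∫ _ in ball x₀ (ρ / 2), q := by
          rw [setIntegral_const, volume_real_ball_plane (by positivity), smul_eq_mul, mul_comm]
      _ ≤ ∫ y in ball x₀ (ρ / 2), exp (u y) ∂discMeasure := by
          rw [restrict_discMeasure measurableSet_ball hsub]
          refine setIntegral_mono_on (integrableOn_const measure_ball_lt_top.ne) ?_
            measurableSet_ball hlow
          exact IntegrableOn.mono_set h.integrable_exp hsub
      _ ≤ ∫ y, exp (u y) ∂discMeasure :=
          setIntegral_le_integral h.integrable_exp (ae_of_all _ fun y => (exp_pos _).le)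
      _ ≤ C := h.mass
  have h6 : exp (-oscConst b C) * π * ρ / (8 * r) ≤ C := by
    refine le_trans ?_ h5
    have h7 : (r * (2 * ρ))⁻¹ ≤ (r * (r + ρ))⁻¹ := by gcongr; linarith
    calc _ = exp (-oscConst b C) * (r * (2 * ρ))⁻¹ * (π * (ρ / 2) ^ 2) := by field_simp; ring
      _ ≤ _ := by rw [hq]; gcongr
  rw [div_le_iff₀ (by positivity), Real.exp_neg] at h6
  have h8 : (massConst b C - 1) * r * π = 8 * C * exp (oscConst b C) * r := by
    rw [massConst]; field_simp; ring
  have h9 : ρ * π ≤ 8 * C * exp (oscConst b C) * r := by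
    have := mul_le_mul_of_nonneg_left h6 (exp_pos (oscConst b C)).le
    calc ρ * π = exp (oscConst b C) * ((exp (oscConst b C))⁻¹ * π * ρ) := by field_simp
      _ ≤ _ := this
      _ = _ := by ring
  have h10 : massConst b C * r * π ≤ ρ * π := by gcongr
  have : 0 < r * π := by positivity
  linarith

lemma discMass_mul_log_le (h : LiouvillePeak b C A s u V x₀ r) (hρ0 : 0 < ρ)
    (hρ : ρ ≤ 1 - ‖x₀‖) :
    discMass u V x₀ ρ * log ((1 - ‖x₀‖) / ρ) ≤ 4 * π * log r⁻¹ := by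
  obtain ⟨hFi, hF⟩ := h.integral_indicator_curv hρ
  have hδ := h.dist_pos
  have h1 : ∫ z, (ball x₀ ρ).indicator (curv u V) z * (2 * log ((1 - ‖x₀‖) / ρ)) ∂discMeasure ≤
      4 * π * u x₀ := by
    rw [h.dirichlet.four_pi_mul_eq h.norm_lt]
    refine integral_mono_ae (hFi.mul_const _)
      (h.dirichlet.integrable_greenLog_mul h.norm_lt) ?_
    filter_upwards [ae_norm_lt_one, ae_ne_discMeasure x₀] with z hz hxz
    have hc := h.curv_nonneg (mem_ball_zero_iff.2 hz)
    have hp : 0 < ‖x₀ - z‖ := norm_pos_iff.2 (sub_ne_zero.2 hxz)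
    by_cases hzρ : z ∈ ball x₀ ρ
    · rw [Set.indicator_of_mem hzρ, mul_comm]
      refine mul_le_mul_of_nonneg_right ?_ hc
      rw [mem_ball', dist_eq_norm] at hzρ
      have h2 := Real.log_le_log (by positivity) (one_sub_norm_sq_le_greenDisc h.norm_lt.le hz.le)
      have h3 := Real.log_le_log hp hzρ.le
      rw [greenLog, Real.log_div hδ.ne' hρ0.ne']
      rw [Real.log_pow] at h2 ⊢
      push_cast at h2 ⊢
      linarith
    · rw [Set.indicator_of_notMem hzρ, zero_mul]
      exact mul_nonneg (greenLog_nonneg h.norm_lt hz hxz) hc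
  rw [integral_mul_const, hF, h.apply_peak] at h1
  linarith

end LiouvillePeak

/-! ### A radial vector field cut off near the peak -/

/-- A smooth cutoff equal to `1` on the ball of radius `ρ` about `p`, vanishing outside the ball
of radius `√2 ρ`. -/
noncomputable def peakCutoff (p : Plane) (ρ : ℝ) (x : Plane) : ℝ :=
  smoothTransition (2 - ‖x - p‖ ^ 2 / ρ ^ 2)

/-- The radial vector field about `p`, cut off at scale `ρ`. -/
noncomputable def peakField (p : Plane) (ρ : ℝ) (x : Plane) : Plane := peakCutoff p ρ x • (x - p)

section PeakCutoff

variable {p x y : Plane} {ρ K : ℝ}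

lemma peakCutoff_nonneg : 0 ≤ peakCutoff p ρ x := smoothTransition.nonneg _

lemma peakCutoff_le_one : peakCutoff p ρ x ≤ 1 := smoothTransition.le_one _

lemma contDiff_peakCutoff : ContDiff ℝ 1 (peakCutoff p ρ) :=
  smoothTransition.contDiff.comp
    (contDiff_const.sub (((contDiff_id.sub contDiff_const).norm_sq ℝ).div_const _))

lemma fderiv_peakCutoff (v : Plane) : fderiv ℝ (peakCutoff p ρ) x v =
    -(deriv smoothTransition (2 - ‖x - p‖ ^ 2 / ρ ^ 2) * (2 * ⟪x - p, v⟫ / ρ ^ 2)) := by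
  have h1 : HasFDerivAt (fun x : Plane => 2 - ‖x - p‖ ^ 2 * (ρ ^ 2)⁻¹)
      (-((ρ ^ 2)⁻¹ • (2 • (innerSL ℝ (x - p)).comp (ContinuousLinearMap.id ℝ Plane)))) x :=
    ((((hasFDerivAt_id x).sub_const p).norm_sq).mul_const _).const_sub 2
  have h2 := (smoothTransition.contDiff (n := 1)).differentiable one_ne_zero
    (2 - ‖x - p‖ ^ 2 * (ρ ^ 2)⁻¹)
  have h3 : HasFDerivAt (peakCutoff p ρ) _ x := h2.hasDerivAt.comp_hasFDerivAt x h1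
  rw [h3.fderiv]
  simp [inner_sub_left]
  ring_nf

lemma peakCutoff_eq_one (hρ : 0 < ρ) (hx : ‖x - p‖ ≤ ρ) : peakCutoff p ρ x = 1 := by
  refine smoothTransition.one_of_one_le ?_
  have : ‖x - p‖ ^ 2 / ρ ^ 2 ≤ 1 := by
    rw [div_le_one (by positivity)]; gcongr
  linarith

lemma fderiv_peakCutoff_eq_zero (hρ : 0 < ρ) (hx : ‖x - p‖ < ρ) (v : Plane) :
    fderiv ℝ (peakCutoff p ρ) x v = 0 := by
  have h1 : ‖x - p‖ ^ 2 / ρ ^ 2 < 1 := by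
    rw [div_lt_one (by positivity)]; gcongr
  rw [fderiv_peakCutoff, (deriv_smoothTransition_eq_zero fun h => by linarith [h.2]).1]
  ring

lemma two_mul_sq_le_of_far (hρ : 0 < ρ) (hx : 3 / 2 * ρ ≤ ‖x - p‖) :
    2 - ‖x - p‖ ^ 2 / ρ ^ 2 < 0 := by
  rw [sub_neg, lt_div_iff₀ (by positivity)]
  nlinarith

lemma peakCutoff_eq_zero (hρ : 0 < ρ) (hx : 3 / 2 * ρ ≤ ‖x - p‖) : peakCutoff p ρ x = 0 :=
  smoothTransition.zero_of_nonpos (two_mul_sq_le_of_far hρ hx).le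

lemma abs_fderiv_peakCutoff_le (hρ : 0 < ρ) (hK : ∀ t, |deriv smoothTransition t| ≤ K)
    (v : Plane) : |fderiv ℝ (peakCutoff p ρ) x v| * ‖x - p‖ ≤ 5 * K * ‖v‖ := by
  have hK0 : 0 ≤ K := (abs_nonneg _).trans (hK 0)
  by_cases hx : 3 / 2 * ρ ≤ ‖x - p‖
  · rw [fderiv_peakCutoff, (deriv_smoothTransition_eq_zero fun h =>
      (two_mul_sq_le_of_far hρ hx).not_ge h.1).1]
    simp
    positivity
  · rw [fderiv_peakCutoff, abs_neg, abs_mul, abs_div, abs_mul, abs_of_pos (two_pos (α := ℝ)),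
      abs_of_pos (by positivity : 0 < ρ ^ 2)]
    have h1 := abs_real_inner_le_norm (x - p) v
    have h2 : ‖x - p‖ ^ 2 ≤ 5 / 2 * ρ ^ 2 := by
      nlinarith [norm_nonneg (x - p)]
    calc _ ≤ K * (2 * (‖x - p‖ * ‖v‖) / ρ ^ 2) * ‖x - p‖ := by
          gcongr
          exact hK _
      _ = K * 2 * ‖v‖ * (‖x - p‖ ^ 2 / ρ ^ 2) := by ring
      _ ≤ K * 2 * ‖v‖ * (5 / 2) := by
          refine mul_le_mul_of_nonneg_left ?_ (by positivity)
          rwa [div_le_iff₀ (by positivity)]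
      _ = _ := by ring

lemma abs_fderiv_peakCutoff_sub_le (hρ : 0 < ρ) (hK : ∀ t, |deriv smoothTransition t| ≤ K) :
    |fderiv ℝ (peakCutoff p ρ) x (x - p)| ≤ 5 * K := by
  have hK0 : 0 ≤ K := (abs_nonneg _).trans (hK 0)
  by_cases hx : ‖x - p‖ < ρ
  · rw [fderiv_peakCutoff_eq_zero hρ hx, abs_zero]; positivity
  · exact le_of_mul_le_mul_right (abs_fderiv_peakCutoff_le hρ hK _) (hρ.trans_le (not_lt.1 hx))

lemma tsupport_peakCutoff_subset (hρ : 0 < ρ) :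
    tsupport (peakCutoff p ρ) ⊆ closedBall p (3 / 2 * ρ) := by
  refine closure_minimal (fun y hy => ?_) isClosed_closedBall
  rw [mem_closedBall, dist_eq_norm]
  by_contra! h
  exact hy (peakCutoff_eq_zero hρ h.le)

lemma continuous_peakField : Continuous (peakField p ρ) :=
  contDiff_peakCutoff.continuous.smul (continuous_id.sub continuous_const)

lemma peakField_eq_zero (hρ : 0 < ρ) (hx : 3 / 2 * ρ ≤ ‖x - p‖) : peakField p ρ x = 0 := by
  rw [peakField, peakCutoff_eq_zero hρ hx, zero_smul]

lemma peakField_eq_sub (hρ : 0 < ρ) (hx : ‖x - p‖ ≤ ρ) : peakField p ρ x = x - p := by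
  rw [peakField, peakCutoff_eq_one hρ hx, one_smul]

lemma norm_peakField_le (hρ : 0 < ρ) : ‖peakField p ρ x‖ ≤ 3 / 2 * ρ := by
  by_cases hx : 3 / 2 * ρ ≤ ‖x - p‖
  · rw [peakField_eq_zero hρ hx, norm_zero]; positivity
  · rw [peakField, norm_smul, Real.norm_of_nonneg peakCutoff_nonneg]
    calc _ ≤ 1 * (3 / 2 * ρ) := by
          gcongr
          · exact peakCutoff_le_one
          · exact (not_le.1 hx).le
      _ = _ := one_mul _

lemma norm_peakField_sub_le (hρ : 0 < ρ) (hK : ∀ t, |deriv smoothTransition t| ≤ K) :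
    ‖peakField p ρ x - peakField p ρ y‖ ≤ (1 + 5 * K) * ‖x - y‖ := by
  have hK0 : 0 ≤ K := (abs_nonneg _).trans (hK 0)
  have hd (z : Plane) : HasFDerivAt (peakField p ρ) _ z :=
    ((contDiff_peakCutoff (p := p) (ρ := ρ)).differentiable one_ne_zero z).hasFDerivAt.smul
      ((hasFDerivAt_id z).sub_const p)
  refine Convex.norm_image_sub_le_of_norm_hasFDerivWithin_le (s := Set.univ)
    (fun z _ => (hd z).hasFDerivWithinAt) (fun z _ => ?_) convex_univ trivial trivial
  refine ContinuousLinearMap.opNorm_le_bound _ (by positivity) fun v => ?_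
  have h1 := abs_fderiv_peakCutoff_le (p := p) (x := z) hρ hK v
  have h2 := peakCutoff_le_one (p := p) (ρ := ρ) (x := z)
  simp only [add_apply, smul_apply, ContinuousLinearMap.smulRight_apply,
    ContinuousLinearMap.id_apply]
  refine (norm_add_le _ _).trans ?_
  rw [norm_smul, norm_smul, Real.norm_of_nonneg peakCutoff_nonneg, Real.norm_eq_abs]
  have h3 : peakCutoff p ρ z * ‖v‖ ≤ 1 * ‖v‖ := by gcongr
  linarith

end PeakCutoff

section PeakKernel

variable {p x y : Plane} {ρ K Λ : ℝ}

/-- The part of the gradient of the Green function coming from the reflected charge. -/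
noncomputable def reflectedGrad (x y : Plane) : Plane :=
  (2 / greenDisc x y) • ((x - y) - (1 - ‖y‖ ^ 2) • x)

lemma norm_reflectedGrad_le (hx : ‖x‖ < 1) (hy : ‖y‖ < 1) :
    ‖reflectedGrad x y‖ ≤ 10 / (1 - ‖x‖) := by
  have hD := greenDisc_pos hx hy
  have h1 := one_sub_norm_sq_le_greenDisc hx.le hy.le
  have h2 := norm_sub_sq_le_greenDisc hx hy
  have h3 := one_sub_norm_sq_le_add hx hy
  have hx0 : 0 < 1 - ‖x‖ := by linarith
  have hs := Real.sq_sqrt hD.le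
  have hs0 : 0 < √(greenDisc x y) := Real.sqrt_pos.2 hD
  set d := √(greenDisc x y)
  have h4 : 1 - ‖x‖ ≤ d := Real.le_sqrt_of_sq_le h1
  have h5 : ‖x - y‖ ≤ d := Real.le_sqrt_of_sq_le h2
  have hy0 := one_sub_norm_sq_pos hy
  have h6 : ‖(x - y) - (1 - ‖y‖ ^ 2) • x‖ ≤ d + 4 * d * 1 := by
    refine (norm_sub_le _ _).trans ?_
    rw [norm_smul, Real.norm_of_nonneg hy0.le]
    gcongr
    nlinarith [norm_nonneg x]
  rw [reflectedGrad, norm_smul, Real.norm_of_nonneg (by positivity), ← hs]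
  calc _ ≤ 2 / d ^ 2 * (d + 4 * d * 1) := by gcongr
    _ = 10 / d := by field_simp; norm_num
    _ ≤ _ := by gcongr

lemma pairKernel_eq (X : Plane → Plane) : pairKernel X x y =
    ⟪X x, reflectedGrad x y⟫ + ⟪X y, reflectedGrad y x⟫ -
      2 / ‖x - y‖ ^ 2 * ⟪X x - X y, x - y⟫ := by
  rw [pairKernel, greenGrad, greenGrad, ← reflectedGrad, ← reflectedGrad, norm_sub_rev y x,
    ← neg_sub x y]
  simp only [inner_sub_left, inner_sub_right, inner_smul_right, inner_neg_right]
  ring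

lemma abs_inner_peakField_reflectedGrad_le (hρ : 0 < ρ) (hΛ : 2 ≤ Λ)
    (hΛρ : Λ * ρ ≤ 1 - ‖p‖) (hx : ‖x‖ < 1) (hy : ‖y‖ < 1) :
    |⟪peakField p ρ x, reflectedGrad x y⟫| ≤ 60 / Λ := by
  by_cases hxp : 3 / 2 * ρ ≤ ‖x - p‖
  · rw [peakField_eq_zero hρ hxp, inner_zero_left, abs_zero]; positivity
  · have h1 := (abs_le.1 (abs_norm_sub_norm_le x p)).2
    have h2 : 2 * ρ ≤ Λ * ρ := by gcongr
    have h3 : Λ * ρ / 4 ≤ 1 - ‖x‖ := by linarith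
    refine (abs_real_inner_le_norm _ _).trans ?_
    calc _ ≤ 3 / 2 * ρ * (10 / (Λ * ρ / 4)) := by
          gcongr
          · exact norm_peakField_le hρ
          · refine (norm_reflectedGrad_le hx hy).trans ?_
            gcongr
      _ = _ := by field_simp; norm_num

/-- Up to small errors the pairing kernel of the cut-off radial field is `-2` on pairs of points
near the peak. -/
lemma abs_pairKernel_peakField_add_le (hρ : 0 < ρ) (hΛ : 2 ≤ Λ)
    (hΛρ : Λ * ρ ≤ 1 - ‖p‖) (hK : ∀ t, |deriv smoothTransition t| ≤ K) (hx : ‖x‖ < 1)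
    (hy : ‖y‖ < 1) (hxy : x ≠ y) :
    |pairKernel (peakField p ρ) x y +
      2 * ((ball p ρ).indicator 1 x * (ball p ρ).indicator 1 y)| ≤
    124 / Λ + 2 * (1 + 5 * K) * ((ball p (Λ * ρ) \ ball p ρ).indicator 1 x +
      (ball p (Λ * ρ) \ ball p ρ).indicator 1 y) := by
  have hK0 : 0 ≤ K := (abs_nonneg _).trans (hK 0)
  have hd : 0 < ‖x - y‖ := norm_sub_pos_iff.2 hxy
  have hΛ0 : 0 < Λ := by linarith
  have h1 := abs_inner_peakField_reflectedGrad_le hρ hΛ hΛρ hx hy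
  have h2 := abs_inner_peakField_reflectedGrad_le hρ hΛ hΛρ hy hx
  have hsub : ball p ρ ⊆ ball p (Λ * ρ) := ball_subset_ball (by nlinarith)
  set T : Set Plane := ball p (Λ * ρ) \ ball p ρ
  have hfar {z : Plane} (hz : z ∉ ball p (Λ * ρ)) : peakField p ρ z = 0 := by
    rw [mem_ball, not_lt, dist_eq_norm] at hz
    exact peakField_eq_zero hρ (by nlinarith)
  have hnear {z : Plane} (hz : z ∈ ball p ρ) : peakField p ρ z = z - p := by
    rw [mem_ball, dist_eq_norm] at hz
    exact peakField_eq_sub hρ hz.le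
  have hT0 (z : Plane) : 0 ≤ T.indicator (1 : Plane → ℝ) z :=
    Set.indicator_nonneg (fun _ _ => zero_le_one) z
  suffices h : |-(2 / ‖x - y‖ ^ 2 * ⟪peakField p ρ x - peakField p ρ y, x - y⟫) +
      2 * ((ball p ρ).indicator 1 x * (ball p ρ).indicator 1 y)| ≤
      4 / Λ + 2 * (1 + 5 * K) * (T.indicator 1 x + T.indicator 1 y) by
    rw [pairKernel_eq]
    rw [abs_le] at *
    have e : 124 / Λ = 60 / Λ + 60 / Λ + 4 / Λ := by ring
    constructor <;> linarith
  have hsing : |2 / ‖x - y‖ ^ 2 * ⟪peakField p ρ x - peakField p ρ y, x - y⟫| ≤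
      2 * (‖peakField p ρ x - peakField p ρ y‖ / ‖x - y‖) := by
    rw [abs_mul, abs_of_pos (by positivity)]
    calc _ ≤ 2 / ‖x - y‖ ^ 2 * (‖peakField p ρ x - peakField p ρ y‖ * ‖x - y‖) := by
          gcongr; exact abs_real_inner_le_norm _ _
      _ = _ := by field_simp
  have hT (h : x ∈ T ∨ y ∈ T) : 1 ≤ T.indicator (1 : Plane → ℝ) x + T.indicator 1 y := by
    rcases h with h | h
    · rw [Set.indicator_of_mem h, Pi.one_apply]; linarith [hT0 y]
    · rw [Set.indicator_of_mem h, Pi.one_apply]; linarith [hT0 x]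
  have hcross {z w : Plane} (hz : z ∈ ball p ρ) (hw : w ∉ ball p (Λ * ρ)) :
      2 * (‖z - p‖ / ‖z - w‖) ≤ 4 / Λ := by
    rw [mem_ball, dist_eq_norm] at hz
    rw [mem_ball, not_lt, dist_eq_norm] at hw
    have h3 : Λ * ρ / 2 ≤ ‖z - w‖ := by
      have := norm_sub_le_norm_sub_add_norm_sub w z p
      rw [norm_sub_rev w z] at this
      nlinarith
    calc _ ≤ 2 * (ρ / (Λ * ρ / 2)) := by gcongr
      _ = _ := by field_simp; norm_num
  by_cases hTT : x ∈ T ∨ y ∈ T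
  · have h0 : (ball p ρ).indicator (1 : Plane → ℝ) x * (ball p ρ).indicator 1 y = 0 := by
      rcases hTT with h | h
      · rw [Set.indicator_of_notMem h.2, zero_mul]
      · rw [Set.indicator_of_notMem h.2, mul_zero]
    rw [h0, mul_zero, add_zero, abs_neg]
    have h3 : 2 * (‖peakField p ρ x - peakField p ρ y‖ / ‖x - y‖) ≤ 2 * (1 + 5 * K) := by
      gcongr
      rw [div_le_iff₀ hd]
      exact norm_peakField_sub_le hρ hK
    have h4 : 2 * (1 + 5 * K) * 1 ≤
        2 * (1 + 5 * K) * (T.indicator (1 : Plane → ℝ) x + T.indicator 1 y) := by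
      gcongr
      exact hT hTT
    have h5 : 0 < 4 / Λ := by positivity
    linarith
  · rw [not_or] at hTT
    have hcase (z : Plane) (hz : z ∉ T) : z ∈ ball p ρ ∨ z ∉ ball p (Λ * ρ) := by
      by_contra! h
      exact hz ⟨h.2, h.1⟩
    rw [Set.indicator_of_notMem hTT.1, Set.indicator_of_notMem hTT.2, add_zero, mul_zero, add_zero]
    have h5 : 0 < 4 / Λ := by positivity
    rcases hcase x hTT.1 with hx' | hx' <;> rcases hcase y hTT.2 with hy' | hy'
    · rw [Set.indicator_of_mem hx', Set.indicator_of_mem hy', hnear hx', hnear hy',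
        sub_sub_sub_cancel_right, real_inner_self_eq_norm_sq, div_mul_cancel₀ _ (by positivity)]
      simp
      positivity
    · rw [Set.indicator_of_notMem fun h => hy' (hsub h), mul_zero, mul_zero, add_zero, abs_neg]
      refine hsing.trans ?_
      rw [hnear hx', hfar hy', sub_zero]
      exact hcross hx' hy'
    · rw [Set.indicator_of_notMem fun h => hx' (hsub h), zero_mul, mul_zero, add_zero, abs_neg]
      refine hsing.trans ?_
      rw [hnear hy', hfar hx', zero_sub, norm_neg, norm_sub_rev x y]
      exact hcross hy' hx'
    · rw [Set.indicator_of_notMem fun h => hx' (hsub h), zero_mul, mul_zero, add_zero, abs_neg,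
        hfar hx', hfar hy', sub_zero, inner_zero_left, mul_zero, abs_zero]
      exact h5.le

end PeakKernel

/-! ### The local Pohozaev identity -/

namespace LiouvillePeak

variable {b C A s r ρ K Λ : ℝ} {u V : Plane → ℝ} {x x₀ y : Plane}

lemma abs_sub_le_of_mem (h : LiouvillePeak b C A s u V x₀ r) (hy : y ∈ unitDisc) {t : ℝ}
    (ht : ‖y - x₀‖ ≤ t) : |V y - V x₀| ≤ A * t ^ s := by
  have := h.A_pos
  have := h.s_pos
  refine (h.holder y (ball_subset_closedBall hy) x₀
    (mem_closedBall_zero_iff.2 h.norm_lt.le)).trans ?_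
  gcongr

lemma abs_fderiv_peakField_le (h : LiouvillePeak b C A s u V x₀ r) (hρ : 0 < ρ)
    (hy : y ∈ unitDisc) :
    |fderiv ℝ u y (peakField x₀ ρ y)| ≤ 3 / 2 * ρ * (gradConst b C / r) :=
  h.abs_fderiv_le_of_norm_le (mem_ball_zero_iff.1 hy) (norm_peakField_le hρ)

lemma abs_sub_mul_fderiv_peakField_le (h : LiouvillePeak b C A s u V x₀ r) (hρ : 0 < ρ)
    (hy : y ∈ unitDisc) :
    |(V y - V x₀) * fderiv ℝ u y (peakField x₀ ρ y)| ≤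
      3 * A * gradConst b C * (ρ ^ s * (ρ / r)) := by
  have hA := h.A_pos
  have hr := h.r_pos
  have hK := h.gradConst_pos
  have hs : (3 / 2 * ρ) ^ s ≤ 3 / 2 * ρ ^ s := by
    rw [Real.mul_rpow (by norm_num) hρ.le]
    gcongr
    exact Real.rpow_le_self_of_one_le (by norm_num) h.s_le_one
  by_cases hx : 3 / 2 * ρ ≤ ‖y - x₀‖
  · rw [peakField_eq_zero hρ hx, map_zero, mul_zero, abs_zero]; positivity
  · rw [abs_mul]
    calc _ ≤ A * (3 / 2 * ρ ^ s) * (3 / 2 * ρ * (gradConst b C / r)) := by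
          gcongr
          · exact (h.abs_sub_le_of_mem hy (not_le.1 hx).le).trans (by gcongr)
          · exact h.abs_fderiv_peakField_le hρ hy
      _ = 9 / 4 * (A * gradConst b C * (ρ ^ s * (ρ / r))) := by ring
      _ ≤ 3 * (A * gradConst b C * (ρ ^ s * (ρ / r))) := by gcongr; norm_num
      _ = _ := by ring

/-- The divergence theorem for `e^u` times the cut-off radial field, with its integrability. -/
lemma integral_exp_mul_div_eq_zero (h : LiouvillePeak b C A s u V x₀ r) (hρ : 0 < ρ)
    (hρδ : 2 * ρ ≤ 1 - ‖x₀‖) :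
    Integrable (fun y => exp (u y) * (fderiv ℝ u y (peakField x₀ ρ y) + 2 * peakCutoff x₀ ρ y +
      fderiv ℝ (peakCutoff x₀ ρ) y (y - x₀))) discMeasure ∧
    ∫ y, exp (u y) * (fderiv ℝ u y (peakField x₀ ρ y) + 2 * peakCutoff x₀ ρ y +
      fderiv ℝ (peakCutoff x₀ ρ) y (y - x₀)) ∂discMeasure = 0 := by
  obtain ⟨K, hK0, hK⟩ := exists_deriv_smoothTransition_le
  constructor
  · refine h.integrable_exp.mul_bdd (c := 3 / 2 * ρ * (gradConst b C / r) + 2 + 5 * K) ?_ ?_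
    · have h1 : ContinuousOn (fun y => fderiv ℝ u y (peakField x₀ ρ y)) unitDisc :=
        (h.contDiffOn.continuousOn_fderiv_of_isOpen isOpen_ball one_le_two).clm_apply
          continuous_peakField.continuousOn
      have h2 : Continuous fun y => fderiv ℝ (peakCutoff x₀ ρ) y (y - x₀) :=
        (contDiff_peakCutoff.continuous_fderiv one_ne_zero).clm_apply
          (continuous_id.sub continuous_const)
      exact ((h1.add (contDiff_peakCutoff.continuous.const_mul 2).continuousOn).add
        h2.continuousOn).aestronglyMeasurable measurableSet_ball
    · filter_upwards [ae_norm_lt_one] with y hy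
      have h1 := h.abs_fderiv_peakField_le hρ (mem_ball_zero_iff.2 hy)
      have h2 := abs_fderiv_peakCutoff_sub_le (p := x₀) (x := y) hρ fun t => (hK t).1
      have h3 : |2 * peakCutoff x₀ ρ y| ≤ 2 := by
        rw [abs_of_nonneg (mul_nonneg zero_le_two peakCutoff_nonneg)]
        linarith [peakCutoff_le_one (p := x₀) (ρ := ρ) (x := y)]
      exact (abs_add_three _ _ _).trans (by linarith)
  · have h1 := abs_integral_cutoff_le (p := x₀) (M := 2) (χ := peakCutoff x₀ ρ)
      (W := fun _ => 1) (K := 0) (h.contDiffOn.of_le one_le_two).exp h.integrable_exp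
      (LipschitzWith.const 1) contDiff_peakCutoff (fun _ => peakCutoff_nonneg)
      (fun _ => peakCutoff_le_one)
      ((tsupport_peakCutoff_subset hρ).trans
        ((closedBall_subset_ball (by linarith)).trans (ball_subset hρδ)))
      (fun y hy => (norm_sub_le _ _).trans (by
        linarith [mem_ball_zero_iff.1 hy, h.norm_lt]))
    rw [NNReal.coe_zero, mul_zero, zero_mul, abs_nonpos_iff] at h1
    rw [← h1]
    refine setIntegral_congr_fun measurableSet_ball fun y hy => ?_
    have h2 : fderiv ℝ (fun y => exp (u y)) y (y - x₀) = exp (u y) * fderiv ℝ u y (y - x₀) := by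
      rw [(h.differentiableAt hy).hasFDerivAt.exp.fderiv]; rfl
    beta_reduce
    rw [h2, peakField, map_smul, smul_eq_mul]
    ring

/-- The mass of `e^u` in the annulus between the discs of radius `ρ` and `Λρ`. -/
noncomputable def annulusMass (u : Plane → ℝ) (x₀ : Plane) (ρ Λ : ℝ) : ℝ :=
  ∫ y in ball x₀ (Λ * ρ) \ ball x₀ ρ, exp (u y)

lemma integral_indicator_exp (h : LiouvillePeak b C A s u V x₀ r) (hΛρ : Λ * ρ ≤ 1 - ‖x₀‖) :
    Integrable ((ball x₀ (Λ * ρ) \ ball x₀ ρ).indicator fun y => exp (u y)) discMeasure ∧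
      ∫ y, (ball x₀ (Λ * ρ) \ ball x₀ ρ).indicator (fun y => exp (u y)) y ∂discMeasure =
        annulusMass u x₀ ρ Λ := by
  have hm : MeasurableSet (ball x₀ (Λ * ρ) \ ball x₀ ρ) := measurableSet_ball.diff measurableSet_ball
  refine ⟨h.integrable_exp.indicator hm, ?_⟩
  rw [integral_indicator hm, restrict_discMeasure hm
    (Set.sdiff_subset.trans (ball_subset hΛρ)), annulusMass]

lemma annulusMass_nonneg : 0 ≤ annulusMass u x₀ ρ Λ :=
  setIntegral_nonneg (measurableSet_ball.diff measurableSet_ball) fun _ _ => (exp_pos _).le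

lemma abs_integral_peakField_add_le (h : LiouvillePeak b C A s u V x₀ r) (hρ : 0 < ρ)
    (hΛ : 2 ≤ Λ) (hΛρ : Λ * ρ ≤ 1 - ‖x₀‖) (hK : ∀ t, |deriv smoothTransition t| ≤ K) :
    |∫ x, curv u V x * fderiv ℝ u x (peakField x₀ ρ x) ∂discMeasure + 2 * discMass u V x₀ ρ| ≤
      3 * A * gradConst b C * (ρ ^ s * (ρ / r)) * C + b * (2 + 5 * K) * annulusMass u x₀ ρ Λ +
        2 * A * ρ ^ s * C := by
  have hA := h.A_pos
  have hC := h.C_pos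
  have hb := h.b_pos
  have hr := h.r_pos
  have hs := h.s_pos
  have hG := h.gradConst_pos
  have hK0 : 0 ≤ K := (abs_nonneg _).trans (hK 0)
  have hρδ : 2 * ρ ≤ 1 - ‖x₀‖ := le_trans (by gcongr) hΛρ
  have hx₀ : x₀ ∈ closedBall (0 : Plane) 1 := mem_closedBall_zero_iff.2 h.norm_lt.le
  obtain ⟨iJ, eJ⟩ := h.integral_exp_mul_div_eq_zero hρ hρδ
  obtain ⟨iS, eS⟩ := h.integral_indicator_curv (by linarith : ρ ≤ 1 - ‖x₀‖)
  obtain ⟨iT, eT⟩ := h.integral_indicator_exp hΛρ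
  have i0 : Integrable (fun x => curv u V x * fderiv ℝ u x (peakField x₀ ρ x)) discMeasure := by
    refine h.integrable_curv.mul_bdd (c := 3 / 2 * ρ * (gradConst b C / r)) ?_ ?_
    · exact ((h.contDiffOn.continuousOn_fderiv_of_isOpen isOpen_ball one_le_two).clm_apply
        continuous_peakField.continuousOn).aestronglyMeasurable measurableSet_ball
    · filter_upwards [ae_norm_lt_one] with y hy
      exact h.abs_fderiv_peakField_le hρ (mem_ball_zero_iff.2 hy)
  set J : Plane → ℝ := fun y => exp (u y) * (fderiv ℝ u y (peakField x₀ ρ y) +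
    2 * peakCutoff x₀ ρ y + fderiv ℝ (peakCutoff x₀ ρ) y (y - x₀)) with hJ
  set T : Set Plane := ball x₀ (Λ * ρ) \ ball x₀ ρ with hT
  have i01 : Integrable (fun x => curv u V x * fderiv ℝ u x (peakField x₀ ρ x) - V x₀ * J x)
    discMeasure := i0.sub (iJ.const_mul _)
  have e : ∫ x, curv u V x * fderiv ℝ u x (peakField x₀ ρ x) ∂discMeasure +
      2 * discMass u V x₀ ρ = ∫ x, curv u V x * fderiv ℝ u x (peakField x₀ ρ x) - V x₀ * J x +
        2 * (ball x₀ ρ).indicator (curv u V) x ∂discMeasure := by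
    rw [integral_add i01 (iS.const_mul 2), integral_sub i0 (iJ.const_mul _), integral_const_mul,
      integral_const_mul, eJ, eS, mul_zero, sub_zero]
  have j1 := h.integrable_exp.const_mul (3 * A * gradConst b C * (ρ ^ s * (ρ / r)))
  have j2 := iT.const_mul (b * (2 + 5 * K))
  have j3 := h.integrable_exp.const_mul (2 * A * ρ ^ s)
  have j12 : Integrable (fun y => 3 * A * gradConst b C * (ρ ^ s * (ρ / r)) * exp (u y) +
    b * (2 + 5 * K) * T.indicator (fun y => exp (u y)) y) discMeasure := j1.add j2
  rw [e, ← Real.norm_eq_abs]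
  refine (norm_integral_le_of_norm_le (j12.add j3) ?_).trans ?_
  · filter_upwards [ae_norm_lt_one] with y hy
    have hy' := mem_ball_zero_iff.2 hy
    have h1 := h.abs_sub_mul_fderiv_peakField_le hρ hy'
    have hE := exp_pos (u y)
    rw [Real.norm_eq_abs]
    simp only [Pi.add_apply]
    by_cases hyS : y ∈ ball x₀ ρ
    · have hyT : y ∉ T := fun h => h.2 hyS
      rw [Set.indicator_of_mem hyS, Set.indicator_of_notMem hyT]
      rw [mem_ball, dist_eq_norm] at hyS
      have h2 := h.abs_sub_le_of_mem hy' hyS.le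
      have hJy : J y = exp (u y) * (fderiv ℝ u y (peakField x₀ ρ y) + 2 * peakCutoff x₀ ρ y +
        fderiv ℝ (peakCutoff x₀ ρ) y (y - x₀)) := rfl
      rw [hJy, peakCutoff_eq_one hρ hyS.le, fderiv_peakCutoff_eq_zero hρ hyS]
      calc _ = |((V y - V x₀) * fderiv ℝ u y (peakField x₀ ρ y) + 2 * (V y - V x₀)) * exp (u y)| := by
            rw [curv]; congr 1; ring
        _ ≤ (3 * A * gradConst b C * (ρ ^ s * (ρ / r)) + 2 * (A * ρ ^ s)) * exp (u y) := by
            rw [abs_mul, abs_of_pos hE]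
            gcongr
            refine (abs_add_le _ _).trans (add_le_add h1 ?_)
            rw [abs_mul, abs_of_pos (two_pos (α := ℝ))]
            gcongr
        _ = _ := by ring
    · rw [Set.indicator_of_notMem hyS, mul_zero, add_zero]
      have h3 : 0 ≤ 2 * A * ρ ^ s * exp (u y) := by positivity
      refine le_trans ?_ (le_add_of_nonneg_right h3)
      have e1 : curv u V y * fderiv ℝ u y (peakField x₀ ρ y) - V x₀ * J y =
          (V y - V x₀) * fderiv ℝ u y (peakField x₀ ρ y) * exp (u y) -
          V x₀ * (2 * peakCutoff x₀ ρ y + fderiv ℝ (peakCutoff x₀ ρ) y (y - x₀)) *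
            exp (u y) := by
        rw [hJ, curv]; ring
      rw [e1]
      refine (abs_sub _ _).trans ?_
      rw [abs_mul, abs_mul _ (exp (u y)), abs_of_pos hE]
      have hterm : |V x₀ * (2 * peakCutoff x₀ ρ y + fderiv ℝ (peakCutoff x₀ ρ) y (y - x₀))| *
          exp (u y) ≤ b * (2 + 5 * K) * T.indicator (fun y => exp (u y)) y := by
        by_cases hyT : y ∈ T
        · rw [Set.indicator_of_mem hyT]
          gcongr
          rw [abs_mul, abs_of_nonneg (h.nonneg _ hx₀)]
          have h4 := abs_fderiv_peakCutoff_sub_le (p := x₀) (x := y) hρ hK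
          have h5 : |2 * peakCutoff x₀ ρ y| ≤ 2 := by
            rw [abs_of_nonneg (mul_nonneg zero_le_two peakCutoff_nonneg)]
            linarith [peakCutoff_le_one (p := x₀) (ρ := ρ) (x := y)]
          exact mul_le_mul (h.le _ hx₀) ((abs_add_le _ _).trans (add_le_add h5 h4))
            (abs_nonneg _) hb.le
        · have hfar : 3 / 2 * ρ ≤ ‖y - x₀‖ := by
            by_contra! hlt
            refine hyT ⟨?_, hyS⟩
            rw [mem_ball, dist_eq_norm]
            nlinarith
          rw [Set.indicator_of_notMem hyT, peakCutoff_eq_zero hρ hfar, fderiv_peakCutoff,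
            (deriv_smoothTransition_eq_zero fun h =>
              (two_mul_sq_le_of_far hρ hfar).not_ge h.1).1]
          simp
      gcongr
  · simp only [Pi.add_apply]
    rw [integral_add j12 j3, integral_add j1 j2, integral_const_mul, integral_const_mul,
      integral_const_mul, eT]
    gcongr
    · exact h.mass
    · exact h.mass

lemma abs_eight_pi_mul_add_le (h : LiouvillePeak b C A s u V x₀ r) (hρ : 0 < ρ)
    (hΛ : 2 ≤ Λ) (hΛρ : Λ * ρ ≤ 1 - ‖x₀‖) (hK : ∀ t, |deriv smoothTransition t| ≤ K) :
    |8 * π * ∫ x, curv u V x * fderiv ℝ u x (peakField x₀ ρ x) ∂discMeasure +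
      2 * discMass u V x₀ ρ ^ 2| ≤
      124 / Λ * (b * C) ^ 2 + 4 * (1 + 5 * K) * (b * annulusMass u x₀ ρ Λ) * (b * C) := by
  have hb := h.b_pos
  have hC := h.C_pos
  have hK0 : 0 ≤ K := (abs_nonneg _).trans (hK 0)
  have hm := continuous_peakField (p := x₀) (ρ := ρ) |>.measurable
  have hN : ∀ x ∈ unitDisc, ‖peakField x₀ ρ x‖ ≤ 3 / 2 * ρ := fun x _ => norm_peakField_le hρ
  have hρδ : 2 * ρ ≤ 1 - ‖x₀‖ := le_trans (by gcongr) hΛρ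
  obtain ⟨iS, eS⟩ := h.integral_indicator_curv (by linarith : ρ ≤ 1 - ‖x₀‖)
  obtain ⟨iT, eT⟩ := h.integral_indicator_exp hΛρ
  have hi := h.dirichlet.integrable_pairKernel hm hN
  set T : Set Plane := ball x₀ (Λ * ρ) \ ball x₀ ρ with hT
  set f := curv u V with hf
  have hTm : MeasurableSet T := measurableSet_ball.diff measurableSet_ball
  have iTf : Integrable (T.indicator f) discMeasure := h.integrable_curv.indicator hTm
  have hQ := h.integral_curv_le
  have hQ0 : 0 ≤ ∫ y, f y ∂discMeasure := integral_nonneg_of_ae h.ae_curv_nonneg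
  have hTf : ∫ y, T.indicator f y ∂discMeasure ≤ b * annulusMass u x₀ ρ Λ := by
    rw [← eT, ← integral_const_mul]
    refine integral_mono_ae iTf (iT.const_mul b) ?_
    filter_upwards [h.ae_curv_le_mul_exp] with y hy
    by_cases hyT : y ∈ T
    · rw [Set.indicator_of_mem hyT, Set.indicator_of_mem hyT]; exact hy
    · rw [Set.indicator_of_notMem hyT, Set.indicator_of_notMem hyT, mul_zero]
  have k1 := (h.integrable_curv.mul_prod h.integrable_curv).const_mul (124 / Λ)
  have k2 := (iTf.mul_prod h.integrable_curv).const_mul (2 * (1 + 5 * K))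
  have k3 := (h.integrable_curv.mul_prod iTf).const_mul (2 * (1 + 5 * K))
  have k12 : Integrable (fun p : Plane × Plane => 124 / Λ * (f p.1 * f p.2) +
    2 * (1 + 5 * K) * (T.indicator f p.1 * f p.2)) (discMeasure.prod discMeasure) := k1.add k2
  have e : 8 * π * ∫ x, f x * fderiv ℝ u x (peakField x₀ ρ x) ∂discMeasure +
      2 * discMass u V x₀ ρ ^ 2 = ∫ p : Plane × Plane,
        f p.1 * f p.2 * pairKernel (peakField x₀ ρ) p.1 p.2 +
        2 * ((ball x₀ ρ).indicator f p.1 * (ball x₀ ρ).indicator f p.2)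
          ∂(discMeasure.prod discMeasure) := by
    rw [integral_add hi ((iS.mul_prod iS).const_mul 2), integral_const_mul,
      integral_prod_mul ((ball x₀ ρ).indicator f) ((ball x₀ ρ).indicator f), eS,
      h.dirichlet.eight_pi_mul_integral_eq hm hN, sq]
  rw [e, ← Real.norm_eq_abs]
  refine (norm_integral_le_of_norm_le (k12.add k3) ?_).trans ?_
  · filter_upwards [ae_prod_norm_lt_one] with p ⟨hp1, hp2, hp⟩
    have hc1 := h.curv_nonneg (mem_ball_zero_iff.2 hp1)
    have hc2 := h.curv_nonneg (mem_ball_zero_iff.2 hp2)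
    have h1 := abs_pairKernel_peakField_add_le hρ hΛ hΛρ hK hp1 hp2 hp
    have hind (S : Set Plane) (z : Plane) : S.indicator f z = S.indicator 1 z * f z := by
      by_cases hz : z ∈ S
      · rw [Set.indicator_of_mem hz, Set.indicator_of_mem hz, Pi.one_apply, one_mul]
      · rw [Set.indicator_of_notMem hz, Set.indicator_of_notMem hz, zero_mul]
    simp only [Pi.add_apply]
    rw [hind, hind, hind T, hind T]
    have h2 := mul_le_mul_of_nonneg_left h1 (mul_nonneg hc1 hc2)
    rw [← abs_of_nonneg (mul_nonneg hc1 hc2), ← abs_mul,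
      abs_of_nonneg (mul_nonneg hc1 hc2)] at h2
    refine le_trans (le_of_eq ?_) (h2.trans_eq ?_)
    · rw [Real.norm_eq_abs]
      congr 1
      ring
    · ring
  · simp only [Pi.add_apply]
    rw [integral_add k12 k3, integral_add k1 k2, integral_const_mul, integral_const_mul,
      integral_const_mul, integral_prod_mul f f, integral_prod_mul (T.indicator f) f,
      integral_prod_mul f (T.indicator f)]
    have h1 : (∫ y, f y ∂discMeasure) * ∫ y, f y ∂discMeasure ≤ b * C * (b * C) := by gcongr
    have h2 : (∫ y, T.indicator f y ∂discMeasure) * ∫ y, f y ∂discMeasure ≤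
        b * annulusMass u x₀ ρ Λ * (b * C) := by
      have := annulusMass_nonneg (u := u) (x₀ := x₀) (ρ := ρ) (Λ := Λ)
      gcongr
    have h3 : 124 / Λ * ((∫ y, f y ∂discMeasure) * ∫ y, f y ∂discMeasure) ≤
        124 / Λ * (b * C * (b * C)) := by gcongr
    have h4 : 2 * (1 + 5 * K) * ((∫ y, T.indicator f y ∂discMeasure) * ∫ y, f y ∂discMeasure) ≤
        2 * (1 + 5 * K) * (b * annulusMass u x₀ ρ Λ * (b * C)) := by gcongr
    have h5 : (∫ y, f y ∂discMeasure) * ∫ y, T.indicator f y ∂discMeasure =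
      (∫ y, T.indicator f y ∂discMeasure) * ∫ y, f y ∂discMeasure := mul_comm _ _
    rw [h5]
    linarith

/-- Local Pohozaev estimate: the mass in a disc around the peak is almost `8π`, provided the
surrounding annulus carries little mass. -/
lemma abs_sq_discMass_sub_le (h : LiouvillePeak b C A s u V x₀ r) (hρ : 0 < ρ)
    (hΛ : 2 ≤ Λ) (hΛρ : Λ * ρ ≤ 1 - ‖x₀‖) (hK : ∀ t, |deriv smoothTransition t| ≤ K) :
    |discMass u V x₀ ρ ^ 2 - 8 * π * discMass u V x₀ ρ| ≤ 62 * (b * C) ^ 2 / Λ +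
      (2 * (1 + 5 * K) * b * (b * C) + 4 * π * b * (2 + 5 * K)) * annulusMass u x₀ ρ Λ +
      4 * π * A * C * (3 * gradConst b C * (ρ / r) + 2) * ρ ^ s := by
  have h1 := h.abs_integral_peakField_add_le hρ hΛ hΛρ hK
  have h2 := h.abs_eight_pi_mul_add_le hρ hΛ hΛρ hK
  set P := ∫ x, curv u V x * fderiv ℝ u x (peakField x₀ ρ x) ∂discMeasure
  set m := discMass u V x₀ ρ
  have e : m ^ 2 - 8 * π * m = (8 * π * P + 2 * m ^ 2) / 2 - 4 * π * (P + 2 * m) := by ring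
  rw [e]
  refine (abs_sub _ _).trans ?_
  rw [abs_div, abs_mul, abs_of_pos (two_pos (α := ℝ)), abs_of_pos (by positivity : 0 < 4 * π)]
  refine (add_le_add (div_le_div_of_nonneg_right h2 zero_le_two)
    (mul_le_mul_of_nonneg_left h1 (by positivity))).trans_eq ?_
  ring

end LiouvillePeak

/-! ### Bound of the peak -/

namespace LiouvillePeak

variable {b C A s r ρ K Λ : ℝ} {u V : Plane → ℝ} {x₀ : Plane}

lemma exists_annulusMass_le (h : LiouvillePeak b C A s u V x₀ r) (hΛ : 1 ≤ Λ) (hρ : 0 < ρ)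
    {N : ℕ} (hN : 0 < N) (hΛN : Λ ^ N * ρ ≤ 1 - ‖x₀‖) :
    ∃ k < N, annulusMass u x₀ (Λ ^ k * ρ) Λ ≤ C / N := by
  have hN' : (0 : ℝ) < N := Nat.cast_pos.2 hN
  set I : ℕ → ℝ := fun k => ∫ y in ball x₀ (Λ ^ k * ρ), exp (u y) with hI
  have hsub {k : ℕ} (hk : k ≤ N) : ball x₀ (Λ ^ k * ρ) ⊆ unitDisc :=
    ball_subset (le_trans (by gcongr) hΛN)
  have hInt {k : ℕ} (hk : k ≤ N) :
      IntegrableOn (fun y => exp (u y)) (ball x₀ (Λ ^ k * ρ)) :=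
    IntegrableOn.mono_set h.integrable_exp (hsub hk)
  have hstep : ∀ k ∈ Finset.range N, annulusMass u x₀ (Λ ^ k * ρ) Λ = I (k + 1) - I k := by
    intro k hk
    have hk' := Finset.mem_range.1 hk
    rw [annulusMass, hI, ← mul_assoc, ← pow_succ']
    exact setIntegral_sdiff measurableSet_ball (hInt hk')
      (ball_subset_ball (by gcongr; exact k.le_succ))
  have hle : I N ≤ C := (setIntegral_mono_set h.integrable_exp
    (ae_of_all _ fun _ => (exp_pos _).le) (hsub le_rfl).eventuallyLE).trans h.mass
  have h0 : 0 ≤ I 0 := integral_nonneg fun _ => (exp_pos _).le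
  have hsum : ∑ k ∈ Finset.range N, annulusMass u x₀ (Λ ^ k * ρ) Λ ≤
      ∑ _k ∈ Finset.range N, C / N := by
    rw [Finset.sum_congr rfl hstep, Finset.sum_range_sub, Finset.sum_const, Finset.card_range,
      nsmul_eq_mul, mul_div_cancel₀ _ hN'.ne']
    linarith
  obtain ⟨k, hk, hk'⟩ := Finset.exists_le_of_sum_le (Finset.nonempty_range_iff.2 hN.ne') hsum
  exact ⟨k, Finset.mem_range.1 hk, hk'⟩

/-- A mass which satisfies the Pohozaev identity up to a small error and is not small itself is
close to `8π`. -/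
lemma le_of_abs_sq_sub_le {m : ℝ} (hm : 2 * π ≤ m)
    (hσ : |m ^ 2 - 8 * π * m| ≤ 4 * π ^ 2 * (2 - 1 / s)) : 2 * π * (2 + 1 / s) ≤ m := by
  have hπ := pi_pos
  by_contra! hlt
  have h1 : 8 * π * m - m ^ 2 ≤ 4 * π ^ 2 * (2 - 1 / s) := (abs_le.1 hσ).1 |> fun h => by linarith
  have hσ0 : 0 ≤ 2 - 1 / s := nonneg_of_mul_nonneg_right ((abs_nonneg _).trans hσ) (by positivity)
  have h2 : 2 * π * (2 - 1 / s) < 8 * π - m := by linarith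
  have h3 : 2 * π * (2 * π * (2 - 1 / s)) < m * (8 * π - m) :=
    mul_lt_mul' hm h2 (by positivity) (by linarith)
  linarith

/-- If the disc of radius `ρ ≈ r` around the peak carries mass at least `2π(2 + 1/s)`, then `r`
is bounded below. -/
lemma log_inv_le_of_discMass (h : LiouvillePeak b C A s u V x₀ r) (hs : 1 / 2 < s)
    (hr : massConst b C * r ≤ (1 - ‖x₀‖) / 2) (hρ0 : 0 < ρ) (hρ : ρ ≤ 1 - ‖x₀‖) {R : ℝ}
    (hR : ρ ≤ R * r) (hm : 2 * π * (2 + 1 / s) ≤ discMass u V x₀ ρ) :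
    log r⁻¹ ≤ (2 + 1 / s) * (log R - log (π / (20 * globalConst b C A))) / (2 * s - 1) := by
  have hπ := pi_pos
  have hr0 := h.r_pos
  have hs0 := h.s_pos
  have hδ := h.dist_pos
  have hg := h.globalConst_pos
  have hR0 : 0 < R := pos_of_mul_pos_left (hρ0.trans_le hR) hr0.le
  set δ := 1 - ‖x₀‖
  set c := π / (20 * globalConst b C A) with hc
  have hc0 : 0 < c := by positivity
  have hδr : c * r ^ (1 - s) ≤ δ := by
    have h1 := (pow_le_pow_left₀ (by positivity) (h.two_pi_le_discMass le_rfl hr) 2).trans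
      h.sq_discMass_le
    have h2 : r ^ (s - 1) * r ^ (1 - s) = 1 := by
      rw [← Real.rpow_add hr0, sub_add_sub_cancel, sub_self, Real.rpow_zero]
    have h3 : 0 < r ^ (1 - s) := Real.rpow_pos_of_pos hr0 _
    have h4 : (2 * π) ^ 2 * r ^ (1 - s) ≤ 80 * π * δ * globalConst b C A := by
      calc _ ≤ 80 * π * δ * (globalConst b C A * r ^ (s - 1)) * r ^ (1 - s) := by gcongr
        _ = 80 * π * δ * globalConst b C A * (r ^ (s - 1) * r ^ (1 - s)) := by ring
        _ = _ := by rw [h2, mul_one]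
    rw [hc, div_mul_eq_mul_div, div_le_iff₀ (by positivity)]
    have h5 : 4 * π * (π * r ^ (1 - s)) ≤ 4 * π * (δ * (20 * globalConst b C A)) := by linarith
    exact le_of_mul_le_mul_left h5 (by positivity)
  have hlogδ : log c - (1 - s) * log r⁻¹ ≤ log δ := by
    have := Real.log_le_log (by positivity) hδr
    rw [Real.log_mul hc0.ne' (Real.rpow_pos_of_pos hr0 _).ne', Real.log_rpow hr0] at this
    rw [Real.log_inv]
    linarith
  have hlogρ : log ρ ≤ log R - log r⁻¹ := by
    have := Real.log_le_log hρ0 hR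
    rw [Real.log_mul hR0.ne' hr0.ne'] at this
    rw [Real.log_inv]
    linarith
  have hlog0 : 0 ≤ log (δ / ρ) := Real.log_nonneg ((one_le_div hρ0).2 hρ)
  have h1 := (mul_le_mul_of_nonneg_right hm hlog0).trans (h.discMass_mul_log_le hρ0 hρ)
  have h2 : (2 + 1 / s) * log (δ / ρ) ≤ 2 * log r⁻¹ :=
    le_of_mul_le_mul_left (by linarith) (by positivity : 0 < 2 * π)
  have h3 : (2 + 1 / s) * (log c - log R + s * log r⁻¹) ≤ (2 + 1 / s) * log (δ / ρ) := by
    rw [Real.log_div hδ.ne' hρ0.ne']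
    have : 0 < 2 + 1 / s := by positivity
    exact mul_le_mul_of_nonneg_left (by linarith) this.le
  have h4 : (2 + 1 / s) * (s * log r⁻¹) = (2 * s + 1) * log r⁻¹ := by field_simp
  rw [le_div_iff₀ (by linarith)]
  linarith

/-- The height of a peak is bounded in terms of `b`, `C`, `A`, `s` only. -/
theorem exists_log_inv_le (hb : 0 < b) (hC : 0 < C) (hA : 0 < A) (hs : 1 / 2 < s) :
    ∃ M, ∀ u V x₀ r, LiouvillePeak b C A s u V x₀ r → log r⁻¹ ≤ M := by
  have hπ := pi_pos
  have hs0 : 0 < s := by linarith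
  obtain ⟨K, hK0, hK⟩ := exists_deriv_smoothTransition_le
  set σ := 4 * π ^ 2 * (2 - 1 / s) with hσ
  have hσ0 : 0 < σ := by
    have : 1 / s < 2 := by rw [div_lt_iff₀ hs0]; linarith
    have : 0 < 2 - 1 / s := by linarith
    positivity
  set Λ := 2 + 186 * (b * C) ^ 2 / σ with hΛ
  have hΛ2 : 2 ≤ Λ := by rw [hΛ, le_add_iff_nonneg_right]; positivity
  have hΛ0 : 0 < Λ := by linarith
  have hΛ1 : 1 ≤ Λ := by linarith
  have e1 : 62 * (b * C) ^ 2 / Λ ≤ σ / 3 := by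
    rw [div_le_iff₀ hΛ0, hΛ]
    have : σ / 3 * (2 + 186 * (b * C) ^ 2 / σ) = σ * 2 / 3 + 62 * (b * C) ^ 2 := by
      field_simp; ring
    linarith
  set c₂ := 2 * (1 + 5 * K) * b * (b * C) + 4 * π * b * (2 + 5 * K) with hc₂
  have hc₂0 : 0 < c₂ := by positivity
  obtain ⟨N, hN⟩ := exists_nat_gt (3 * c₂ * C / σ)
  have hN0' : (0 : ℝ) < N := lt_of_le_of_lt (by positivity) hN
  have hN0 : 0 < N := Nat.cast_pos.1 hN0'
  have e2 : c₂ * (C / N) ≤ σ / 3 := by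
    rw [div_lt_iff₀ hσ0] at hN
    rw [← mul_div_assoc, div_le_iff₀ hN0']
    linarith
  set R := Λ ^ N * massConst b C with hR
  set D := 4 * π * A * C * (3 * gradConst b C * R + 2) * R ^ s with hD
  refine ⟨max (max (R * potentialConst b C / π) (log (3 * D / σ) / s))
    ((2 + 1 / s) * (log R - log (π / (20 * globalConst b C A))) / (2 * s - 1)),
    fun u V x₀ r h => ?_⟩
  have hr := h.r_pos
  have hG := h.gradConst_pos
  have hM := h.one_le_massConst
  have hM0 : 0 < massConst b C := one_pos.trans_le hM
  have hR0 : 0 < R := by positivity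
  have hD0 : 0 < D := by positivity
  rcases lt_or_ge (1 - ‖x₀‖) (2 * (R * r)) with hδ | hδ
  · refine le_max_of_le_left (le_max_of_le_left ?_)
    have hP := h.potentialConst_pos
    have h1 : (1 - ‖x₀‖) * (potentialConst b C / r) ≤ 2 * (R * r) * (potentialConst b C / r) := by
      gcongr
    have h2 : 2 * (R * r) * (potentialConst b C / r) = 2 * (R * potentialConst b C) := by
      field_simp
    rw [le_div_iff₀ hπ]
    linarith [h.log_inv_le]
  rcases lt_or_ge (σ / 3) (D * r ^ s) with hDr | hDr
  · refine le_max_of_le_left (le_max_of_le_right ?_)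
    rw [le_div_iff₀ hs0, mul_comm, ← Real.log_rpow (inv_pos.2 hr), Real.inv_rpow hr.le]
    refine Real.log_le_log (by positivity) ?_
    rw [inv_le_comm₀ (by positivity) (by positivity), inv_div, div_le_iff₀ (by positivity)]
    linarith
  refine le_max_of_le_right ?_
  have hRr : Λ ^ N * (massConst b C * r) = R * r := by rw [hR, mul_assoc]
  have hRr0 : 0 < R * r := by positivity
  obtain ⟨k, hk, hann⟩ := h.exists_annulusMass_le hΛ1 (mul_pos hM0 hr) hN0
    (by rw [hRr]; linarith)
  set ρ := Λ ^ k * (massConst b C * r) with hρ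
  have hρ0 : 0 < ρ := by positivity
  have hρΛ : Λ * ρ ≤ R * r := by
    rw [← hRr, hρ, ← mul_assoc, ← pow_succ']
    gcongr
    exact hk
  have hρR : ρ ≤ R * r := (le_mul_of_one_le_left hρ0.le hΛ1).trans hρΛ
  have hMρ : massConst b C * r ≤ ρ := le_mul_of_one_le_left (by positivity) (one_le_pow₀ hΛ1)
  refine h.log_inv_le_of_discMass hs (by linarith) hρ0 (by linarith) hρR
    (le_of_abs_sq_sub_le (h.two_pi_le_discMass (by linarith) hMρ) ?_)
  have e3 : 4 * π * A * C * (3 * gradConst b C * (ρ / r) + 2) * ρ ^ s ≤ σ / 3 := by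
    refine le_trans ?_ hDr
    have h1 : ρ / r ≤ R := (div_le_iff₀ hr).2 hρR
    have h2 : ρ ^ s ≤ R ^ s * r ^ s := by
      rw [← Real.mul_rpow hR0.le hr.le]; gcongr
    calc _ ≤ 4 * π * A * C * (3 * gradConst b C * R + 2) * (R ^ s * r ^ s) := by gcongr
      _ = _ := by rw [hD]; ring
  have e4 := (mul_le_mul_of_nonneg_left hann hc₂0.le).trans e2
  exact (h.abs_sq_discMass_sub_le hρ0 hΛ2 (by linarith) fun t => (hK t).1).trans (by linarith)

end LiouvillePeak

/-- Theorem 2: a uniform a priori bound for solutions of `-Δu = V e^u` on the unit ball of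
`ℝ²` with zero boundary data, `0 ≤ V ≤ b` `s`-Hölder (`1/2 < s ≤ 1`), `∫ e^u ≤ C` and total
curvature `∫ V e^u ≤ 40π - ε`. -/
theorem compactness_below_40pi
    (b C A s ε : ℝ) (hb : 0 < b) (hC : 0 < C) (hA : 0 < A)
    (hs1 : 1 / 2 < s) (hs2 : s ≤ 1) (hε : 0 < ε) :
    ∃ c : ℝ,
      ∀ u V : EuclideanSpace ℝ (Fin 2) → ℝ,
        ContDiffOn ℝ 2 u (ball (0 : EuclideanSpace ℝ (Fin 2)) 1) →
        ContinuousOn u (closedBall (0 : EuclideanSpace ℝ (Fin 2)) 1) →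
        (∀ x ∈ closedBall (0 : EuclideanSpace ℝ (Fin 2)) 1, 0 ≤ V x) →
        (∀ x ∈ closedBall (0 : EuclideanSpace ℝ (Fin 2)) 1, V x ≤ b) →
        (∀ x ∈ closedBall (0 : EuclideanSpace ℝ (Fin 2)) 1,
          ∀ y ∈ closedBall (0 : EuclideanSpace ℝ (Fin 2)) 1,
            |V x - V y| ≤ A * ‖x - y‖ ^ s) →
        (∀ x ∈ ball (0 : EuclideanSpace ℝ (Fin 2)) 1, -lap u x = V x * exp (u x)) →
        (∀ x ∈ sphere (0 : EuclideanSpace ℝ (Fin 2)) 1, u x = 0) →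
        (∫ y in ball (0 : EuclideanSpace ℝ (Fin 2)) 1, exp (u y)) ≤ C →
        (∫ y in ball (0 : EuclideanSpace ℝ (Fin 2)) 1, V y * exp (u y)) ≤ 40 * π - ε →
        ∀ x ∈ ball (0 : EuclideanSpace ℝ (Fin 2)) 1, u x ≤ c := by
  obtain ⟨M, hM⟩ := LiouvillePeak.exists_log_inv_le hb hC hA hs1
  refine ⟨max 0 (2 * M), fun u V hu huc hV0 hVb hVA heq hbd hmass _ x hx => ?_⟩
  obtain ⟨x₀, hx₀, hmax⟩ := (isCompact_closedBall (0 : EuclideanSpace ℝ (Fin 2)) 1).exists_isMaxOn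
    ⟨0, mem_closedBall_self zero_le_one⟩ huc
  have hxx₀ : u x ≤ u x₀ := hmax (ball_subset_closedBall hx)
  rcases le_or_gt (u x₀) 0 with h0 | h0
  · exact le_max_of_le_left (hxx₀.trans h0)
  refine le_max_of_le_right (hxx₀.trans ?_)
  have hx₀1 : ‖x₀‖ < 1 := by
    refine (mem_closedBall_zero_iff.1 hx₀).lt_of_ne fun h => ?_
    exact h0.ne' (hbd x₀ (mem_sphere_zero_iff_norm.2 h))
  have hr : (exp (-(u x₀ / 2)) ^ 2)⁻¹ = exp (u x₀) := by
    rw [← exp_nat_mul, ← exp_neg]; congr 1; push_cast; ring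
  have h := hM u V x₀ (exp (-(u x₀ / 2)))
    { b_pos := hb, C_pos := hC, A_pos := hA, s_pos := by linarith, s_le_one := hs2
      r_pos := exp_pos _
      r_le_one := exp_le_one_iff.2 (by linarith)
      norm_lt := hx₀1, contDiffOn := hu, continuousOn := huc, boundary := hbd, eq := heq
      nonneg := hV0, le := hVb, holder := hVA, mass := hmass
      exp_le := fun y hy => hr ▸ exp_le_exp.2 (hmax (ball_subset_closedBall hy))
      exp_eq := hr.symm }
  rw [log_inv, log_exp] at h
  linarith
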